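/- arXiv:2406.17371 — 4 statements merged into one kernel-verified Lean document; each statement's English description precedes it below -/
import Mathlib

section
/- Let G be a 2-connected bipartite graph with bipartition (X, Y) and let P be a path in G from u to v. If u ∈ X and v ∈ Y, then G contains a cycle of length at least min{|V(P)|, 2(d_P(u) + d_P(v) - 1)}. -/
/-- A finite simple graph is 2-connected if it has at least 3 vertices and
deleting any single vertex leaves a connected graph. -/
def IsTwoConnected {V : Type*} [Fintype V] (G : SimpleGraph V) : Prop :=
  3 ≤ Fintype.card V ∧
    ∀ v : V, ((⊤ : G.Subgraph).deleteVerts {v}).coe.Connected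

namespace BipPosa
open SimpleGraph

variable {V : Type*} [DecidableEq V] {G : SimpleGraph V}

/-- There is a path from `a` to `b` with vertex set `S`. -/
def Pa (G : SimpleGraph V) (a b : V) (S : Finset V) : Prop :=
  ∃ w : G.Walk a b, w.IsPath ∧ w.support.toFinset = S

lemma Pa.refl (a : V) : Pa G a a {a} := ⟨Walk.nil, by simp, by simp⟩

lemma Pa.symm {a b : V} {S : Finset V} (h : Pa G a b S) : Pa G b a S := by
  obtain ⟨w, hw, rfl⟩ := h
  exact ⟨w.reverse, hw.reverse, by simp⟩

lemma Pa.left_mem {a b : V} {S : Finset V} (h : Pa G a b S) : a ∈ S := by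
  obtain ⟨w, hw, rfl⟩ := h
  simp

lemma Pa.right_mem {a b : V} {S : Finset V} (h : Pa G a b S) : b ∈ S := by
  obtain ⟨w, hw, rfl⟩ := h
  simp

lemma Pa.append {a b c : V} {S T : Finset V} (h : Pa G a b S) (h' : Pa G b c T)
    (hd : ∀ z ∈ S, z ∈ T → z = b) : Pa G a c (S ∪ T) := by
  obtain ⟨w, hw, rfl⟩ := h
  obtain ⟨w', hw', rfl⟩ := h'
  refine ⟨w.append w', ?_, ?_⟩
  · rw [Walk.isPath_def, Walk.support_append, List.nodup_append]
    have h1 := hw'.support_nodup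
    have h2 := w'.cons_tail_support
    rw [← h2, List.nodup_cons] at h1
    refine ⟨hw.support_nodup, h1.2, ?_⟩
    intro z hz y hy hzy
    subst hzy
    have := hd z (by simpa using hz) (by simpa using List.mem_of_mem_tail hy)
    subst this
    exact h1.1 hy
  · ext z
    simp [Walk.mem_support_append_iff]

lemma Pa.edge {a b : V} (h : G.Adj a b) : Pa G a b {a, b} :=
  ⟨Walk.cons h Walk.nil, by simp [h.ne], by simp⟩

lemma Pa.join {a b c d : V} {S T : Finset V} (h : Pa G a b S) (h' : Pa G c d T)
    (e : G.Adj b c) (hd : ∀ z ∈ S, z ∉ T) : Pa G a d (S ∪ T) := by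
  have h1 := h.append (Pa.edge e) (by
    intro z hz hz'
    simp only [Finset.mem_insert, Finset.mem_singleton] at hz'
    rcases hz' with rfl | rfl
    · rfl
    · exact absurd h'.left_mem (hd _ hz))
  have h2 := h1.append h' (by
    intro z hz hz'
    have := hd z
    have := h.right_mem
    simp only [Finset.mem_insert, Finset.mem_singleton, Finset.mem_union] at hz
    rcases hz with hz | rfl | rfl <;> tauto)
  convert h2 using 1
  have := h.right_mem
  have := h'.left_mem
  ext z
  simp only [Finset.mem_insert, Finset.mem_singleton, Finset.mem_union]
  constructor
  · tauto
  · rintro ((h | rfl | rfl) | h) <;> tauto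

lemma Pa.split {a b c : V} {S : Finset V} (h : Pa G a b S) (hc : c ∈ S) :
    ∃ S1 S2, Pa G a c S1 ∧ Pa G c b S2 ∧ S1 ⊆ S ∧ S2 ⊆ S ∧ ∀ z ∈ S1, z ∈ S2 → z = c := by
  obtain ⟨w, hw, rfl⟩ := h
  have hc' : c ∈ w.support := by simpa using hc
  refine ⟨_, _, ⟨w.takeUntil c hc', hw.takeUntil hc', rfl⟩,
    ⟨w.dropUntil c hc', hw.dropUntil hc', rfl⟩, ?_, ?_, ?_⟩
  · intro z hz
    simp only [List.mem_toFinset] at *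
    exact w.support_takeUntil_subset_support hc' hz
  · intro z hz
    simp only [List.mem_toFinset] at *
    exact w.support_dropUntil_subset_support hc' hz
  · intro z hz hz'
    simp only [List.mem_toFinset] at *
    have h1 := hw.support_nodup
    rw [← w.take_spec hc', Walk.support_append, List.nodup_append] at h1
    rw [← Walk.cons_tail_support, List.mem_cons] at hz'
    rcases hz' with h | h
    · exact h
    · exact absurd rfl (h1.2.2 z hz z h)

lemma Pa.cycle {a b : V} {S : Finset V} (h : Pa G a b S) (e : G.Adj b a) (h3 : 3 ≤ S.card) :
    ∃ (w : V) (c : G.Walk w w), c.IsCycle ∧ c.length = S.card := by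
  obtain ⟨w, hw, rfl⟩ := h
  have hcard : w.support.toFinset.card = w.length + 1 := by
    rw [List.toFinset_card_of_nodup hw.support_nodup, Walk.length_support]
  refine ⟨b, Walk.cons e w, ?_, ?_⟩
  · rw [Walk.cons_isCycle_iff]
    refine ⟨hw, fun hmem => ?_⟩
    rw [Sym2.eq_swap] at hmem
    have := hw.length_eq_one_of_mem_edges hmem
    omega
  · simp [hcard]

lemma Pa.card_bip {X Y : Finset V} (hdisj : Disjoint X Y)
    (hbip : ∀ x y : V, G.Adj x y → (x ∈ X ∧ y ∈ Y) ∨ (x ∈ Y ∧ y ∈ X))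
    {a b : V} {S : Finset V} (h : Pa G a b S) (hb : b ∈ Y) :
    (a ∈ X → S.card = 2 * (S ∩ Y).card) ∧ (a ∈ Y → S.card + 1 = 2 * (S ∩ Y).card) := by
  obtain ⟨w, hw, rfl⟩ := h
  have hd := Finset.disjoint_left.1 hdisj
  induction w with
  | nil =>
    refine ⟨fun h => absurd hb (hd h), fun h => ?_⟩
    simp [hb]
  | @cons u v w e p ih =>
    rw [Walk.cons_isPath_iff] at hw
    have ih := ih hb hw.1
    have hu : u ∉ p.support.toFinset := by simpa using hw.2
    have e1 : (Walk.cons e p).support.toFinset = insert u p.support.toFinset := by simp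
    rw [e1, Finset.card_insert_of_notMem hu]
    have := hbip _ _ e
    constructor
    · intro h
      rw [Finset.insert_inter_of_notMem (hd h)]
      have h2 : v ∈ Y := by
        rcases this with h' | h'
        · exact h'.2
        · exact absurd h'.1 (hd h)
      exact ih.2 h2
    · intro h
      rw [Finset.insert_inter_of_mem h, Finset.card_insert_of_notMem (by simp [hw.2])]
      have h2 : v ∈ X := by
        rcases this with h' | h'
        · exact absurd h (hd h'.1)
        · exact h'.2
      have := ih.1 h2
      omega

lemma Pa.seg {x : ℕ → V} {n : ℕ} (hinj : Set.InjOn x {k | k ≤ n})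
    (hadj : ∀ k < n, G.Adj (x k) (x (k + 1))) {i j : ℕ} (hij : i ≤ j) (hj : j ≤ n) :
    Pa G (x i) (x j) ((Finset.Icc i j).image x) := by
  induction j, hij using Nat.le_induction with
  | base => simpa using Pa.refl (x i)
  | succ j hij ih =>
    have := (ih (by omega)).join (Pa.refl (x (j+1))) (hadj j (by omega)) (by
      intro z hz hz'
      simp only [Finset.mem_image, Finset.mem_Icc, Finset.mem_singleton] at *
      obtain ⟨k, hk, rfl⟩ := hz
      have := hinj (show k ≤ n by omega) (show j + 1 ≤ n by omega) hz'
      omega)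
    convert this using 1
    ext z
    simp only [Finset.mem_image, Finset.mem_Icc, Finset.mem_singleton, Finset.mem_union]
    constructor
    · rintro ⟨k, hk, rfl⟩
      by_cases h : k = j + 1
      · right; rw [h]
      · left; exact ⟨k, by omega, rfl⟩
    · rintro (⟨k, hk, rfl⟩ | rfl)
      · exact ⟨k, by omega, rfl⟩
      · exact ⟨j + 1, by omega, rfl⟩

lemma Pa.trimLeft {b : V} (Z : Finset V) : ∀ (m : ℕ) {a : V} {S : Finset V}, S.card ≤ m →
    Pa G a b S → a ∈ Z →
    ∃ a' S', Pa G a' b S' ∧ a' ∈ Z ∧ S' ⊆ S ∧ ∀ z ∈ S', z ∈ Z → z = a' := by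
  intro m
  induction m with
  | zero =>
    intro a S hS h
    have := Finset.card_pos.2 ⟨_, h.left_mem⟩
    omega
  | succ m ih =>
    intro a S hS h ha
    by_cases hz : ∀ z ∈ S, z ∈ Z → z = a
    · exact ⟨a, S, h, ha, subset_rfl, hz⟩
    · push Not at hz
      obtain ⟨z, hzS, hzZ, hza⟩ := hz
      obtain ⟨S1, S2, h1, h2, hs1, hs2, hd⟩ := h.split hzS
      have hlt : S2.card < S.card := by
        apply Finset.card_lt_card
        refine ⟨hs2, fun hh => hza ?_⟩
        exact (hd a h1.left_mem (hh h.left_mem)).symm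
      obtain ⟨a', S', g1, g2, g3, g4⟩ := ih (by omega) h2 hzZ
      exact ⟨a', S', g1, g2, g3.trans hs2, g4⟩

lemma Pa.trim {a b : V} {S : Finset V} (Z B : Finset V) (h : Pa G a b S) (ha : a ∈ Z)
    (hb : b ∈ B) :
    ∃ a' b' S', Pa G a' b' S' ∧ a' ∈ Z ∧ b' ∈ B ∧ S' ⊆ S ∧ (∀ z ∈ S', z ∈ Z → z = a') ∧
      ∀ z ∈ S', z ∈ B → z = b' := by
  obtain ⟨a', S', h1, h2, h3, h4⟩ := Pa.trimLeft Z _ le_rfl h ha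
  obtain ⟨b', S'', g1, g2, g3, g4⟩ := Pa.trimLeft B _ le_rfl h1.symm hb
  have ha' : a' ∈ S'' := g1.right_mem
  exact ⟨a', b', S'', g1.symm, h2, g2, g3.trans h3, fun z hz => h4 z (g3 hz), g4⟩

lemma conn [Fintype V] (hG : IsTwoConnected G) (z a b : V) (ha : a ≠ z) (hb : b ≠ z) :
    ∃ S, Pa G a b S ∧ z ∉ S := by
  have h := hG.2 z
  obtain ⟨w, hw⟩ := (h.preconnected ⟨a, by simp [ha]⟩ ⟨b, by simp [hb]⟩).exists_isPath
  refine ⟨_, ⟨w.map (Subgraph.hom _), Walk.IsPath.map Subgraph.hom_injective hw, rfl⟩, ?_⟩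
  intro hz
  have hz := List.mem_toFinset.1 hz
  have hz2 := (Walk.support_map (Subgraph.hom _) w) ▸ hz
  obtain ⟨⟨y, hy⟩, _, h⟩ := List.mem_map.1 hz2
  have h' : y = z := h
  subst h'
  simp at hy

lemma cycle_exists [Fintype V] (hG : IsTwoConnected G) {u v : V} (e : G.Adj u v) :
    ∃ (w : V) (c : G.Walk w w), c.IsCycle ∧ 2 ≤ c.length := by
  obtain ⟨z, hz⟩ : ∃ z, z ∉ ({u, v} : Finset V) := by
    by_contra! h
    have h1 : (Finset.univ : Finset V) ⊆ {u, v} := fun z _ => h z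
    have h2 := Finset.card_le_card h1
    have h3 : ({u, v} : Finset V).card ≤ 2 := Finset.card_le_two
    have := hG.1
    rw [Finset.card_univ] at h2
    omega
  simp only [Finset.mem_insert, Finset.mem_singleton, not_or] at hz
  obtain ⟨S, ⟨w, hw, rfl⟩, huS⟩ := conn hG u v z e.ne' hz.1
  cases w with
  | nil => exact absurd rfl hz.2
  | @cons _ y _ h p =>
    have hyu : y ≠ u := by
      rintro rfl
      simp at huS
    obtain ⟨T, hT, hvT⟩ := conn hG v y u h.ne' e.ne
    have h1 := (Pa.refl v).join hT h (by simpa using hvT)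
    have h3 : 3 ≤ ({v} ∪ T).card := by
      rw [← Finset.insert_eq, Finset.card_insert_of_notMem hvT]
      have : ({y, u} : Finset V) ⊆ T := by
        intro z hz
        simp only [Finset.mem_insert, Finset.mem_singleton] at hz
        rcases hz with rfl | rfl
        · exact hT.left_mem
        · exact hT.right_mem
      have := Finset.card_le_card this
      rw [Finset.card_pair hyu] at this
      omega
    obtain ⟨w, c, hc, hl⟩ := h1.cycle e h3
    exact ⟨w, c, hc, by omega⟩

/-- One step: extend a path ending at `x r` to `x (r+1)` if necessary. -/
lemma ext_step {s y y' z : V} {S : Finset V} (h : Pa G s y S) (e : G.Adj y' z)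
    (hy : y = z ∨ y = y' ∧ z ∉ S) : ∃ S', Pa G s z S' ∧ S' ⊆ insert z S := by
  rcases hy with rfl | ⟨rfl, hz⟩
  · exact ⟨S, h, Finset.subset_insert _ _⟩
  · refine ⟨_, h.join (Pa.refl z) e (by rintro w hw hw'; simp at hw'; subst hw'; exact hz hw), ?_⟩
    intro w
    simp only [Finset.mem_union, Finset.mem_singleton, Finset.mem_insert]
    tauto

lemma two_paths {x : ℕ → V} {n : ℕ} (hinj : Set.InjOn x {k | k ≤ n})
    (hadj : ∀ k < n, G.Adj (x k) (x (k + 1)))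
    (hconn : ∀ z a b : V, a ≠ z → b ≠ z → ∃ S, Pa G a b S ∧ z ∉ S)
    {p : ℕ} (hp : 1 ≤ p) {r : ℕ} (hpr : p ≤ r) (hr : r < n) :
    ∃ a b y1 y2 S1 S2, a < p ∧ r < b ∧ b ≤ n ∧ Pa G (x p) y1 S1 ∧ Pa G (x a) y2 S2 ∧
      (∀ z ∈ S1, z ∉ S2) ∧ (y1 = x r ∧ y2 = x b ∨ y1 = x b ∧ y2 = x r) ∧
      (∀ k < p, x k ∉ S1) ∧ (∀ k < p, x k ∈ S2 → k = a) ∧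
      (∀ k, r < k → k ≤ n → x k ∈ S1 ∨ x k ∈ S2 → k = b) := by
  have inj : ∀ i j, i ≤ n → j ≤ n → x i = x j → i = j := fun i j hi hj h => hinj hi hj h
  induction r, hpr using Nat.le_induction with
  | base =>
    obtain ⟨S, hS, hpS⟩ := hconn (x p) (x 0) (x n)
      (fun h => by have := inj _ _ (by omega) (by omega) h; omega)
      (fun h => by have := inj _ _ (by omega) (by omega) h; omega)
    obtain ⟨a', b', S', h1, h2, h3, h4, h5, h6⟩ := hS.trim ((Finset.range p).image x)
      ((Finset.Icc (p+1) n).image x)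
      (Finset.mem_image_of_mem x (by simp; omega)) (Finset.mem_image_of_mem x (by simp; omega))
    simp only [Finset.mem_image, Finset.mem_range, Finset.mem_Icc] at h2 h3
    obtain ⟨a, ha, rfl⟩ := h2
    obtain ⟨b, hb, rfl⟩ := h3
    refine ⟨a, b, x p, x b, {x p}, S', ha, by omega, by omega, Pa.refl _, h1, ?_, Or.inl ⟨rfl, rfl⟩,
      ?_, ?_, ?_⟩
    · intro z hz hz'
      rw [Finset.mem_singleton] at hz
      subst hz
      exact hpS (h4 hz')
    · intro k hk h
      rw [Finset.mem_singleton] at h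
      have := inj _ _ (by omega) (by omega) h
      omega
    · intro k hk h
      exact inj _ _ (by omega) (by omega) (h5 _ h (Finset.mem_image_of_mem x (by simpa using hk)))
    · intro k hk hk' h
      rw [Finset.mem_singleton] at h
      rcases h with h | h
      · have := inj _ _ (by omega) (by omega) h
        omega
      · exact inj _ _ (by omega) (by omega)
          (h6 _ h (Finset.mem_image_of_mem x (by simp; omega)))
  | succ r hpr ih =>
    obtain ⟨a, b, y1, y2, S1, S2, ha, hb, hbn, hP1, hP2, hd, hy, hS1, hS2, hS⟩ := ih (by omega)
    have hrr : G.Adj (x r) (x (r+1)) := hadj r (by omega)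
    by_cases hbr : b = r + 1
    · subst hbr
      have hm1 := hP1.right_mem
      have hm2 := hP2.right_mem
      have hy1 : x (r+1) ∈ S1 → y1 = x (r+1) := by
        intro h
        rcases hy with ⟨e1, e2⟩ | ⟨e1, e2⟩
        · exact absurd (e2 ▸ hm2) (hd _ h)
        · exact e1
      have hy2 : x (r+1) ∈ S2 → y2 = x (r+1) := by
        intro h
        rcases hy with ⟨e1, e2⟩ | ⟨e1, e2⟩
        · exact e2
        · exact absurd h (hd _ (e1 ▸ hm1))
      obtain ⟨E1, hE1, hE1s⟩ := ext_step hP1 hrr (by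
        rcases hy with ⟨e1, e2⟩ | ⟨e1, e2⟩
        · exact Or.inr ⟨e1, fun h => hd _ h (e2 ▸ hm2)⟩
        · exact Or.inl e1)
      obtain ⟨E2, hE2, hE2s⟩ := ext_step hP2 hrr (by
        rcases hy with ⟨e1, e2⟩ | ⟨e1, e2⟩
        · exact Or.inl e2
        · exact Or.inr ⟨e2, fun h => hd _ (e1 ▸ hm1) h⟩)
      obtain ⟨T, hT, hrT⟩ := hconn (x (r+1)) (x 0) (x n)
        (fun h => by have := inj _ _ (by omega) (by omega) h; omega)
        (fun h => by have := inj _ _ (by omega) (by omega) h; omega)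
      obtain ⟨w, b', S', h1, h2, h3, h4, h5, h6⟩ := hT.trim
        ((Finset.range p).image x ∪ S1 ∪ S2)
        ((Finset.Icc (r+2) n).image x)
        (by
          simp only [Finset.mem_union]
          exact Or.inl (Or.inl (Finset.mem_image_of_mem x (by simp; omega))))
        (Finset.mem_image_of_mem x (by simp; omega))
      have hrS' : x (r+1) ∉ S' := fun h => hrT (h4 h)
      have hwr : w ≠ x (r+1) := fun h => hrS' (h ▸ h1.left_mem)
      have h5a : ∀ k < p, x k ∈ S' → x k = w := fun k hk h => h5 _ h (by
        simp only [Finset.mem_union]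
        exact Or.inl (Or.inl (Finset.mem_image_of_mem x (by simpa using hk))))
      have h51 : ∀ z ∈ S', z ∈ S1 → z = w := fun z h h' => h5 _ h (by simp [h'])
      have h52 : ∀ z ∈ S', z ∈ S2 → z = w := fun z h h' => h5 _ h (by simp [h'])
      simp only [Finset.mem_image, Finset.mem_Icc] at h3
      obtain ⟨b, hb', rfl⟩ := h3
      have h6' : ∀ k, r + 1 < k → k ≤ n → x k ∈ S' → k = b := fun k hk hk' h =>
        inj _ _ (by omega) (by omega) (h6 _ h (Finset.mem_image_of_mem x (by simp; omega)))
      have hnot1 : ∀ k, r + 1 < k → k ≤ n → x k ∉ S1 := fun k hk hk' h => by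
        have := hS k (by omega) hk' (Or.inl h)
        omega
      have hnot2 : ∀ k, r + 1 < k → k ≤ n → x k ∉ S2 := fun k hk hk' h => by
        have := hS k (by omega) hk' (Or.inr h)
        omega
      have hne : ∀ k ≤ n, k ≠ r + 1 → x k ≠ x (r + 1) := fun k hk hk' h =>
        hk' (inj _ _ hk (by omega) h)
      have hE1m : ∀ z ∈ E1, z = x (r+1) ∨ z ∈ S1 := fun z hz => Finset.mem_insert.1 (hE1s hz)
      have hE2m : ∀ z ∈ E2, z = x (r+1) ∨ z ∈ S2 := fun z hz => Finset.mem_insert.1 (hE2s hz)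
      by_cases hw1 : w ∈ S1
      · obtain ⟨C, D, hC, hD, hCs, hDs, hCD⟩ := hP1.split hw1
        have hrC : x (r+1) ∉ C := by
          intro h
          have e := hy1 (hCs h)
          exact hwr (hCD _ h (e ▸ hD.right_mem)).symm
        have hN := hC.append h1 (fun z hz hz' => h51 z hz' (hCs hz))
        refine ⟨a, b, x b, x (r+1), C ∪ S', E2, ha, by omega, by omega, hN, hE2, ?_,
          Or.inr ⟨rfl, rfl⟩, ?_, ?_, ?_⟩
        · intro z hz hz'
          rcases Finset.mem_union.1 hz with hz | hz <;> rcases hE2m z hz' with rfl | hz'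
          · exact hrC hz
          · exact hd _ (hCs hz) hz'
          · exact hrS' hz
          · have := h52 z hz hz'
            subst this
            exact hd _ hw1 hz'
        · intro k hk hz
          rcases Finset.mem_union.1 hz with hz | hz
          · exact hS1 k hk (hCs hz)
          · exact hS1 k hk (h5a k hk hz ▸ hw1)
        · intro k hk hz
          rcases hE2m _ hz with hz | hz
          · exact absurd hz (hne k (by omega) (by omega))
          · exact hS2 k hk hz
        · intro k hk hk' hz
          rcases hz with hz | hz
          · rcases Finset.mem_union.1 hz with hz | hz
            · exact absurd (hCs hz) (hnot1 k hk hk')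
            · exact h6' k hk hk' hz
          · rcases hE2m _ hz with hz | hz
            · exact absurd hz (hne k (by omega) (by omega))
            · exact absurd hz (hnot2 k hk hk')
      · have hE1' : ∀ k < p, x k ∉ E1 := by
          intro k hk hz
          rcases hE1m _ hz with hz | hz
          · exact absurd hz (hne k (by omega) (by omega))
          · exact hS1 k hk hz
        have hE1'' : ∀ k, r + 1 < k → k ≤ n → x k ∉ E1 := by
          intro k hk hk' hz
          rcases hE1m _ hz with hz | hz
          · exact absurd hz (hne k (by omega) (by omega))
          · exact absurd hz (hnot1 k hk hk')
        have hE1S : ∀ z ∈ E1, z ∉ S' := by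
          intro z hz hz'
          rcases hE1m _ hz with rfl | hz
          · exact hrS' hz'
          · exact hw1 (h51 z hz' hz ▸ hz)
        by_cases hw2 : w ∈ S2
        · obtain ⟨C, D, hC, hD, hCs, hDs, hCD⟩ := hP2.split hw2
          have hrC : x (r+1) ∉ C := by
            intro h
            have e := hy2 (hCs h)
            exact hwr (hCD _ h (e ▸ hD.right_mem)).symm
          have hN := hC.append h1 (fun z hz hz' => h52 z hz' (hCs hz))
          refine ⟨a, b, x (r+1), x b, E1, C ∪ S', ha, by omega, by omega, hE1, hN, ?_,
            Or.inl ⟨rfl, rfl⟩, hE1', ?_, ?_⟩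
          · intro z hz hz'
            rcases Finset.mem_union.1 hz' with hz' | hz'
            · rcases hE1m z hz with rfl | hz
              · exact hrC hz'
              · exact hd _ hz (hCs hz')
            · exact hE1S z hz hz'
          · intro k hk hz
            rcases Finset.mem_union.1 hz with hz | hz
            · exact hS2 k hk (hCs hz)
            · exact hS2 k hk (h5a k hk hz ▸ hw2)
          · intro k hk hk' hz
            rcases hz with hz | hz
            · exact absurd hz (hE1'' k hk hk')
            · rcases Finset.mem_union.1 hz with hz | hz
              · exact absurd (hCs hz) (hnot2 k hk hk')
              · exact h6' k hk hk' hz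
        · have hwA : w ∈ (Finset.range p).image x := by
            simp only [Finset.mem_union] at h2
            tauto
          simp only [Finset.mem_image, Finset.mem_range] at hwA
          obtain ⟨a', ha', rfl⟩ := hwA
          refine ⟨a', b, x (r+1), x b, E1, S', ha', by omega, by omega, hE1, h1, hE1S,
            Or.inl ⟨rfl, rfl⟩, hE1', ?_, ?_⟩
          · intro k hk hz
            exact inj _ _ (by omega) (by omega) (h5a k hk hz)
          · intro k hk hk' hz
            rcases hz with hz | hz
            · exact absurd hz (hE1'' k hk hk')
            · exact h6' k hk hk' hz
    ·
      have hn1 : x (r+1) ∉ S1 := fun h => by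
        have := hS (r+1) (by omega) (by omega) (Or.inl h)
        omega
      have hn2 : x (r+1) ∉ S2 := fun h => by
        have := hS (r+1) (by omega) (by omega) (Or.inr h)
        omega
      have hne : ∀ k ≤ n, k ≠ r + 1 → x k ≠ x (r + 1) := fun k hk hk' h =>
        hk' (inj _ _ hk (by omega) h)
      rcases hy with ⟨rfl, rfl⟩ | ⟨rfl, rfl⟩
      · obtain ⟨E1, hE1, hE1s⟩ := ext_step hP1 hrr (Or.inr ⟨rfl, hn1⟩)
        have hE1m : ∀ z ∈ E1, z = x (r+1) ∨ z ∈ S1 := fun z hz => Finset.mem_insert.1 (hE1s hz)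
        refine ⟨a, b, _, _, E1, S2, ha, by omega, hbn, hE1, hP2, ?_, Or.inl ⟨rfl, rfl⟩, ?_, hS2, ?_⟩
        · intro z hz hz'
          rcases hE1m z hz with rfl | hz
          · exact hn2 hz'
          · exact hd _ hz hz'
        · intro k hk hz
          rcases hE1m _ hz with hz | hz
          · exact absurd hz (hne k (by omega) (by omega))
          · exact hS1 k hk hz
        · intro k hk hk' hz
          rcases hz with hz | hz
          · rcases hE1m _ hz with hz | hz
            · exact absurd hz (hne k (by omega) (by omega))
            · exact hS k (by omega) hk' (Or.inl hz)
          · exact hS k (by omega) hk' (Or.inr hz)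
      · obtain ⟨E2, hE2, hE2s⟩ := ext_step hP2 hrr (Or.inr ⟨rfl, hn2⟩)
        have hE2m : ∀ z ∈ E2, z = x (r+1) ∨ z ∈ S2 := fun z hz => Finset.mem_insert.1 (hE2s hz)
        refine ⟨a, b, _, _, S1, E2, ha, by omega, hbn, hP1, hE2, ?_, Or.inr ⟨rfl, rfl⟩, hS1, ?_, ?_⟩
        · intro z hz hz'
          rcases hE2m z hz' with rfl | hz'
          · exact hn1 hz
          · exact hd _ hz hz'
        · intro k hk hz
          rcases hE2m _ hz with hz | hz
          · exact absurd hz (hne k (by omega) (by omega))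
          · exact hS2 k hk hz
        · intro k hk hk' hz
          rcases hz with hz | hz
          · exact hS k (by omega) hk' (Or.inl hz)
          · rcases hE2m _ hz with hz | hz
            · exact absurd hz (hne k (by omega) (by omega))
            · exact hS k (by omega) hk' (Or.inr hz)


lemma final [DecidableRel G.Adj] {X Y : Finset V} (hdisj : Disjoint X Y)
    (hbip : ∀ x y : V, G.Adj x y → (x ∈ X ∧ y ∈ Y) ∨ (x ∈ Y ∧ y ∈ X))
    {x : ℕ → V} {n : ℕ} (hinj : Set.InjOn x {k | k ≤ n})
    (hadj : ∀ k < n, G.Adj (x k) (x (k + 1))) (h0 : x 0 ∈ X) (hn : x n ∈ Y)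
    {s t : V} {S : Finset V} {i : ℕ} (hS : Pa G s t S) (hs : s ∈ X) (ht : t ∈ Y)
    (e : G.Adj t s) (h3 : 3 ≤ S.card)
    (hu : ∀ k ≤ n, G.Adj (x 0) (x k) → x k ∈ S)
    (hv : ∀ k < n, k ≠ i → G.Adj (x n) (x k) → x (k + 1) ∈ S)
    (hdj : ∀ k < n, k ≠ i → G.Adj (x n) (x k) → ¬ G.Adj (x 0) (x (k + 1))) :
    ∃ (w : V) (c : G.Walk w w), c.IsCycle ∧
      2 * (((Finset.range (n+1)).filter (fun k => G.Adj (x 0) (x k))).card +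
        ((Finset.range (n+1)).filter (fun k => G.Adj (x n) (x k))).card - 1) ≤ c.length := by
  obtain ⟨w, c, hc, hl⟩ := hS.cycle e h3
  refine ⟨w, c, hc, ?_⟩
  rw [hl, (hS.card_bip hdisj hbip ht).1 hs]
  have hd := Finset.disjoint_left.1 hdisj
  set Nu := (Finset.range (n+1)).filter (fun k => G.Adj (x 0) (x k)) with hNu
  set Nv := (Finset.range (n+1)).filter (fun k => G.Adj (x n) (x k)) with hNv
  have hNvn : ∀ k ∈ Nv, k < n ∧ G.Adj (x n) (x k) := by
    intro k hk
    rw [hNv, Finset.mem_filter, Finset.mem_range] at hk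
    refine ⟨?_, hk.2⟩
    have : k ≠ n := by
      rintro rfl
      exact G.loopless.irrefl _ hk.2
    omega
  have hYu : ∀ k, G.Adj (x 0) (x k) → x k ∈ Y := by
    intro k hk
    rcases hbip _ _ hk with h | h
    · exact h.2
    · exact absurd h.1 (hd h0)
  have hYv : ∀ k < n, G.Adj (x n) (x k) → x (k+1) ∈ Y := by
    intro k hkn hk
    have hX : x k ∈ X := by
      rcases hbip _ _ hk with h | h
      · exact absurd hn (hd h.1)
      · exact h.2
    rcases hbip _ _ (hadj k hkn) with h | h
    · exact h.2
    · exact absurd h.1 (hd hX)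
  set M := (Nv.erase i).image (· + 1) with hM
  have hMc : Nv.card - 1 ≤ M.card := by
    rw [hM, Finset.card_image_of_injective _ (add_left_injective 1)]
    exact Finset.pred_card_le_card_erase
  have hMm : ∀ m ∈ M, ∃ k, k < n ∧ k ≠ i ∧ G.Adj (x n) (x k) ∧ m = k + 1 := by
    intro m hm
    simp only [hM, Finset.mem_image, Finset.mem_erase] at hm
    obtain ⟨k, hk, rfl⟩ := hm
    exact ⟨k, (hNvn k hk.2).1, hk.1, (hNvn k hk.2).2, rfl⟩
  have hdis : Disjoint Nu M := by
    rw [Finset.disjoint_left]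
    intro m hm hm'
    obtain ⟨k, h1, h2, h3, rfl⟩ := hMm m hm'
    exact hdj k h1 h2 h3 (Finset.mem_filter.1 hm).2
  have hsub : (Nu ∪ M).image x ⊆ S ∩ Y := by
    intro z hz
    simp only [Finset.mem_image, Finset.mem_union] at hz
    obtain ⟨m, hm | hm, rfl⟩ := hz
    · rw [hNu, Finset.mem_filter, Finset.mem_range] at hm
      exact Finset.mem_inter.2 ⟨hu m (by omega) hm.2, hYu m hm.2⟩
    · obtain ⟨k, h1, h2, h3, rfl⟩ := hMm m hm
      exact Finset.mem_inter.2 ⟨hv k h1 h2 h3, hYv k h1 h3⟩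
  have hcard := Finset.card_le_card hsub
  rw [Finset.card_image_of_injOn, Finset.card_union_of_disjoint hdis] at hcard
  · omega
  · intro m hm m' hm' h
    have : ∀ m ∈ Nu ∪ M, m ≤ n := by
      intro m hm
      rcases Finset.mem_union.1 hm with hm | hm
      · rw [hNu, Finset.mem_filter, Finset.mem_range] at hm
        omega
      · obtain ⟨k, h1, h2, h3, rfl⟩ := hMm m hm
        omega
    exact hinj (this m hm) (this m' hm') h

lemma three_le {S : Finset V} {a b c : V} (ha : a ∈ S) (hb : b ∈ S) (hc : c ∈ S) (hab : a ≠ b)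
    (hac : a ≠ c) (hbc : b ≠ c) : 3 ≤ S.card := by
  have h : ({a, b, c} : Finset V) ⊆ S := by
    intro z hz
    simp only [Finset.mem_insert, Finset.mem_singleton] at hz
    rcases hz with rfl | rfl | rfl <;> assumption
  have := Finset.card_le_card h
  rwa [Finset.card_eq_three.2 ⟨a, b, c, hab, hac, hbc, rfl⟩] at this

lemma main [Fintype V] [DecidableRel G.Adj] (hG : IsTwoConnected G)
    {X Y : Finset V} (hdisj : Disjoint X Y)
    (hbip : ∀ x y : V, G.Adj x y → (x ∈ X ∧ y ∈ Y) ∨ (x ∈ Y ∧ y ∈ X))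
    {x : ℕ → V} {n : ℕ} (hinj : Set.InjOn x {k | k ≤ n})
    (hadj : ∀ k < n, G.Adj (x k) (x (k + 1))) (h0 : x 0 ∈ X) (hn : x n ∈ Y) :
    ∃ (w : V) (c : G.Walk w w), c.IsCycle ∧ min (n + 1)
      (2 * (((Finset.range (n+1)).filter (fun k => G.Adj (x 0) (x k))).card +
        ((Finset.range (n+1)).filter (fun k => G.Adj (x n) (x k))).card - 1)) ≤ c.length := by
  have inj : ∀ i j, i ≤ n → j ≤ n → x i = x j → i = j := fun i j hi hj h => hinj hi hj h
  have hd := Finset.disjoint_left.1 hdisj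
  have hn0 : n ≠ 0 := by
    rintro rfl
    exact hd h0 hn
  have hXv : ∀ k, G.Adj (x n) (x k) → x k ∈ X := by
    intro k hk
    rcases hbip _ _ hk with h | h
    · exact absurd hn (hd h.1)
    · exact h.2
  have hYu : ∀ k, G.Adj (x 0) (x k) → x k ∈ Y := by
    intro k hk
    rcases hbip _ _ hk with h | h
    · exact h.2
    · exact absurd h.1 (hd h0)
  by_cases hn1 : n = 1
  · subst hn1
    obtain ⟨w, c, hc, hl⟩ := cycle_exists hG (hadj 0 (by omega))
    exact ⟨w, c, hc, le_trans (min_le_left _ _) hl⟩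
  have a01 : G.Adj (x 0) (x 1) := hadj 0 (by omega)
  have ann : G.Adj (x n) (x (n-1)) := by
    have := hadj (n-1) (by omega)
    rw [show n - 1 + 1 = n by omega] at this
    exact this.symm
  by_cases hcr : ∃ d i, i + d + 1 ≤ n ∧ G.Adj (x n) (x i) ∧ G.Adj (x 0) (x (i + d + 1))
  ·
    classical
    obtain ⟨i, hjn, hvi, huj⟩ := Nat.find_spec hcr
    have hmin : ∀ d' i', d' < Nat.find hcr → i' + d' + 1 ≤ n → G.Adj (x n) (x i') →
        ¬ G.Adj (x 0) (x (i' + d' + 1)) := fun d' i' h h1 h2 h3 =>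
      Nat.find_min hcr h ⟨i', h1, h2, h3⟩
    generalize Nat.find hcr = d at *
    obtain ⟨j, hj⟩ : ∃ j, j = i + d + 1 := ⟨_, rfl⟩
    rw [← hj] at hjn huj
    have hpath := (Pa.seg hinj hadj (Nat.zero_le i) (by omega)).symm.join
      (Pa.seg hinj hadj hjn le_rfl) huj (by
        intro z hz hz'
        simp only [Finset.mem_image, Finset.mem_Icc] at hz hz'
        obtain ⟨k, hk, rfl⟩ := hz
        obtain ⟨k', hk', h⟩ := hz'
        have := inj _ _ (by omega) (by omega) h
        omega)
    set S := (Finset.Icc 0 i).image x ∪ (Finset.Icc j n).image x with hSdef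
    have hmem : ∀ k, k ≤ i ∨ j ≤ k ∧ k ≤ n → x k ∈ S := by
      intro k hk
      rw [hSdef, Finset.mem_union]
      rcases hk with hk | hk
      · exact Or.inl (Finset.mem_image_of_mem x (by simpa using hk))
      · exact Or.inr (Finset.mem_image_of_mem x (by simpa using hk))
    have hne : ∀ a b, a ≤ n → b ≤ n → a ≠ b → x a ≠ x b := fun a b ha hb hab h =>
      hab (inj a b ha hb h)
    have h3 : 3 ≤ S.card := by
      by_cases hi : i = 0
      · have hj' : j ≠ n := by
          intro hjn'
          refine hmin 0 0 (by omega) (by omega) (hi ▸ hvi) (by simpa using a01)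
        exact three_le (hmem 0 (by omega)) (hmem j (by omega)) (hmem n (by omega))
          (hne _ _ (by omega) (by omega) (by omega)) (hne _ _ (by omega) (by omega) (by omega))
          (hne _ _ (by omega) (by omega) (by omega))
      · exact three_le (hmem 0 (by omega)) (hmem i (by omega)) (hmem n (by omega))
          (hne _ _ (by omega) (by omega) (by omega)) (hne _ _ (by omega) (by omega) (by omega))
          (hne _ _ (by omega) (by omega) (by omega))
    by_cases hd0 : d = 0
    · obtain ⟨w, c, hc, hl⟩ := hpath.cycle hvi h3
      refine ⟨w, c, hc, le_trans (min_le_left _ _) ?_⟩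
      rw [hl]
      have : (Finset.range (n+1)).image x ⊆ S := by
        intro z hz
        simp only [Finset.mem_image, Finset.mem_range] at hz
        obtain ⟨k, hk, rfl⟩ := hz
        exact hmem k (by omega)
      have := Finset.card_le_card this
      rw [Finset.card_image_of_injOn] at this
      · simpa using this
      · intro a ha b hb h
        simp only [Finset.coe_range, Set.mem_Iio] at ha hb
        exact inj a b (by omega) (by omega) h
    · obtain ⟨w, c, hc, hl⟩ := final hdisj hbip hinj hadj h0 hn (i := i) hpath (hXv i hvi) hn hvi h3
        (by
          intro k hk hk'
          apply hmem
          by_contra hcon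
          refine hmin (k - i - 1) i (by omega) (by omega) hvi ?_
          rwa [show i + (k - i - 1) + 1 = k by omega])
        (by
          intro k hk hki hk'
          apply hmem
          by_contra hcon
          refine hmin (j - k - 1) k (by omega) (by omega) hk' ?_
          rwa [show k + (j - k - 1) + 1 = j by omega])
        (by
          intro k hk hki hk' hk''
          exact hmin 0 k (by omega) (by omega) hk' hk'')
      exact ⟨w, c, hc, le_trans (min_le_right _ _) hl⟩
  ·
    have hnc : ∀ i j, j ≤ n → G.Adj (x n) (x i) → G.Adj (x 0) (x j) → j ≤ i := by
      intro i j hj hi hj'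
      by_contra hcon
      refine hcr ⟨j - i - 1, i, by omega, hi, ?_⟩
      rwa [show i + (j - i - 1) + 1 = j by omega]
    obtain ⟨p, ⟨hpn, hup⟩, hpmax⟩ : ∃ p, (p ≤ n ∧ G.Adj (x 0) (x p)) ∧
        ∀ k ≤ n, G.Adj (x 0) (x k) → k ≤ p := by
      refine ⟨Nat.findGreatest (fun k => G.Adj (x 0) (x k)) n,
        ⟨Nat.findGreatest_le n, Nat.findGreatest_spec (P := fun k => G.Adj (x 0) (x k))
          (show 1 ≤ n by omega) a01⟩, fun k hk h => Nat.le_findGreatest hk h⟩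
    obtain ⟨q, ⟨hqn, hvq⟩, hqmin⟩ : ∃ q, (q < n ∧ G.Adj (x n) (x q)) ∧
        ∀ k, G.Adj (x n) (x k) → q ≤ k := by
      have hex : ∃ k, G.Adj (x n) (x k) := ⟨_, ann⟩
      refine ⟨Nat.find hex, ⟨?_, Nat.find_spec hex⟩, fun k hk => Nat.find_min' hex hk⟩
      have := Nat.find_min' hex ann
      omega
    have hp1 : 1 ≤ p := hpmax 1 (by omega) a01
    have hpq : p < q := by
      have h1 := hnc q p hpn hvq hup
      have h2 : p ≠ q := by
        rintro rfl
        exact hd (hXv p hvq) (hYu p hup)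
      omega
    obtain ⟨a, b, y1, y2, S1, S2, ha, hb, hbn, hP1, hP2, hdj, hy, hS1, hS2, hS⟩ :=
      two_paths hinj hadj (conn hG) hp1 hpq.le hqn
    obtain ⟨p', ⟨hap', hup'⟩, hp'min⟩ : ∃ p', (a < p' ∧ G.Adj (x 0) (x p')) ∧
        ∀ k, a < k → G.Adj (x 0) (x k) → p' ≤ k := by
      have hex : ∃ k, a < k ∧ G.Adj (x 0) (x k) := ⟨p, ha, hup⟩
      exact ⟨Nat.find hex, Nat.find_spec hex, fun k hk hk' => Nat.find_min' hex ⟨hk, hk'⟩⟩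
    have hp'p : p' ≤ p := hp'min p ha hup
    obtain ⟨q', ⟨hq'b, hvq'⟩, hq'max⟩ : ∃ q', (q' < b ∧ G.Adj (x n) (x q')) ∧
        ∀ k, k < b → G.Adj (x n) (x k) → k ≤ q' := by
      have h := Nat.findGreatest_spec (P := fun k => G.Adj (x n) (x k))
          (show q ≤ b - 1 by omega) hvq
      have h2 := Nat.findGreatest_le (P := fun k => G.Adj (x n) (x k)) (b - 1)
      exact ⟨Nat.findGreatest (fun k => G.Adj (x n) (x k)) (b - 1), ⟨by omega, h⟩,
        fun k hk hk' => Nat.le_findGreatest (by omega) hk'⟩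
    have hqq' : q ≤ q' := hqmin q' hvq'
    have hD1 := (Pa.seg hinj hadj hp'p hpn).symm.join
      (Pa.seg hinj hadj (Nat.zero_le a) (by omega)) hup'.symm (by
        intro z hz hz'
        simp only [Finset.mem_image, Finset.mem_Icc] at hz hz'
        obtain ⟨k, hk, rfl⟩ := hz
        obtain ⟨k', hk', h⟩ := hz'
        have := inj _ _ (by omega) (by omega) h
        omega)
    set D := (Finset.Icc p' p).image x ∪ (Finset.Icc 0 a).image x with hD
    have hDm : ∀ z, z ∈ D → ∃ k, k ≤ p ∧ (p' ≤ k ∨ k ≤ a) ∧ z = x k := by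
      intro z hz
      simp only [hD, Finset.mem_union, Finset.mem_image, Finset.mem_Icc] at hz
      rcases hz with ⟨k, hk, rfl⟩ | ⟨k, hk, rfl⟩
      · exact ⟨k, by omega, by omega, rfl⟩
      · exact ⟨k, by omega, by omega, rfl⟩
    have hDm' : ∀ k, k ≤ p → (p' ≤ k ∨ k ≤ a) → x k ∈ D := by
      intro k hk h
      simp only [hD, Finset.mem_union, Finset.mem_image, Finset.mem_Icc]
      rcases h with h | h
      · exact Or.inl ⟨k, by omega, rfl⟩
      · exact Or.inr ⟨k, by omega, rfl⟩
    have hL1 := hP1.symm.append hD1 (by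
      intro z hz hz'
      obtain ⟨k, hk, _, rfl⟩ := hDm z hz'
      by_cases h : k = p
      · rw [h]
      · exact absurd hz (hS1 k (by omega)))
    have hL2 := hL1.append hP2 (by
      intro z hz hz'
      rcases Finset.mem_union.1 hz with hz | hz
      · exact absurd hz' (hdj z hz)
      · obtain ⟨k, hk, _, rfl⟩ := hDm z hz
        by_cases h : k = p
        · subst h
          exact absurd hz' (hdj _ hP1.left_mem)
        · rw [hS2 k (by omega) hz'])
    set L := S1 ∪ D ∪ S2 with hLdef
    have hL : Pa G (x q) (x b) L := by
      rcases hy with ⟨rfl, rfl⟩ | ⟨rfl, rfl⟩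
      · exact hL2
      · exact hL2.symm
    have hLk : ∀ k, q < k → k ≤ n → x k ∈ L → k = b := by
      intro k hk hkn h
      simp only [hLdef, Finset.mem_union] at h
      rcases h with (h | h) | h
      · exact hS k hk hkn (Or.inl h)
      · obtain ⟨k', hk', _, h'⟩ := hDm _ h
        have := inj _ _ (by omega) (by omega) h'
        omega
      · exact hS k hk hkn (Or.inr h)
    have hM1 := (Pa.seg hinj hadj hqq' (by omega)).symm.append hL (by
      intro z hz hz'
      simp only [Finset.mem_image, Finset.mem_Icc] at hz
      obtain ⟨k, hk, rfl⟩ := hz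
      by_cases h : k = q
      · rw [h]
      · have := hLk k (by omega) (by omega) hz'
        omega)
    have hM2 := hM1.append (Pa.seg hinj hadj hbn le_rfl) (by
      intro z hz hz'
      simp only [Finset.mem_image, Finset.mem_Icc] at hz'
      obtain ⟨k, hk, rfl⟩ := hz'
      rcases Finset.mem_union.1 hz with hz | hz
      · simp only [Finset.mem_image, Finset.mem_Icc] at hz
        obtain ⟨k', hk', h⟩ := hz
        have := inj _ _ (by omega) (by omega) h
        omega
      · rw [hLk k (by omega) (by omega) hz])
    set S := (Finset.Icc q q').image x ∪ L ∪ (Finset.Icc b n).image x with hSdef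
    have hSL : ∀ z ∈ L, z ∈ S := fun z hz => by simp [hSdef, hz]
    have hSD : ∀ z ∈ D, z ∈ S := fun z hz => by simp [hSdef, hLdef, hz]
    have hSq : ∀ k, q ≤ k → k ≤ q' → x k ∈ S := by
      intro k h1 h2
      have := Finset.mem_image_of_mem x (Finset.mem_Icc.2 ⟨h1, h2⟩)
      simp only [hSdef, Finset.mem_union]
      tauto
    have hSb : ∀ k, b ≤ k → k ≤ n → x k ∈ S := by
      intro k h1 h2
      have := Finset.mem_image_of_mem x (Finset.mem_Icc.2 ⟨h1, h2⟩)
      simp only [hSdef, Finset.mem_union]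
      tauto
    have hne : ∀ a b, a ≤ n → b ≤ n → a ≠ b → x a ≠ x b := fun a b ha hb hab h =>
      hab (inj a b ha hb h)
    have h3 : 3 ≤ S.card :=
      three_le (hSD _ (hDm' p le_rfl (by omega))) (hSq q le_rfl hqq') (hSb b le_rfl hbn)
        (hne _ _ (by omega) (by omega) (by omega)) (hne _ _ (by omega) (by omega) (by omega))
        (hne _ _ (by omega) (by omega) (by omega))
    obtain ⟨w, c, hc, hl⟩ := final hdisj hbip hinj hadj h0 hn (i := q') hM2 (hXv q' hvq') hn hvq' h3
      (by
        intro k hk hk'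
        apply hSD
        apply hDm' k (hpmax k hk hk')
        by_cases h : k ≤ a
        · exact Or.inr h
        · exact Or.inl (hp'min k (by omega) hk'))
      (by
        intro k hk hki hk'
        have h1 := hqmin k hk'
        by_cases h : k < b
        · have := hq'max k h hk'
          exact hSq _ (by omega) (by omega)
        · exact hSb _ (by omega) (by omega))
      (by
        intro k hk hki hk' hk''
        have h1 := hqmin k hk'
        have h2 := hpmax (k+1) (by omega) hk''
        omega)
    exact ⟨w, c, hc, le_trans (min_le_right _ _) hl⟩

lemma deg_le [Fintype V] [DecidableRel G.Adj] {u v : V} (P : G.Walk u v) (a : V) :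
    (P.support.toFinset ∩ G.neighborFinset a).card ≤
      ((Finset.range (P.length+1)).filter (fun k => G.Adj a (P.getVert k))).card := by
  refine le_trans (Finset.card_le_card ?_) (Finset.card_image_le (f := P.getVert))
  intro z hz
  simp only [Finset.mem_inter, List.mem_toFinset, mem_neighborFinset] at hz
  obtain ⟨k, rfl, hk⟩ := Walk.mem_support_iff_exists_getVert.1 hz.1
  exact Finset.mem_image_of_mem _ (by simp; exact ⟨by omega, hz.2⟩)

end BipPosa

/-- Bipartite analogue of Pósa's lemma, part (i): if `G` is a 2-connected bipartite graph
with parts `X, Y` and `P` is a `u`–`v` path with `u ∈ X` and `v ∈ Y`, then `G` contains a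
cycle of length at least `min {|V(P)|, 2(d_P(u) + d_P(v) - 1)}`. -/
theorem stmt_5 {V : Type*} [Fintype V] [DecidableEq V]
    (G : SimpleGraph V) [DecidableRel G.Adj]
    (X Y : Finset V) (hdisj : Disjoint X Y) (hunion : X ∪ Y = Finset.univ)
    (hbip : ∀ x y : V, G.Adj x y → (x ∈ X ∧ y ∈ Y) ∨ (x ∈ Y ∧ y ∈ X))
    (hG : IsTwoConnected G)
    (u v : V) (hu : u ∈ X) (hv : v ∈ Y) (P : G.Walk u v) (hP : P.IsPath) :
    ∃ (w : V) (c : G.Walk w w), c.IsCycle ∧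
      min P.support.length
        (2 * ((P.support.toFinset ∩ G.neighborFinset u).card
              + (P.support.toFinset ∩ G.neighborFinset v).card - 1)) ≤ c.length := by
  obtain ⟨w, c, hc, hl⟩ := BipPosa.main hG hdisj hbip (x := P.getVert) (n := P.length)
    hP.getVert_injOn (fun k hk => P.adj_getVert_succ hk) (by simpa using hu) (by simpa using hv)
  refine ⟨w, c, hc, le_trans ?_ hl⟩
  have h1 := BipPosa.deg_le P u
  have h2 := BipPosa.deg_le P v
  simp only [SimpleGraph.Walk.getVert_zero, SimpleGraph.Walk.getVert_length,
    SimpleGraph.Walk.length_support]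
  apply min_le_min le_rfl
  omega
end

section
/- Let G be a 2-connected bipartite graph with bipartition (X, Y) and let P be a path in G from u to v with u, v ∈ X. Then G contains a cycle of length at least min{|V(P)| - 1, 2(d_P(u) + d_P(v) - 2)}. -/
namespace PosaBip

open SimpleGraph

variable {V : Type*} {G : SimpleGraph V}

theorem append_isPath {a b c : V} (p : G.Walk a b) (q : G.Walk b c) (hp : p.IsPath) (hq : q.IsPath)
    (h : ∀ x ∈ p.support, x ∈ q.support → x = b) : (p.append q).IsPath := by
  rw [Walk.isPath_def, Walk.support_append, List.nodup_append]
  refine ⟨hp.support_nodup, hq.support_nodup.tail, ?_⟩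
  intro x hx y hy hxy
  subst hxy
  have h1 := h x hx (List.mem_of_mem_tail hy)
  subst h1
  have h2 := hq.support_nodup
  rw [← Walk.cons_tail_support q] at h2
  exact (List.nodup_cons.1 h2).1 hy

theorem close_cycle {x y : V} (p : G.Walk y x) (hp : p.IsPath) (hl : 2 ≤ p.length)
    (h : G.Adj x y) : ∃ (w : V) (c : G.Walk w w), c.IsCycle ∧ c.length = p.length + 1 := by
  refine ⟨x, Walk.cons h p, ?_, by simp⟩
  rw [Walk.cons_isCycle_iff]
  refine ⟨hp, ?_⟩
  cases p with
  | nil => simp at hl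
  | cons h' q =>
    rename_i c
    rw [Walk.cons_isPath_iff] at hp
    intro he
    rw [Walk.edges_cons, List.mem_cons] at he
    rcases he with he | he
    · have hc : c = x := by
        rw [Sym2.eq_iff] at he
        rcases he with ⟨h1, h2⟩ | ⟨h1, h2⟩
        · exact absurd h1 h.ne
        · exact h1.symm
      subst hc
      have := Walk.isPath_iff_nil.1 hp.1
      have h3 := Walk.length_eq_zero_iff.2 this
      simp [h3] at hl
    · exact hp.2 (Walk.snd_mem_support_of_mem_edges q he)

/-- Avoiding connectivity. -/
def AvoidConn (G : SimpleGraph V) : Prop :=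
  ∀ f x y : V, x ≠ f → y ≠ f → ∃ W : G.Walk x y, f ∉ W.support

theorem avoidConn_of [Fintype V] (hG : IsTwoConnected G) : AvoidConn G := by
  intro f x y hx hy
  have hc := hG.2 f
  have hx' : x ∈ ((⊤ : G.Subgraph).deleteVerts {f}).verts := by simp [hx]
  have hy' : y ∈ ((⊤ : G.Subgraph).deleteVerts {f}).verts := by simp [hy]
  obtain ⟨W⟩ := hc.preconnected ⟨x, hx'⟩ ⟨y, hy'⟩
  suffices key : f ∉ (W.map (Subgraph.hom _)).support from ⟨W.map (Subgraph.hom _), key⟩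
  rw [Walk.support_map]
  intro hf
  rw [List.mem_map] at hf
  obtain ⟨z, _, hz⟩ := hf
  have h1 := z.2
  have h2 : (z : V) = f := hz
  rw [h2] at h1
  simp at h1

theorem ear [DecidableEq V] (hG : AvoidConn G) (C D : Set V) (f c d : V) (hc : c ∈ C) (hd : d ∈ D)
    (hcf : c ≠ f) (hdf : d ≠ f) :
    ∃ z ∈ C, ∃ b ∈ D, ∃ R : G.Walk z b, R.IsPath ∧ f ∉ R.support ∧
      (∀ x ∈ R.support, x ∈ C → x = z) ∧ (∀ x ∈ R.support, x ∈ D → x = b) := by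
  classical
  have hex : ∃ n : ℕ, ∃ z ∈ C, ∃ b ∈ D, ∃ R : G.Walk z b, f ∉ R.support ∧ R.length = n := by
    obtain ⟨W, hW⟩ := hG f c d hcf hdf
    exact ⟨_, c, hc, d, hd, W, hW, rfl⟩
  obtain ⟨z, hz, b, hb, R, hR, hlen⟩ := Nat.find_spec hex
  have hmin : ∀ z' ∈ C, ∀ b' ∈ D, ∀ R' : G.Walk z' b', f ∉ R'.support → R.length ≤ R'.length := by
    intro z' hz' b' hb' R' hR'
    rw [hlen]
    exact Nat.find_min' hex ⟨z', hz', b', hb', R', hR', rfl⟩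
  refine ⟨z, hz, b, hb, R.bypass, R.bypass_isPath,
    fun h => hR (R.support_bypass_subset_support h), ?_, ?_⟩
  · intro x hx hxC
    have hx := R.support_bypass_subset_support hx
    by_contra hne
    have hx' : x ∈ R.reverse.support := by simpa using hx
    have h1 := Walk.length_takeUntil_lt_length (p := R.reverse) hx' hne
    have h2 := hmin x hxC b hb (R.reverse.takeUntil x hx').reverse (by
      rw [Walk.support_reverse, List.mem_reverse]
      intro h
      have := Walk.support_takeUntil_subset_support _ hx' h
      exact hR (by simpa using this))
    simp at h1 h2
    omega
  · intro x hx hxC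
    have hx := R.support_bypass_subset_support hx
    by_contra hne
    have h1 := Walk.length_takeUntil_lt_length (p := R) hx hne
    have h2 := hmin z hz x hxC (R.takeUntil x hx) (by
      intro h
      exact hR (Walk.support_takeUntil_subset_support _ hx h))
    omega

/-- Two disjoint paths from `s1, s2` to `f` and another vertex of `B`. -/
def Sys (G : SimpleGraph V) (A B : Set V) (f s1 s2 : V) : Prop :=
  ∃ b ∈ B, b ≠ f ∧ ∃ (Q : G.Walk s1 f) (R : G.Walk s2 b), Q.IsPath ∧ R.IsPath ∧
    (∀ x ∈ Q.support, x ∉ R.support) ∧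
    (∀ x ∈ Q.support, x ∈ A → x = s1) ∧ (∀ x ∈ R.support, x ∈ A → x = s2) ∧
    (∀ x ∈ Q.support, x ∈ B → x = f) ∧ (∀ x ∈ R.support, x ∈ B → x = b)

/-- joining a path with an ear -/
theorem join [DecidableEq V] {s z b w : V} (Q : G.Walk s w) (hz : z ∈ Q.support)
    (R : G.Walk z b) : ∃ T : G.Walk s b, T.IsPath ∧
      ∀ x ∈ T.support, x ∈ (Q.takeUntil z hz).support ∨ x ∈ R.support := by
  refine ⟨((Q.takeUntil z hz).append R).bypass, Walk.bypass_isPath _, ?_⟩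
  intro x hx
  have := Walk.support_bypass_subset_support _ hx
  rwa [Walk.mem_support_append_iff] at this

theorem step [DecidableEq V] (hG : AvoidConn G) (A B : Set V) (g f s1 s2 : V)
    (hgf : G.Adj g f) (hg : g ∉ B) (hf : f ∈ B) (hAB : Disjoint A B)
    (hB : ∃ b ∈ B, b ≠ f) (hs1 : s1 ∈ A) (hs2 : s2 ∈ A)
    (h : Sys G A (insert g B) g s1 s2) :
    Sys G A B f s1 s2 ∨ Sys G A B f s2 s1 ∨
      ∃ z ∈ A, z ≠ s1 ∧ z ≠ s2 ∧ Sys G A B f s1 z ∧ Sys G A B f s2 z := by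
  obtain ⟨b, hb, hbg, Q, R, hQ, hR, hdis, hQA, hRA, hQB, hRB⟩ := h
  have hAB' : ∀ x ∈ A, x ∉ B := fun x hx hx' => Set.disjoint_left.1 hAB hx hx'
  have hbB : b ∈ B := by
    rcases hb with hb | hb
    · exact absurd hb hbg
    · exact hb
  have hQB' : ∀ x ∈ Q.support, x ∉ B := by
    intro x hx hxB
    have := hQB x hx (Or.inr hxB)
    subst this
    exact hg hxB
  have hRB' : ∀ x ∈ R.support, x ∈ B → x = b := fun x hx hxB => hRB x hx (Or.inr hxB)
  have hfQ : f ∉ Q.support := fun h => hQB' f h hf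
  have hQ1 : (Q.concat hgf).IsPath := hQ.concat hfQ hgf
  have hQ1s : ∀ x ∈ (Q.concat hgf).support, x ∈ Q.support ∨ x = f := by
    intro x hx
    simpa [Walk.support_concat] using hx
  have hfA : f ∉ A := fun h => hAB' f h hf
  have hQ1A : ∀ x ∈ (Q.concat hgf).support, x ∈ A → x = s1 := by
    intro x hx hxA
    rcases hQ1s x hx with h | h
    · exact hQA x h hxA
    · subst h; exact absurd hxA hfA
  have hQ1B : ∀ x ∈ (Q.concat hgf).support, x ∈ B → x = f := by
    intro x hx hxA
    rcases hQ1s x hx with h | h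
    · exact absurd hxA (hQB' x h)
    · exact h
  by_cases hbf : b = f
  · subst hbf
    obtain ⟨b0, hb0, hb0f⟩ := hB
    obtain ⟨z, hz, b', hb', T, hT, hfT, hTC, hTB⟩ := ear hG
      (A ∪ {x | x ∈ Q.support} ∪ {x | x ∈ R.support}) B b s1 b0 (Or.inl (Or.inl hs1)) hb0
      (fun h => hfA (h ▸ hs1)) hb0f
    have hb'f : b' ≠ b := by
      rintro rfl
      exact hfT T.end_mem_support
    have hzf : z ≠ b := by
      rintro rfl
      exact hfT T.start_mem_support
    by_cases hzQ : z ∈ Q.support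
    · right; left
      obtain ⟨U, hU, hUs⟩ := join Q hzQ T
      have hsub := Walk.support_takeUntil_subset_support Q hzQ
      refine ⟨b', hb', hb'f, R, U, hR, hU, ?_, hRA, ?_, hRB', ?_⟩
      · intro x hxR hxU
        rcases hUs x hxU with h | h
        · exact hdis x (hsub h) hxR
        · have := hTC x h (Or.inr hxR)
          subst this
          exact hdis x hzQ hxR
      · intro x hxU hxA
        rcases hUs x hxU with h | h
        · exact hQA x (hsub h) hxA
        · have := hTC x h (Or.inl (Or.inl hxA))
          subst this
          exact hQA x hzQ hxA
      · intro x hxU hxB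
        rcases hUs x hxU with h | h
        · exact absurd hxB (hQB' x (hsub h))
        · exact hTB x h hxB
    · by_cases hzR : z ∈ R.support
      · left
        obtain ⟨U, hU, hUs⟩ := join R hzR T
        have hsub := Walk.support_takeUntil_subset_support R hzR
        have hend := Walk.endpoint_notMem_support_takeUntil hR hzR (Ne.symm hzf)
        refine ⟨b', hb', hb'f, Q.concat hgf, U, hQ1, hU, ?_, hQ1A, ?_, hQ1B, ?_⟩
        · intro x hxQ hxU
          rcases hQ1s x hxQ with hxQ | rfl
          · rcases hUs x hxU with h | h
            · exact hdis x hxQ (hsub h)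
            · have := hTC x h (Or.inl (Or.inr hxQ))
              subst this
              exact hzQ hxQ
          · rcases hUs x hxU with h | h
            · exact hend h
            · exact hfT h
        · intro x hxU hxA
          rcases hUs x hxU with h | h
          · exact hRA x (hsub h) hxA
          · have := hTC x h (Or.inl (Or.inl hxA))
            subst this
            exact hRA x hzR hxA
        · intro x hxU hxB
          rcases hUs x hxU with h | h
          · have := hRB' x (hsub h) hxB
            subst this
            exact absurd h hend
          · exact hTB x h hxB
      · right; right
        have hzA : z ∈ A := by
          rcases hz with (h | h) | h
          · exact h
          · exact absurd h hzQ
          · exact absurd h hzR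
        have hTA : ∀ x ∈ T.support, x ∈ A → x = z :=
          fun x hx hxA => hTC x hx (Or.inl (Or.inl hxA))
        refine ⟨z, hzA, ?_, ?_, ?_, ?_⟩
        · rintro rfl; exact hzQ Q.start_mem_support
        · rintro rfl; exact hzR R.start_mem_support
        · refine ⟨b', hb', hb'f, Q.concat hgf, T, hQ1, hT, ?_, hQ1A, hTA, hQ1B, hTB⟩
          intro x hxQ hxT
          rcases hQ1s x hxQ with hxQ | rfl
          · have := hTC x hxT (Or.inl (Or.inr hxQ))
            subst this
            exact hzQ hxQ
          · exact hfT hxT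
        · refine ⟨b', hb', hb'f, R, T, hR, hT, ?_, hRA, hTA, hRB', hTB⟩
          intro x hxQ hxT
          have := hTC x hxT (Or.inr hxQ)
          subst this
          exact hzR hxQ
  · left
    refine ⟨b, hbB, hbf, Q.concat hgf, R, hQ1, hR, ?_, hQ1A, hRA, hQ1B, hRB'⟩
    intro x hx hxR
    rcases hQ1s x hx with h | h
    · exact hdis x h hxR
    · subst h
      exact hbf (hRB' x hxR hf).symm

/-- The disjoint paths lemma; the linking path is given as a sequence `y 0, …, y n`. -/
theorem linkage [DecidableEq V] (hG : AvoidConn G) (A : Set V) (y : ℕ → V) (n : ℕ)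
    (hinj : ∀ i ≤ n, ∀ j ≤ n, y i = y j → i = j)
    (hadj : ∀ i < n, G.Adj (y i) (y (i + 1)))
    (hA0 : y 0 ∈ A) (hA : ∀ i ≤ n, y i ∈ A → i = 0) (hA1 : ∃ a ∈ A, a ≠ y 0)
    (B : Set V) (hBn : y n ∈ B) (hB : ∀ i ≤ n, y i ∈ B → i = n) (hB1 : ∃ b ∈ B, b ≠ y n)
    (hAB : ∀ x ∈ A, x ∈ B → x = y 0 ∧ x = y n) :
    ∃ a ∈ A, a ≠ y 0 ∧ (Sys G A B (y n) (y 0) a ∨ Sys G A B (y n) a (y 0)) := by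
  induction n generalizing B with
  | zero =>
    obtain ⟨a0, ha0, ha0e⟩ := hA1
    obtain ⟨b0, hb0, hb0e⟩ := hB1
    obtain ⟨z, hz, b, hb, R, hR, hf, hRA, hRB⟩ := ear hG A B (y 0) a0 b0 ha0 hb0 ha0e hb0e
    have hze : z ≠ y 0 := by
      rintro rfl; exact hf R.start_mem_support
    have hbe : b ≠ y 0 := by
      rintro rfl; exact hf R.end_mem_support
    refine ⟨z, hz, hze, Or.inl ⟨b, hb, hbe, Walk.nil, R, by simp, hR, ?_, ?_, hRA, ?_, hRB⟩⟩
    · simpa using hf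
    · simp
    · simp
  | succ n ih =>
    have hne : y 0 ≠ y (n + 1) := fun h => by
      have := hinj 0 (by omega) (n + 1) (by omega) h
      omega
    have hdis : Disjoint A B := by
      rw [Set.disjoint_left]
      intro x hx hxB
      obtain ⟨h1, h2⟩ := hAB x hx hxB
      exact hne (h1.symm.trans h2)
    have hnB : y n ∉ B := fun h => by
      have := hB n (by omega) h
      omega
    obtain ⟨a, ha, hae, hS⟩ := ih (fun i hi j hj => hinj i (by omega) j (by omega))
      (fun i hi => hadj i (by omega)) (fun i hi => hA i (by omega)) (insert (y n) B)
      (Or.inl rfl) (by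
        intro i hi h
        rcases h with h | h
        · exact hinj i (by omega) n (by omega) h
        · have := hB i (by omega) h
          omega) ⟨y (n + 1), Or.inr hBn, fun h => hnB (h ▸ hBn)⟩ (by
        intro x hx h
        rcases h with h | h
        · subst h
          have := hA n (by omega) hx
          subst this
          exact ⟨rfl, rfl⟩
        · exact absurd h (Set.disjoint_left.1 hdis hx))
    rcases hS with hS | hS
    · rcases step hG A B (y n) (y (n + 1)) (y 0) a (hadj n (by omega)) hnB hBn hdis hB1 hA0 ha hS
        with h | h | ⟨z, hz, hz1, hz2, h1, h2⟩
      · exact ⟨a, ha, hae, Or.inl h⟩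
      · exact ⟨a, ha, hae, Or.inr h⟩
      · exact ⟨z, hz, hz1, Or.inl h1⟩
    · rcases step hG A B (y n) (y (n + 1)) a (y 0) (hadj n (by omega)) hnB hBn hdis hB1 ha hA0 hS
        with h | h | ⟨z, hz, hz1, hz2, h1, h2⟩
      · exact ⟨a, ha, hae, Or.inr h⟩
      · exact ⟨a, ha, hae, Or.inl h⟩
      · exact ⟨z, hz, hz2, Or.inl h2⟩

/-- closing up a linkage to a cycle -/
theorem sys_cycle (A B DA DB : Set V) (f s1 s2 : V) (hs2 : s2 ∈ A) (h12 : s1 ≠ s2)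
    (hf : f ∈ B)
    (hAB : ∀ x ∈ A, x ∈ B → x = f)
    (PA : G.Walk s2 s1) (hPA : PA.IsPath) (hPAs : ∀ x ∈ PA.support, x ∈ A)
    (hPAD : ∀ x ∈ DA, x ∈ PA.support)
    (hBp : ∀ b ∈ B, b ≠ f → ∃ PB : G.Walk f b, PB.IsPath ∧ (∀ x ∈ PB.support, x ∈ B) ∧
      ∀ x ∈ DB, x ∈ PB.support)
    (hS : Sys G A B f s1 s2) :
    ∃ (x y : V) (p : G.Walk y x), p.IsPath ∧ 2 ≤ p.length ∧ G.Adj x y ∧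
      (∀ x ∈ DA, x ∈ p.support) ∧ (∀ x ∈ DB, x ∈ p.support) := by
  obtain ⟨b, hb, hbf, Q, R, hQ, hR, hdis, hQA, hRA, hQB, hRB⟩ := hS
  obtain ⟨PB, hPB, hPBs, hPBD⟩ := hBp b hb hbf
  have hT1 : (Q.append PB).IsPath := append_isPath Q PB hQ hPB
    (fun x hx hx' => hQB x hx (hPBs x hx'))
  have hT2 : ((Q.append PB).append R.reverse).IsPath := by
    refine append_isPath _ _ hT1 hR.reverse ?_
    intro x hx hxR
    rw [Walk.support_reverse, List.mem_reverse] at hxR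
    rw [Walk.mem_support_append_iff] at hx
    rcases hx with hx | hx
    · exact absurd hxR (hdis x hx)
    · exact hRB x hxR (hPBs x hx)
  have hlen : 2 ≤ ((Q.append PB).append R.reverse).length := by
    simp only [Walk.length_append, Walk.length_reverse]
    have h1 : PB.length ≠ 0 := fun h => hbf (Walk.eq_of_length_eq_zero h).symm
    by_contra hcon
    have h3 : s2 = b := Walk.eq_of_length_eq_zero (p := R) (by omega)
    subst h3
    exact hbf (hAB s2 hs2 hb)
  have hTA : ∀ x ∈ ((Q.append PB).append R.reverse).support, x ∈ A → x = s1 ∨ x = s2 := by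
    intro x hx hxA
    simp only [Walk.mem_support_append_iff, Walk.support_reverse, List.mem_reverse] at hx
    rcases hx with (hx | hx) | hx
    · exact Or.inl (hQA x hx hxA)
    · have hxB := hPBs x hx
      have hxf := hAB x hxA hxB
      subst hxf
      exact Or.inl (hQA x Q.end_mem_support hxA)
    · exact Or.inr (hRA x hx hxA)
  have hTD : ∀ x ∈ DB, x ∈ ((Q.append PB).append R.reverse).support := by
    intro x hx
    simp only [Walk.mem_support_append_iff]
    exact Or.inl (Or.inr (hPBD x hx))
  generalize (Q.append PB).append R.reverse = T at *
  cases PA with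
  | nil => exact absurd rfl h12
  | cons h PA' =>
    rename_i c
    rw [Walk.cons_isPath_iff] at hPA
    refine ⟨s2, c, PA'.append T, ?_, ?_, h, ?_, ?_⟩
    · refine append_isPath _ _ hPA.1 hT2 ?_
      intro x hx hxT
      rcases hTA x hxT (hPAs x (by simp [hx])) with h | h
      · exact h
      · subst h; exact absurd hx hPA.2
    · rw [Walk.length_append]; omega
    · intro x hx
      have := hPAD x hx
      rw [Walk.support_cons, List.mem_cons] at this
      rw [Walk.mem_support_append_iff]
      rcases this with h | h
      · subst h; exact Or.inr T.end_mem_support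
      · exact Or.inl h
    · intro x hx
      rw [Walk.mem_support_append_iff]
      exact Or.inr (hTD x hx)

/-- the data of a path as a sequence -/
structure Seq (G : SimpleGraph V) (x : ℕ → V) (m : ℕ) : Prop where
  inj : ∀ i ≤ m, ∀ j ≤ m, x i = x j → i = j
  adj : ∀ i < m, G.Adj (x i) (x (i + 1))

theorem Seq.rev {x : ℕ → V} {m : ℕ} (h : Seq G x m) : Seq G (fun k => x (m - k)) m := by
  refine ⟨?_, ?_⟩
  · intro i hi j hj hij
    have := h.inj _ (by omega) _ (by omega) hij
    omega
  · intro i hi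
    have h1 := (h.adj (m - (i + 1)) (by omega)).symm
    rwa [show m - (i + 1) + 1 = m - i by omega] at h1

theorem Seq.seg {x : ℕ → V} {m : ℕ} (h : Seq G x m) (i d : ℕ) (hd : i + d ≤ m) :
    ∃ W : G.Walk (x i) (x (i + d)), W.IsPath ∧ W.length = d ∧
      ∀ w, w ∈ W.support ↔ ∃ k, i ≤ k ∧ k ≤ i + d ∧ x k = w := by
  induction d with
  | zero =>
    refine ⟨Walk.nil, by simp, by simp, ?_⟩
    intro w
    simp only [Walk.support_nil, List.mem_singleton]
    constructor
    · rintro rfl; exact ⟨i, le_rfl, le_rfl, rfl⟩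
    · rintro ⟨k, h1, h2, rfl⟩
      rw [show k = i by omega]
  | succ d ih =>
    obtain ⟨W, hW, hl, hs⟩ := ih (by omega)
    have ha : G.Adj (x (i + d)) (x (i + (d + 1))) := h.adj (i + d) (by omega)
    refine ⟨W.concat ha, hW.concat ?_ ha, by simp [hl], ?_⟩
    · rw [hs]
      rintro ⟨k, h1, h2, h3⟩
      have := h.inj k (by omega) _ (by omega) h3
      omega
    · intro w
      rw [Walk.support_concat]
      simp only [List.concat_eq_append, List.mem_append, List.mem_singleton, hs]
      constructor
      · rintro (⟨k, h1, h2, h3⟩ | h3)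
        · exact ⟨k, h1, by omega, h3⟩
        · exact ⟨i + (d + 1), by omega, le_rfl, h3.symm⟩
      · rintro ⟨k, h1, h2, h3⟩
        by_cases hk : k ≤ i + d
        · exact Or.inl ⟨k, h1, hk, h3⟩
        · right
          rw [← h3, show k = i + (d + 1) by omega]

theorem Seq.seg' {x : ℕ → V} {m : ℕ} (h : Seq G x m) (i j : ℕ) (hij : i ≤ j) (hj : j ≤ m) :
    ∃ W : G.Walk (x i) (x j), W.IsPath ∧ W.length = j - i ∧
      ∀ w, w ∈ W.support ↔ ∃ k, i ≤ k ∧ k ≤ j ∧ x k = w := by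
  obtain ⟨d, rfl⟩ := Nat.exists_eq_add_of_le hij
  obtain ⟨W, h1, h2, h3⟩ := h.seg i d hj
  exact ⟨W, h1, by omega, h3⟩

/-- `x i, …, x 0, x j, …, x l` -/
theorem Seq.rot {x : ℕ → V} {m : ℕ} (h : Seq G x m) (i j l : ℕ) (hij : i < j) (hjl : j ≤ l)
    (hl : l ≤ m) (hadj : G.Adj (x 0) (x j)) :
    ∃ W : G.Walk (x i) (x l), W.IsPath ∧ W.length = i + 1 + (l - j) ∧
      ∀ w, w ∈ W.support ↔ ∃ k, (k ≤ i ∨ (j ≤ k ∧ k ≤ l)) ∧ x k = w := by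
  obtain ⟨W1, hW1, hl1, hs1⟩ := h.seg' 0 i (by omega) (by omega)
  obtain ⟨W2, hW2, hl2, hs2⟩ := h.seg' j l hjl hl
  have h0 : x 0 ∉ W2.support := by
    rw [hs2]
    rintro ⟨k, h1, h2, h3⟩
    have := h.inj k (by omega) 0 (by omega) h3
    omega
  refine ⟨W1.reverse.append (Walk.cons hadj W2), ?_, ?_, ?_⟩
  · refine append_isPath _ _ hW1.reverse (hW2.cons h0) ?_
    intro w hw1 hw2
    rw [Walk.support_reverse, List.mem_reverse, hs1] at hw1
    rw [Walk.support_cons, List.mem_cons, hs2] at hw2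
    rcases hw2 with hw2 | ⟨k, h1, h2, h3⟩
    · exact hw2
    · obtain ⟨k', h1', h2', h3'⟩ := hw1
      have := h.inj k (by omega) k' (by omega) (h3.trans h3'.symm)
      omega
  · simp [hl1, hl2]; omega
  · intro w
    rw [Walk.mem_support_append_iff, Walk.support_reverse, List.mem_reverse, Walk.support_cons,
      List.mem_cons, hs1, hs2]
    constructor
    · rintro (⟨k, h1, h2, h3⟩ | h | ⟨k, h1, h2, h3⟩)
      · exact ⟨k, Or.inl h2, h3⟩
      · exact ⟨0, Or.inl (by omega), h.symm⟩
      · exact ⟨k, Or.inr ⟨h1, h2⟩, h3⟩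
    · rintro ⟨k, h1 | h1, h3⟩
      · exact Or.inl ⟨k, by omega, h1, h3⟩
      · exact Or.inr (Or.inr ⟨k, h1.1, h1.2, h3⟩)

theorem Seq.fan {x : ℕ → V} {m : ℕ} (h : Seq G x m) (s : ℕ) (hs : s ≤ m)
    (hadj : G.Adj (x 0) (x s)) (a : ℕ) (ha : a < s) :
    ∃ W : G.Walk (x a) (x s), W.IsPath ∧ (∀ w ∈ W.support, ∃ k ≤ s, x k = w) ∧
      ∀ k ≤ s, G.Adj (x 0) (x k) → x k ∈ W.support := by
  classical
  have hex : ∃ j, a < j ∧ j ≤ s ∧ G.Adj (x 0) (x j) := ⟨s, ha, le_rfl, hadj⟩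
  obtain ⟨h1, h2, h3⟩ := Nat.find_spec hex
  have hmin : ∀ k, a < k → k ≤ s → G.Adj (x 0) (x k) → Nat.find hex ≤ k :=
    fun k hk hk' hk'' => Nat.find_min' hex ⟨hk, hk', hk''⟩
  generalize Nat.find hex = j at *
  obtain ⟨W, hW, -, hWs⟩ := h.rot a j s h1 h2 hs h3
  refine ⟨W, hW, ?_, ?_⟩
  · intro w hw
    obtain ⟨k, hk, hk'⟩ := (hWs w).1 hw
    exact ⟨k, by omega, hk'⟩
  · intro k hk hk'
    rw [hWs]
    refine ⟨k, ?_, rfl⟩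
    by_cases hak : k ≤ a
    · exact Or.inl hak
    · exact Or.inr ⟨hmin k (by omega) hk hk', hk⟩

/-- parity count -/
theorem count_walk (c : V → Bool) (hc : ∀ a b, G.Adj a b → c a = !(c b)) {a b : V}
    (p : G.Walk a b) :
    2 * p.support.countP c = p.length + (c a).toNat + (c b).toNat := by
  induction p with
  | nil =>
    rename_i a
    cases h : c a <;> simp [h]
  | cons h p ih =>
    rename_i a b d
    have h1 := hc _ _ h
    rw [Walk.support_cons, List.countP_cons, Walk.length_cons, mul_add, ih]
    cases h2 : c b <;> simp [h1, h2] <;> omega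

theorem cycle_count [DecidableEq V] (c : V → Bool) (hc : ∀ a b, G.Adj a b → c a = !(c b)) {x y : V}
    (p : G.Walk y x) (hp : p.IsPath) (hl : 2 ≤ p.length) (h : G.Adj x y) (S : Finset V)
    (hS : ∀ w ∈ S, c w = true) (hSp : ∀ w ∈ S, w ∈ p.support) :
    ∃ (w : V) (C : G.Walk w w), C.IsCycle ∧ 2 * S.card ≤ C.length := by
  obtain ⟨w, C, hC, hCl⟩ := close_cycle p hp hl h
  refine ⟨w, C, hC, ?_⟩
  have h1 := count_walk c hc p
  have h2 := hc _ _ h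
  have h3 : S.card ≤ p.support.countP c := by
    rw [List.countP_eq_length_filter]
    have : S ⊆ (p.support.filter c).toFinset := by
      intro w hw
      simp [hS w hw, hSp w hw]
    exact (Finset.card_le_card this).trans (List.toFinset_card_le _)
  cases h4 : c y <;> simp [h2, h4] at h1 <;> omega

/-- existence of some cycle -/
theorem exists_cycle [Fintype V] [DecidableEq V] (hG : AvoidConn G) (h3 : 3 ≤ Fintype.card V)
    (u : V) : ∃ (w : V) (c : G.Walk w w), c.IsCycle := by
  have nb : ∀ f, f ≠ u → ∃ y, y ≠ f ∧ G.Adj u y := by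
    intro f hf
    obtain ⟨w, hw⟩ : ∃ w, w ∉ ({f, u} : Finset V) := by
      by_contra hcon
      push Not at hcon
      have : (Finset.univ : Finset V) ⊆ {f, u} := fun w _ => hcon w
      have h1 := Finset.card_le_card this
      have h2 : ({f, u} : Finset V).card ≤ 2 := Finset.card_le_two
      rw [Finset.card_univ] at h1
      omega
    simp only [Finset.mem_insert, Finset.mem_singleton, not_or] at hw
    obtain ⟨W, hW⟩ := hG f u w hf.symm hw.1
    cases W with
    | nil => exact absurd rfl hw.2
    | cons h W' =>
      rename_i y
      refine ⟨y, ?_, h⟩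
      rintro rfl
      exact hW (by simp)
  obtain ⟨f, hf⟩ : ∃ f, f ≠ u := by
    haveI : Nontrivial V := Fintype.one_lt_card_iff_nontrivial.1 (by omega)
    exact exists_ne u
  obtain ⟨y, _, hy⟩ := nb f hf
  obtain ⟨z, hzy, hz⟩ := nb y hy.ne'
  obtain ⟨W, hW⟩ := hG u y z hy.ne' hz.ne'
  have hW' : u ∉ W.bypass.support := fun h => hW (W.support_bypass_subset_support h)
  have hl : W.bypass.length ≠ 0 := fun h => hzy (Walk.eq_of_length_eq_zero h).symm
  obtain ⟨w, C, hC, _⟩ := close_cycle (Walk.cons hy W.bypass) ((W.bypass_isPath).cons hW')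
    (by rw [Walk.length_cons]; omega) hz.symm
  exact ⟨w, C, hC⟩

/-- the non-crossing case -/
theorem noncross [DecidableEq V] (hG : AvoidConn G) {x : ℕ → V} {m : ℕ} (h : Seq G x m)
    (s t : ℕ) (hs : 1 ≤ s) (hst : s ≤ t) (htm : t < m)
    (hus : G.Adj (x 0) (x s)) (hvt : G.Adj (x m) (x t)) :
    ∃ (a b : V) (p : G.Walk b a), p.IsPath ∧ 2 ≤ p.length ∧ G.Adj a b ∧
      (∀ k ≤ s, G.Adj (x 0) (x k) → x k ∈ p.support) ∧
      (∀ k, t ≤ k → k ≤ m → G.Adj (x m) (x k) → x k ∈ p.support) := by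
  set A : Set V := {w | ∃ k ≤ s, x k = w} with hA
  set B : Set V := {w | ∃ k, t ≤ k ∧ k ≤ m ∧ x k = w} with hB
  have hfA := h.fan s (by omega) hus
  have hfB : ∀ b ∈ B, b ≠ x t → ∃ PB : G.Walk (x t) b, PB.IsPath ∧ (∀ w ∈ PB.support, w ∈ B) ∧
      ∀ w ∈ {w | ∃ k, t ≤ k ∧ k ≤ m ∧ G.Adj (x m) (x k) ∧ x k = w}, w ∈ PB.support := by
    rintro b ⟨k, h1, h2, rfl⟩ hne
    have hk : k ≠ t := fun hk => hne (by rw [hk])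
    have hr := h.rev.fan (m - t) (by omega)
    simp only [Nat.sub_zero] at hr
    rw [show m - (m - t) = t by omega] at hr
    have hr := hr hvt (m - k) (by omega)
    rw [show m - (m - k) = k by omega] at hr
    obtain ⟨W, hW, hW1, hW2⟩ := hr
    refine ⟨W.reverse, hW.reverse, ?_, ?_⟩
    · intro w hw
      rw [Walk.support_reverse, List.mem_reverse] at hw
      obtain ⟨l, hl, hl'⟩ := hW1 w hw
      exact ⟨m - l, by omega, by omega, hl'⟩
    · rintro w ⟨l, hl1, hl2, hl3, rfl⟩
      rw [Walk.support_reverse, List.mem_reverse]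
      have := hW2 (m - l) (by omega)
      rw [show m - (m - l) = l by omega] at this
      exact this hl3
  have hAB : ∀ w ∈ A, w ∈ B → w = x s ∧ w = x t := by
    rintro w ⟨k, hk, rfl⟩ ⟨l, hl1, hl2, hl3⟩
    have := h.inj l (by omega) k (by omega) hl3
    have h1 : k = s := by omega
    have h2 : k = t := by omega
    exact ⟨by rw [h1], by rw [h2]⟩
  have hlink := linkage hG A (fun i => x (s + i)) (t - s)
    (by
      intro i hi j hj hij
      have := h.inj _ (by omega) _ (by omega) hij
      omega)
    (fun i hi => h.adj (s + i) (by omega))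
    ⟨s, le_rfl, rfl⟩
    (by
      rintro i hi ⟨k, hk, hk'⟩
      have := h.inj _ (by omega) _ (by omega) hk'
      omega)
    ⟨x 0, ⟨0, by omega, rfl⟩, fun h0 => by
      have := h.inj _ (by omega) _ (by omega) h0
      omega⟩
    B
    ⟨t, le_rfl, by omega, by rw [show s + (t - s) = t by omega]⟩
    (by
      rintro i hi ⟨k, hk1, hk2, hk'⟩
      have := h.inj _ (by omega) _ (by omega) hk'
      omega)
    ⟨x m, ⟨m, by omega, le_rfl, rfl⟩, fun h0 => by
      have := h.inj _ (by omega) _ (by omega) h0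
      omega⟩
    (by
      simp only [Nat.add_zero]
      rw [show s + (t - s) = t by omega]
      exact hAB)
  simp only [Nat.add_zero] at hlink
  rw [show s + (t - s) = t by omega] at hlink
  obtain ⟨a, ⟨k, hk, rfl⟩, hae, hS⟩ := hlink
  have hks : k ≠ s := fun h => hae (by rw [h])
  obtain ⟨W, hW, hW1, hW2⟩ := hfA k (by omega)
  have htB : x t ∈ B := ⟨t, le_rfl, by omega, rfl⟩
  rcases hS with hS | hS
  · obtain ⟨a, b, p, hp, hl, hab, h1, h2⟩ := sys_cycle A B
      {w | ∃ k ≤ s, G.Adj (x 0) (x k) ∧ x k = w} _ (x t) (x s) (x k) ⟨k, hk, rfl⟩ hae.symm htB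
      (fun w hw hw' => (hAB w hw hw').2) W hW hW1
      (by rintro w ⟨l, hl, hl', rfl⟩; exact hW2 l hl hl') hfB hS
    exact ⟨a, b, p, hp, hl, hab, fun k hk hk' => h1 _ ⟨k, hk, hk', rfl⟩,
      fun k hk hk' hk'' => h2 _ ⟨k, hk, hk', hk'', rfl⟩⟩
  · obtain ⟨a, b, p, hp, hl, hab, h1, h2⟩ := sys_cycle A B
      {w | ∃ k ≤ s, G.Adj (x 0) (x k) ∧ x k = w} _ (x t) (x k) (x s) ⟨s, le_rfl, rfl⟩ hae htB
      (fun w hw hw' => (hAB w hw hw').2) W.reverse hW.reverse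
      (by intro w hw; exact hW1 w (by simpa using hw))
      (by
        rintro w ⟨l, hl, hl', rfl⟩
        rw [Walk.support_reverse, List.mem_reverse]
        exact hW2 l hl hl') hfB hS
    exact ⟨a, b, p, hp, hl, hab, fun k hk hk' => h1 _ ⟨k, hk, hk', rfl⟩,
      fun k hk hk' hk'' => h2 _ ⟨k, hk, hk', hk'', rfl⟩⟩

/-- counting in the crossing case -/
theorem cross_count (I J : Finset ℕ) (m i j : ℕ) (hm : Even m) (hI : ∀ k ∈ I, Odd k ∧ k ≤ m)
    (hJ : ∀ k ∈ J, Odd k ∧ k ≤ m) (hi : i ∈ J) (hj : j ∈ I) (hij : i < j)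
    (hmin : ∀ i' ∈ J, ∀ j' ∈ I, i' < j' → j - i ≤ j' - i') :
    min m (2 * (I.card + J.card - 2)) ≤ i + 1 + (m - j) + 1 := by
  obtain ⟨⟨i0, hi0⟩, him⟩ := hJ i hi
  obtain ⟨⟨j0, hj0⟩, hjm⟩ := hI j hj
  obtain ⟨m0, hm0⟩ := hm
  by_cases hd : j - i ≤ 2
  · exact (min_le_left _ _).trans (by omega)
  refine (min_le_right _ _).trans ?_
  let O : Finset ℕ := (Finset.range (i0 + 1)).image (fun l => 2 * l + 1) ∪
    (Finset.range (m0 - j0)).image (fun l => j + 2 * l)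
  have hO : O.card ≤ (i0 + 1) + (m0 - j0) := by
    refine (Finset.card_union_le _ _).trans (Nat.add_le_add ?_ ?_)
    · exact Finset.card_image_le.trans (by simp)
    · exact Finset.card_image_le.trans (by simp)
  have hOm : ∀ k, Odd k → k ≤ m → (k ≤ i ∨ j ≤ k) → k ∈ O := by
    rintro k ⟨k0, hk0⟩ hkm hk
    simp only [O, Finset.mem_union, Finset.mem_image, Finset.mem_range]
    rcases hk with hk | hk
    · exact Or.inl ⟨k0, by omega, by omega⟩
    · exact Or.inr ⟨k0 - j0, by omega, by omega⟩
  let I' : Finset ℕ := ((I.erase 1).erase j).image (fun k => k - 2)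
  have hI'3 : ∀ k ∈ (I.erase 1).erase j, k ∈ I ∧ k ≠ j ∧ 3 ≤ k := by
    intro k hk
    simp only [Finset.mem_erase] at hk
    obtain ⟨h1, h2, h3⟩ := hk
    obtain ⟨⟨k0, hk0⟩, _⟩ := hI k h3
    exact ⟨h3, h1, by omega⟩
  have hI'c : I.card - 2 ≤ I'.card := by
    have h1 : I'.card = ((I.erase 1).erase j).card := by
      apply Finset.card_image_of_injOn
      intro a ha b hb hab
      have h1 := (hI'3 a ha).2.2
      have h2 := (hI'3 b hb).2.2
      simp only at hab
      omega
    have h2 := Finset.pred_card_le_card_erase (s := I) (a := 1)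
    have h3 := Finset.pred_card_le_card_erase (s := I.erase 1) (a := j)
    omega
  have hdisj : Disjoint I' J := by
    rw [Finset.disjoint_left]
    intro k hk hkJ
    obtain ⟨k', hk', rfl⟩ := Finset.mem_image.1 hk
    obtain ⟨h1, h2, h3⟩ := hI'3 k' hk'
    have := hmin _ hkJ k' h1 (by omega)
    omega
  have hgap : ∀ k, (k ∈ I ∨ k ∈ J) → k ≤ i ∨ j ≤ k := by
    intro k hk
    by_contra hcon
    push Not at hcon
    rcases hk with hk | hk
    · have := hmin i hi k hk hcon.1
      omega
    · have := hmin k hk j hj hcon.2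
      omega
  have hsub : I' ∪ J ⊆ O := by
    intro k hk
    rcases Finset.mem_union.1 hk with hk | hk
    · obtain ⟨k', hk', rfl⟩ := Finset.mem_image.1 hk
      obtain ⟨h1, h2, h3⟩ := hI'3 k' hk'
      obtain ⟨⟨k0, hk0⟩, hkm⟩ := hI k' h1
      have hg := hgap k' (Or.inl h1)
      refine hOm _ ⟨k0 - 1, by omega⟩ (by omega) ?_
      obtain hg | hg := hg
      · left; omega
      · right; omega
    · exact hOm k (hJ k hk).1 (hJ k hk).2 (hgap k (Or.inr hk))
  have hc := Finset.card_le_card hsub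
  rw [Finset.card_union_of_disjoint hdisj] at hc
  omega

/-- main theorem for sequences -/
theorem main_seq [DecidableEq V] [DecidableRel G.Adj] (hG : AvoidConn G) (c : V → Bool)
    (hc : ∀ a b, G.Adj a b → c a = !(c b)) {x : ℕ → V} {m : ℕ} (h : Seq G x m) (hm : 0 < m)
    (h0 : c (x 0) = false) (hcm : c (x m) = false) :
    ∃ (w : V) (C : G.Walk w w), C.IsCycle ∧
      min m (2 * (((Finset.range (m + 1)).filter (fun k => G.Adj (x 0) (x k))).card +
        ((Finset.range (m + 1)).filter (fun k => G.Adj (x m) (x k))).card - 2)) ≤ C.length := by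
  have hpar : ∀ k ≤ m, (c (x k) = true ↔ Odd k) := by
    intro k
    induction k with
    | zero => intro _; simp [h0]
    | succ k ih =>
      intro hk
      have h1 := ih (by omega)
      have h2 := hc _ _ (h.adj k (by omega))
      rw [Nat.odd_add_one, ← h1, h2]
      simp
  have hme : Even m := by
    have := hpar m le_rfl
    rw [hcm] at this
    simpa using this
  set I := (Finset.range (m + 1)).filter (fun k => G.Adj (x 0) (x k)) with hIdef
  set J := (Finset.range (m + 1)).filter (fun k => G.Adj (x m) (x k)) with hJdef
  have hI : ∀ k, k ∈ I ↔ k ≤ m ∧ G.Adj (x 0) (x k) := by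
    intro k; simp [hIdef, Nat.lt_succ_iff]
  have hJ : ∀ k, k ∈ J ↔ k ≤ m ∧ G.Adj (x m) (x k) := by
    intro k; simp [hJdef, Nat.lt_succ_iff]
  have hIc : ∀ k ∈ I, c (x k) = true := by
    intro k hk
    have h1 := hc _ _ ((hI k).1 hk).2
    rw [h0] at h1
    simpa using h1.symm
  have hJc : ∀ k ∈ J, c (x k) = true := by
    intro k hk
    have h1 := hc _ _ ((hJ k).1 hk).2
    rw [hcm] at h1
    simpa using h1.symm
  have hIodd : ∀ k ∈ I, Odd k ∧ k ≤ m :=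
    fun k hk => ⟨(hpar k ((hI k).1 hk).1).1 (hIc k hk), ((hI k).1 hk).1⟩
  have hJodd : ∀ k ∈ J, Odd k ∧ k ≤ m :=
    fun k hk => ⟨(hpar k ((hJ k).1 hk).1).1 (hJc k hk), ((hJ k).1 hk).1⟩
  have h1I : 1 ∈ I := (hI 1).2 ⟨hm, h.adj 0 hm⟩
  have hmJ : m - 1 ∈ J := by
    refine (hJ _).2 ⟨by omega, ?_⟩
    have := (h.adj (m - 1) (by omega)).symm
    rwa [show m - 1 + 1 = m by omega] at this
  by_cases hcross : ∃ d, ∃ i ∈ J, ∃ j ∈ I, i < j ∧ j - i = d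
  · classical
    obtain ⟨i, hi, j, hj, hij, hd⟩ := Nat.find_spec hcross
    have hmin : ∀ i' ∈ J, ∀ j' ∈ I, i' < j' → j - i ≤ j' - i' := by
      intro i' hi' j' hj' hij'
      rw [hd]
      exact Nat.find_min' hcross ⟨i', hi', j', hj', hij', rfl⟩
    have hcount := cross_count I J m i j hme hIodd hJodd hi hj hij hmin
    obtain ⟨W, hW, hWl, -⟩ := h.rot i j m hij ((hI j).1 hj).1 le_rfl ((hI j).1 hj).2
    have hi1 : Odd i := (hJodd i hi).1
    have hjm : j ≠ m := by
      rintro rfl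
      exact (Nat.not_odd_iff_even.2 hme) (hIodd _ hj).1
    have hjm' := (hIodd j hj).2
    have hi0 := hi1.pos
    obtain ⟨w, C, hC, hCl⟩ := close_cycle W hW (by omega) ((hJ i).1 hi).2
    exact ⟨w, C, hC, by omega⟩
  · have hnc : ∀ i ∈ J, ∀ j ∈ I, j ≤ i := by
      intro i hi j hj
      by_contra hcon
      exact hcross ⟨_, i, hi, j, hj, by omega, rfl⟩
    set s := I.max' ⟨1, h1I⟩ with hs
    set t := J.min' ⟨m - 1, hmJ⟩ with ht
    have hsI : s ∈ I := I.max'_mem _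
    have htJ : t ∈ J := J.min'_mem _
    have hsm : ∀ k ∈ I, k ≤ s := fun k hk => I.le_max' k hk
    have htm : ∀ k ∈ J, t ≤ k := fun k hk => J.min'_le k hk
    have hst := hnc t htJ s hsI
    have h1s := hsm 1 h1I
    have htm1 := htm _ hmJ
    obtain ⟨a, b, p, hp, hl, hab, hp1, hp2⟩ := noncross hG h s t h1s hst (by omega)
      ((hI s).1 hsI).2 ((hJ t).1 htJ).2
    obtain ⟨w, C, hC, hCl⟩ := cycle_count c hc p hp hl hab ((I ∪ J).image x)
      (by
        intro w hw
        obtain ⟨k, hk, rfl⟩ := Finset.mem_image.1 hw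
        rcases Finset.mem_union.1 hk with hk | hk
        · exact hIc k hk
        · exact hJc k hk)
      (by
        intro w hw
        obtain ⟨k, hk, rfl⟩ := Finset.mem_image.1 hw
        rcases Finset.mem_union.1 hk with hk | hk
        · exact hp1 k (hsm k hk) ((hI k).1 hk).2
        · exact hp2 k (htm k hk) ((hJ k).1 hk).1 ((hJ k).1 hk).2)
    refine ⟨w, C, hC, (min_le_right _ _).trans (le_trans ?_ hCl)⟩
    rw [Finset.card_image_of_injOn]
    · have h1 := Finset.card_union_add_card_inter I J
      have h2 : (I ∩ J).card ≤ 1 := by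
        rw [Finset.card_le_one]
        intro a ha b hb
        rw [Finset.mem_inter] at ha hb
        exact le_antisymm (hnc b hb.2 a ha.1) (hnc a ha.2 b hb.1)
      omega
    · intro k hk l hl hkl
      have hb : ∀ k ∈ I ∪ J, k ≤ m := by
        intro k hk
        rcases Finset.mem_union.1 hk with hk | hk
        · exact (hIodd k hk).2
        · exact (hJodd k hk).2
      exact h.inj k (hb k hk) l (hb l hl) hkl

end PosaBip

/-- Bipartite analogue of Pósa's lemma, part (ii): if `G` is a 2-connected bipartite graph
with parts `X, Y` and `P` is a `u`–`v` path with `u, v ∈ X`, then `G` contains a cycle of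
length at least `min {|V(P)| - 1, 2(d_P(u) + d_P(v) - 2)}`. -/
theorem stmt_6 {V : Type*} [Fintype V] [DecidableEq V]
    (G : SimpleGraph V) [DecidableRel G.Adj]
    (X Y : Finset V) (hdisj : Disjoint X Y) (hunion : X ∪ Y = Finset.univ)
    (hbip : ∀ x y : V, G.Adj x y → (x ∈ X ∧ y ∈ Y) ∨ (x ∈ Y ∧ y ∈ X))
    (hG : IsTwoConnected G)
    (u v : V) (hu : u ∈ X) (hv : v ∈ X) (P : G.Walk u v) (hP : P.IsPath) :
    ∃ (w : V) (c : G.Walk w w), c.IsCycle ∧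
      min (P.support.length - 1)
        (2 * ((P.support.toFinset ∩ G.neighborFinset u).card
              + (P.support.toFinset ∩ G.neighborFinset v).card - 2)) ≤ c.length := by
  classical
  have hA := PosaBip.avoidConn_of hG
  have hXY : ∀ w, w ∈ X → w ∉ Y := fun w hw hw' => Finset.disjoint_left.1 hdisj hw hw'
  by_cases hm : P.length = 0
  · obtain ⟨w, c, hc⟩ := PosaBip.exists_cycle hA hG.1 u
    refine ⟨w, c, hc, (min_le_left _ _).trans ?_⟩
    rw [SimpleGraph.Walk.length_support]
    omega
  · have hseq : PosaBip.Seq G P.getVert P.length :=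
      ⟨fun i hi j hj hij => hP.getVert_injOn hi hj hij, fun i hi => P.adj_getVert_succ hi⟩
    obtain ⟨w, C, hC, hCl⟩ := PosaBip.main_seq hA (fun w => decide (w ∈ Y)) (by
      intro a b hab
      rcases hbip a b hab with ⟨h1, h2⟩ | ⟨h1, h2⟩
      · simp [hXY a h1, h2]
      · simp [hXY b h2, h1]) hseq (by omega) (by simpa using hXY u hu) (by simpa using hXY v hv)
    refine ⟨w, C, hC, le_trans ?_ hCl⟩
    have key : ∀ z : V, (P.support.toFinset ∩ G.neighborFinset z).card ≤
        ((Finset.range (P.length + 1)).filter (fun k => G.Adj z (P.getVert k))).card := by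
      intro z
      refine le_trans (Finset.card_le_card ?_) (Finset.card_image_le (f := P.getVert))
      intro y hy
      simp only [Finset.mem_inter, List.mem_toFinset, SimpleGraph.mem_neighborFinset] at hy
      obtain ⟨n, hn, hn'⟩ := SimpleGraph.Walk.mem_support_iff_exists_getVert.1 hy.1
      rw [Finset.mem_image]
      refine ⟨n, ?_, hn⟩
      rw [Finset.mem_filter, Finset.mem_range, hn]
      exact ⟨by omega, hy.2⟩
    have k1 := key u
    have k2 := key v
    rw [SimpleGraph.Walk.length_support]
    simp only [SimpleGraph.Walk.getVert_zero, SimpleGraph.Walk.getVert_length]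
    refine min_le_min (by omega) ?_
    omega
end

section
/- Let G be a 2-connected bipartite graph with bipartition (X, Y) and let P be a maximal path in G with endpoints u ∈ X and v ∈ Y. Then G contains a cycle of length at least min{|V(P)|, 2(d(u) + d(v) − 1)}, where d denotes degree in G. -/
/-- `PathOn G a b S`: there is a path from `a` to `b` with vertex set exactly `S`. -/
inductive PathOn {V : Type*} [DecidableEq V] (G : SimpleGraph V) : V → V → Finset V → Prop
  | single (a : V) : PathOn G a a {a}
  | cons {a b c : V} {S : Finset V} (h : G.Adj a b) (hp : PathOn G b c S) (ha : a ∉ S) :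
      PathOn G a c (insert a S)

namespace PathOn

variable {V : Type*} [DecidableEq V] {G : SimpleGraph V}

theorem left_mem {a b : V} {S : Finset V} (h : PathOn G a b S) : a ∈ S := by
  cases h <;> simp

theorem right_mem {a b : V} {S : Finset V} (h : PathOn G a b S) : b ∈ S := by
  induction h <;> simp_all

theorem join {a b c d : V} {S T : Finset V} (h : PathOn G a b S) (hbc : G.Adj b c)
    (h2 : PathOn G c d T) (hd : ∀ w ∈ S, w ∉ T) : PathOn G a d (S ∪ T) := by
  induction h with
  | single a =>
    rw [← Finset.insert_eq]
    exact PathOn.cons hbc h2 (hd _ (by simp))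
  | cons h hp ha ih =>
    rw [Finset.insert_union]
    refine PathOn.cons h (ih hbc (fun w hw => hd w (by simp [hw]))) ?_
    simp only [Finset.mem_union, not_or]
    exact ⟨ha, hd _ (by simp)⟩

theorem snoc {a b c : V} {S : Finset V} (h : PathOn G a b S) (hbc : G.Adj b c)
    (hc : c ∉ S) : PathOn G a c (insert c S) := by
  have := h.join hbc (PathOn.single c) (fun w hw hw' => by
    rw [Finset.mem_singleton] at hw'; exact hc (hw' ▸ hw))
  rwa [Finset.union_comm, ← Finset.insert_eq] at this

theorem symm {a b : V} {S : Finset V} (h : PathOn G a b S) : PathOn G b a S := by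
  induction h with
  | single a => exact PathOn.single a
  | cons h hp ha ih => exact ih.snoc h.symm ha

theorem peel {a b : V} {S : Finset V} (h : PathOn G a b S) (hab : a ≠ b) :
    ∃ w S', G.Adj a w ∧ PathOn G w b S' ∧ a ∉ S' ∧ S = insert a S' := by
  cases h with
  | single => exact absurd rfl hab
  | cons h hp ha => exact ⟨_, _, h, hp, ha, rfl⟩

theorem glue {a b c : V} {S T : Finset V} (h : PathOn G a b S)
    (h2 : PathOn G b c T) (hd : ∀ w ∈ S, w ∈ T → w = b) : PathOn G a c (S ∪ T) := by
  by_cases hbc : b = c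
  · subst hbc
    induction h with
    | single a =>
      have : ({a} : Finset V) ∪ T = T := by
        rw [← Finset.insert_eq]; exact Finset.insert_eq_of_mem h2.left_mem
      rw [this]; exact h2
    | cons h hp ha ih =>
      rw [Finset.insert_union]
      refine PathOn.cons h (ih (fun w hw => hd w (by simp [hw])) h2) ?_
      simp only [Finset.mem_union, not_or]
      refine ⟨ha, fun hT => ?_⟩
      have := hd _ (by simp) hT
      exact ha (this ▸ hp.right_mem)
  · obtain ⟨w, T', hw, hp, hb, rfl⟩ := h2.peel hbc
    have : S ∪ insert b T' = S ∪ T' := by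
      rw [Finset.union_insert]
      exact Finset.insert_eq_of_mem (by simp [h.right_mem])
    rw [this]
    refine h.join hw hp (fun y hy hy' => ?_)
    have := hd y hy (by simp [hy'])
    exact hb (this ▸ hy')

theorem take {a b z : V} {S : Finset V} (h : PathOn G a b S) (hz : z ∈ S) :
    ∃ S1, S1 ⊆ S ∧ PathOn G a z S1 ∧ (z ≠ b → b ∉ S1) := by
  induction h with
  | single a =>
    simp only [Finset.mem_singleton] at hz
    subst hz
    exact ⟨{z}, subset_rfl, PathOn.single z, fun h => absurd rfl h⟩
  | @cons a b c S h hp ha ih =>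
    by_cases hza : z = a
    · subst hza
      refine ⟨{z}, by simp, PathOn.single z, fun h => ?_⟩
      simpa using h.symm
    · have hz' : z ∈ S := by simpa [hza] using hz
      obtain ⟨S1, h1, h2, h3⟩ := ih hz'
      refine ⟨insert a S1, Finset.insert_subset_insert _ h1, PathOn.cons h h2 (fun hh => ha (h1 hh)), ?_⟩
      intro hzc
      simp only [Finset.mem_insert, not_or]
      exact ⟨fun hca => ha (hca ▸ hp.right_mem), h3 hzc⟩

theorem toWalk {a b : V} {S : Finset V} (h : PathOn G a b S) :
    ∃ W : G.Walk a b, W.IsPath ∧ W.length + 1 = S.card ∧ ∀ w, w ∈ W.support ↔ w ∈ S := by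
  induction h with
  | single a => exact ⟨SimpleGraph.Walk.nil, by simp⟩
  | cons h hp ha ih =>
    obtain ⟨W, h1, h2, h3⟩ := ih
    refine ⟨SimpleGraph.Walk.cons h W, ?_, ?_, ?_⟩
    · rw [SimpleGraph.Walk.cons_isPath_iff]
      exact ⟨h1, fun hh => ha ((h3 _).1 hh)⟩
    · rw [Finset.card_insert_of_notMem ha]; simp [h2]
    · intro w; simp [h3]

theorem toCycle {a b : V} {S : Finset V} (h : PathOn G a b S) (hba : G.Adj b a)
    (hS : 3 ≤ S.card) : ∃ (w : V) (c : G.Walk w w), c.IsCycle ∧ c.length = S.card := by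
  obtain ⟨W, h1, h2, h3⟩ := h.toWalk
  refine ⟨b, SimpleGraph.Walk.cons hba W, ?_, by simp [h2]⟩
  rw [SimpleGraph.Walk.cons_isCycle_iff]
  refine ⟨h1, fun he => ?_⟩
  rw [Sym2.eq_swap] at he
  have := h1.length_eq_one_of_mem_edges he
  omega

theorem parity {X Y : Finset V} (hdisj : Disjoint X Y)
    (hbip : ∀ x y : V, G.Adj x y → (x ∈ X ∧ y ∈ Y) ∨ (x ∈ Y ∧ y ∈ X))
    {a b : V} {S : Finset V} (h : PathOn G a b S) (hb : b ∈ Y) :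
    (a ∈ X → 2 * (S ∩ X).card = S.card) ∧ (a ∈ Y → 2 * (S ∩ X).card + 1 = S.card) := by
  have hd : ∀ w, w ∈ X → w ∈ Y → False := fun w h1 h2 => Finset.disjoint_left.1 hdisj h1 h2
  induction h with
  | single a =>
    refine ⟨fun h => (hd _ h hb).elim, fun h => ?_⟩
    have : ({a} : Finset V) ∩ X = ∅ := by
      rw [Finset.singleton_inter_of_notMem (fun h' => hd _ h' h)]
    simp [this]
  | @cons a b c S h hp ha ih =>
    obtain ⟨i1, i2⟩ := ih hb
    rw [Finset.card_insert_of_notMem ha]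
    constructor
    · intro haX
      rw [Finset.insert_inter_of_mem haX, Finset.card_insert_of_notMem (by simp [ha])]
      rcases hbip _ _ h with h' | h'
      · have := i2 h'.2; omega
      · exact (hd _ haX h'.1).elim
    · intro haY
      rw [Finset.insert_inter_of_notMem (fun h' => hd _ h' haY)]
      rcases hbip _ _ h with h' | h'
      · exact (hd _ h'.1 haY).elim
      · have := i1 h'.2; omega

theorem cycle_parity {X Y : Finset V} (hdisj : Disjoint X Y)
    (hbip : ∀ x y : V, G.Adj x y → (x ∈ X ∧ y ∈ Y) ∨ (x ∈ Y ∧ y ∈ X))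
    {a b : V} {S : Finset V} (h : PathOn G a b S) (hba : G.Adj b a) :
    2 * (S ∩ X).card = S.card := by
  rcases hbip _ _ hba with h' | h'
  · exact (h.symm.parity hdisj hbip h'.2).1 h'.1
  · exact (h.parity hdisj hbip h'.1).1 h'.2

theorem conn_aux (c : V) (D E : Finset V) (hDE : ∀ w ∈ D, w ∉ E)
    (hE : c ∉ E) {a e : V} (he : e ∈ E)
    (h : Relation.ReflTransGen (fun x y => G.Adj x y ∧ x ≠ c) a e) :
    (∃ z ∈ D, ∃ w, ∃ e' ∈ E, ∃ T, G.Adj z w ∧ PathOn G w e' T ∧ (∀ y ∈ T, y ∉ D ∧ y ≠ c) ∧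
      ∀ y ∈ T, y ∈ E → y = e') ∨
    (∃ e' ∈ E, ∃ T, PathOn G a e' T ∧ (∀ y ∈ T, y ∉ D ∧ y ≠ c) ∧
      ∀ y ∈ T, y ∈ E → y = e') := by
  have triv : ∀ a ∈ E, (∃ e' ∈ E, ∃ T, PathOn G a e' T ∧ (∀ y ∈ T, y ∉ D ∧ y ≠ c) ∧
      ∀ y ∈ T, y ∈ E → y = e') := by
    intro a ha
    refine ⟨a, ha, {a}, PathOn.single a, ?_, by simp⟩
    intro y hy
    rw [Finset.mem_singleton] at hy
    subst hy
    exact ⟨fun h' => hDE _ h' ha, fun h' => hE (h' ▸ ha)⟩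
  induction h using Relation.ReflTransGen.head_induction_on with
  | refl => exact Or.inr (triv _ he)
  | @head a b hab hbe ih =>
    rcases ih with ih | ⟨e', he', T, hT, h1, h2⟩
    · exact Or.inl ih
    · by_cases haD : a ∈ D
      · exact Or.inl ⟨a, haD, b, e', he', T, hab.1, hT, h1, h2⟩
      · right
        by_cases haE : a ∈ E
        · exact triv _ haE
        · by_cases haT : a ∈ T
          · obtain ⟨T1, hs, hp, -⟩ := hT.symm.take haT
            exact ⟨e', he', T1, hp.symm, fun y hy => h1 y (hs hy), fun y hy => h2 y (hs hy)⟩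
          · refine ⟨e', he', insert a T, PathOn.cons hab.1 hT haT, ?_, ?_⟩
            · intro y hy
              rcases Finset.mem_insert.1 hy with rfl | hy
              · exact ⟨haD, hab.2⟩
              · exact h1 y hy
            · intro y hy hyE
              rcases Finset.mem_insert.1 hy with rfl | hy
              · exact absurd hyE haE
              · exact h2 y hy hyE

theorem conn [Fintype V] (hG : IsTwoConnected G) (c : V) (D E : Finset V)
    (hDE : ∀ w ∈ D, w ∉ E) (hD : c ∉ D) (hE : c ∉ E) (hDn : D.Nonempty) (hEn : E.Nonempty) :
    ∃ z ∈ D, ∃ w, ∃ e' ∈ E, ∃ T, G.Adj z w ∧ PathOn G w e' T ∧ (∀ y ∈ T, y ∉ D ∧ y ≠ c) ∧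
      ∀ y ∈ T, y ∈ E → y = e' := by
  obtain ⟨d, hd⟩ := hDn
  obtain ⟨e, he⟩ := hEn
  have hdc : d ≠ c := fun h => hD (h ▸ hd)
  have hec : e ≠ c := fun h => hE (h ▸ he)
  have hr := (hG.2 c).preconnected ⟨d, by simp [hdc]⟩ ⟨e, by simp [hec]⟩
  rw [SimpleGraph.reachable_iff_reflTransGen] at hr
  have hr2 : Relation.ReflTransGen (fun x y => G.Adj x y ∧ x ≠ c) d e := by
    refine Relation.ReflTransGen.lift (r := ((⊤ : G.Subgraph).deleteVerts {c}).coe.Adj)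
      (fun x => x.1) ?_ _ _ hr
    intro x y hxy
    refine ⟨SimpleGraph.Subgraph.coe_adj_sub _ _ _ hxy, ?_⟩
    have := x.2
    simpa using this
  rcases conn_aux c D E hDE hE he hr2 with h | ⟨e', he', T, hT, h1, h2⟩
  · exact h
  · exact absurd hd (h1 _ hT.left_mem).1

end PathOn

section main
variable {V : Type*} [DecidableEq V] {G : SimpleGraph V}

/-- the vertices `x i, …, x j` -/
def sg (x : ℕ → V) (i j : ℕ) : Finset V := (Finset.Icc i j).image x

theorem mem_sg {x : ℕ → V} {i j : ℕ} {w : V} : w ∈ sg x i j ↔ ∃ k, (i ≤ k ∧ k ≤ j) ∧ x k = w := by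
  simp [sg]

theorem sg_path {x : ℕ → V} {m : ℕ} (hinj : ∀ i j, i ≤ m → j ≤ m → x i = x j → i = j)
    (hadj : ∀ i, i < m → G.Adj (x i) (x (i + 1))) {i j : ℕ} (hij : i ≤ j) (hj : j ≤ m) :
    PathOn G (x i) (x j) (sg x i j) := by
  induction j, hij using Nat.le_induction with
  | base => simpa [sg] using PathOn.single (G := G) (x i)
  | succ j hij ih =>
    have h1 := (ih (by omega)).snoc (hadj j (by omega)) (by
      rw [mem_sg]
      rintro ⟨k, hk, hk'⟩
      have := hinj _ _ (by omega) hj hk'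
      omega)
    have : insert (x (j + 1)) (sg x i j) = sg x i (j + 1) := by
      ext w
      simp only [Finset.mem_insert, mem_sg]
      constructor
      · rintro (rfl | ⟨k, hk, rfl⟩)
        · exact ⟨j + 1, by omega, rfl⟩
        · exact ⟨k, by omega, rfl⟩
      · rintro ⟨k, hk, rfl⟩
        by_cases hkj : k = j + 1
        · left; rw [hkj]
        · right; exact ⟨k, by omega, rfl⟩
    rwa [this] at h1

/-- Two disjoint paths from `{x a, x p}` to `{x t, x s}`. -/
def TwoState (G : SimpleGraph V) (x : ℕ → V) (m p t : ℕ) : Prop :=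
  ∃ a b b' s R S, a < p ∧ t < s ∧ s ≤ m ∧ ((b = p ∧ b' = a) ∨ (b = a ∧ b' = p)) ∧
    PathOn G (x b) (x t) R ∧ PathOn G (x b') (x s) S ∧ (∀ w ∈ R, w ∉ S) ∧
    ∀ k ≤ m, x k ∈ R ∨ x k ∈ S → k = p ∨ k = a ∨ (p < k ∧ k < t) ∨ k = t ∨ k = s

theorem twoState_base [Fintype V] (hG : IsTwoConnected G) {x : ℕ → V} {m p : ℕ}
    (hinj : ∀ i j, i ≤ m → j ≤ m → x i = x j → i = j) (hp0 : 0 < p) (hpm : p < m) :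
    TwoState G x m p p := by
  obtain ⟨z, hz, w, e, he, T, hzw, hT, h1, h2⟩ := PathOn.conn hG (x p) (sg x 0 (p-1)) (sg x (p+1) m)
    (by
      intro w hw hw'
      rw [mem_sg] at hw hw'
      obtain ⟨k, hk, rfl⟩ := hw
      obtain ⟨l, hl, hl'⟩ := hw'
      have := hinj _ _ (by omega) (by omega) hl'
      omega)
    (by
      rw [mem_sg]
      rintro ⟨k, hk, hk'⟩
      have := hinj _ _ (by omega) (by omega) hk'
      omega)
    (by
      rw [mem_sg]
      rintro ⟨k, hk, hk'⟩
      have := hinj _ _ (by omega) (by omega) hk'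
      omega)
    ⟨x 0, mem_sg.2 ⟨0, by omega, rfl⟩⟩ ⟨x m, mem_sg.2 ⟨m, by omega, rfl⟩⟩
  obtain ⟨a, ha, rfl⟩ := mem_sg.1 hz
  obtain ⟨s, hs, rfl⟩ := mem_sg.1 he
  refine ⟨a, p, a, s, {x p}, insert (x a) T, by omega, by omega, by omega, Or.inl ⟨rfl, rfl⟩,
    PathOn.single _, PathOn.cons hzw hT (fun h => (h1 _ h).1 hz), ?_, ?_⟩
  · intro w hw hw'
    rw [Finset.mem_singleton] at hw
    subst hw
    rcases Finset.mem_insert.1 hw' with h | h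
    · have := hinj _ _ (by omega) (by omega) h
      omega
    · exact (h1 _ h).2 rfl
  · intro k hk h
    rcases h with h | h
    · left
      exact hinj _ _ (by omega) (by omega) (Finset.mem_singleton.1 h)
    · rcases Finset.mem_insert.1 h with h | h
      · right; left; exact hinj _ _ (by omega) (by omega) h
      · rcases lt_trichotomy k p with hkp | hkp | hkp
        · exact absurd (mem_sg.2 ⟨k, by omega, rfl⟩) (h1 _ h).1
        · exact Or.inl hkp
        · have := h2 _ h (mem_sg.2 ⟨k, by omega, rfl⟩)
          have := hinj _ _ (by omega) (by omega) this
          omega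

theorem twoState_step [Fintype V] (hG : IsTwoConnected G) {x : ℕ → V} {m p t : ℕ}
    (hinj : ∀ i j, i ≤ m → j ≤ m → x i = x j → i = j)
    (hadj : ∀ i, i < m → G.Adj (x i) (x (i + 1))) (hpt : p ≤ t) (htm : t + 1 < m)
    (h : TwoState G x m p t) : TwoState G x m p (t + 1) := by
  obtain ⟨a, b, b', s, R, S, hap, hts, hsm, hbb, hR, hS, hRS, hk⟩ := h
  have hR1 : x (t + 1) ∉ R ∨ s = t + 1 := by
    by_contra! hc
    have := hk (t+1) (by omega) (Or.inl hc.1)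
    omega
  by_cases hst : s = t + 1
  swap
  · have hnR : x (t + 1) ∉ R := by
      rcases hR1 with h | h
      · exact h
      · exact absurd h hst
    have hnS : x (t + 1) ∉ S := by
      intro h
      have := hk (t+1) (by omega) (Or.inr h)
      omega
    refine ⟨a, b, b', s, insert (x (t+1)) R, S, hap, by omega, hsm, hbb,
      hR.snoc (hadj t (by omega)) hnR, hS, ?_, ?_⟩
    · intro w hw
      rcases Finset.mem_insert.1 hw with rfl | hw
      · exact hnS
      · exact hRS w hw
    · intro k hkm h
      by_cases hkt : k = t + 1
      · omega
      · have : x k ∈ R ∨ x k ∈ S := by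
          rcases h with h | h
          · rcases Finset.mem_insert.1 h with h | h
            · exact absurd (hinj _ _ hkm (by omega) h) hkt
            · exact Or.inl h
          · exact Or.inr h
        have := hk k hkm this
        omega
  · subst hst
    have hsS : x (t + 1) ∈ S := hS.right_mem
    have hsR : x (t + 1) ∉ R := fun h => hRS _ h hsS
    have hRs := hR.snoc (hadj t (by omega)) hsR
    obtain ⟨z, hz, w, e, he, T, hzw, hT, h1, h2⟩ := PathOn.conn hG (x (t+1))
      (sg x 0 p ∪ R ∪ S.erase (x (t+1))) (sg x (t+2) m)
      (by
        intro w hw hw'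
        rw [mem_sg] at hw'
        obtain ⟨l, hl, rfl⟩ := hw'
        simp only [Finset.mem_union, mem_sg, Finset.mem_erase] at hw
        rcases hw with (⟨k, hk1, hk2⟩ | h) | h
        · have := hinj _ _ (by omega) (by omega) hk2
          omega
        · have := hk l (by omega) (Or.inl h)
          omega
        · have := hk l (by omega) (Or.inr h.2)
          omega)
      (by
        simp only [Finset.mem_union, mem_sg, Finset.mem_erase]
        rintro ((⟨k, hk1, hk2⟩ | h) | h)
        · have := hinj _ _ (by omega) (by omega) hk2
          omega
        · exact hsR h
        · exact h.1 rfl)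
      (by
        rw [mem_sg]
        rintro ⟨k, hk, hk'⟩
        have := hinj _ _ (by omega) (by omega) hk'
        omega)
      ⟨x 0, by simp only [Finset.mem_union]; left; left; exact mem_sg.2 ⟨0, by omega, rfl⟩⟩
      ⟨x m, mem_sg.2 ⟨m, by omega, rfl⟩⟩
    obtain ⟨s, hs, rfl⟩ := mem_sg.1 he
    have hTR : ∀ y ∈ T, y ∉ R := fun y hy h => (h1 y hy).1 (by simp [h])
    have hTS : ∀ y ∈ T, y ∉ S := fun y hy h => (h1 y hy).1 (by
      simp only [Finset.mem_union, Finset.mem_erase]; right; exact ⟨(h1 y hy).2, h⟩)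
    have hTt : x (t + 1) ∉ T := fun h => (h1 _ h).2 rfl
    have hTk : ∀ k ≤ m, x k ∈ T → (p < k ∧ k < t + 1) ∨ k = s := by
      intro k hkm h
      have hkp : p < k := by
        by_contra hc
        exact (h1 _ h).1 (by
          simp only [Finset.mem_union]; left; left; exact mem_sg.2 ⟨k, by omega, rfl⟩)
      rcases lt_trichotomy k (t+1) with hkt | hkt | hkt
      · exact Or.inl ⟨hkp, hkt⟩
      · exact absurd (hkt ▸ h) hTt
      · right
        exact hinj _ _ hkm (by omega) (h2 _ h (mem_sg.2 ⟨k, by omega, rfl⟩))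
    have hkR : ∀ k ≤ m, x k ∈ R → k = p ∨ k = a ∨ (p < k ∧ k < t) ∨ k = t := by
      intro k hkm h
      by_cases hkt : k = t + 1
      · exact absurd (hkt ▸ h) hsR
      · have := hk k hkm (Or.inl h)
        omega
    by_cases hzR : z ∈ R
    · obtain ⟨R1, hR1s, hR1p, -⟩ := hR.take hzR
      refine ⟨a, b', b, s, S, R1 ∪ T, hap, by omega, by omega, by tauto, hS,
        hR1p.join hzw hT (fun w hw hw' => hTR w hw' (hR1s hw)), ?_, ?_⟩
      · intro w hw hw'
        rcases Finset.mem_union.1 hw' with h | h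
        · exact hRS _ (hR1s h) hw
        · exact hTS _ h hw
      · intro k hkm h
        rw [Finset.mem_union] at h
        rcases h with h | h | h
        · have := hk k hkm (Or.inr h); omega
        · have := hk k hkm (Or.inl (hR1s h)); omega
        · have := hTk k hkm h; omega
    by_cases hzS : z ∈ S.erase (x (t+1))
    · rw [Finset.mem_erase] at hzS
      obtain ⟨S1, hS1s, hS1p, hS1⟩ := hS.take hzS.2
      have hS1' := hS1 hzS.1
      refine ⟨a, b, b', s, insert (x (t+1)) R, S1 ∪ T, hap, by omega, by omega, hbb, hRs,
        hS1p.join hzw hT (fun w hw hw' => hTS w hw' (hS1s hw)), ?_, ?_⟩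
      · intro w hw hw'
        rcases Finset.mem_insert.1 hw with rfl | hw
        · rcases Finset.mem_union.1 hw' with h | h
          · exact hS1' h
          · exact hTt h
        · rcases Finset.mem_union.1 hw' with h | h
          · exact hRS _ hw (hS1s h)
          · exact hTR _ h hw
      · intro k hkm h
        rw [Finset.mem_union, Finset.mem_insert] at h
        rcases h with (h | h) | h | h
        · have := hinj _ _ hkm (by omega) h; omega
        · have := hk k hkm (Or.inl h); omega
        · have := hk k hkm (Or.inr (hS1s h)); omega
        · have := hTk k hkm h; omega
    · have hzA : z ∈ sg x 0 p := by
        simp only [Finset.mem_union] at hz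
        tauto
      obtain ⟨l, hl, rfl⟩ := mem_sg.1 hzA
      have hlt : x l ≠ x (t + 1) := fun h => by
        have := hinj _ _ (by omega) (by omega) h; omega
      have hzS' : x l ∉ S := fun h => hzS (Finset.mem_erase.2 ⟨hlt, h⟩)
      have hlp : l ≠ p := by
        rintro rfl
        rcases hbb with ⟨rfl, rfl⟩ | ⟨rfl, rfl⟩
        · exact hzR hR.left_mem
        · exact hzS' hS.left_mem
      have hnew : PathOn G (x l) (x s) (insert (x l) T) := PathOn.cons hzw hT (fun h => (h1 _ h).1 hz)
      rcases hbb with ⟨rfl, rfl⟩ | ⟨rfl, rfl⟩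
      · refine ⟨l, b, l, s, insert (x (t+1)) R, insert (x l) T, by omega, by omega, by omega,
          Or.inl ⟨rfl, rfl⟩, hRs, hnew, ?_, ?_⟩
        · intro w hw hw'
          rcases Finset.mem_insert.1 hw with rfl | hw
          · rcases Finset.mem_insert.1 hw' with h | h
            · exact hlt h.symm
            · exact hTt h
          · rcases Finset.mem_insert.1 hw' with rfl | h
            · exact hzR hw
            · exact hTR _ h hw
        · intro k hkm h
          rw [Finset.mem_insert, Finset.mem_insert] at h
          rcases h with (h | h) | h | h
          · have := hinj _ _ hkm (by omega) h; omega
          · by_cases hkb' : k = b'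
            · subst hkb'
              rcases Nat.lt_or_ge k b with _ | _
              · exact absurd hS.left_mem (hRS _ h)
              · omega
            · have := hkR k hkm h; omega
          · have := hinj _ _ hkm (by omega) h; omega
          · have := hTk k hkm h; omega
      · refine ⟨l, b', l, s, S, insert (x l) T, by omega, by omega, by omega,
          Or.inl ⟨rfl, rfl⟩, hS, hnew, ?_, ?_⟩
        · intro w hw hw'
          rcases Finset.mem_insert.1 hw' with rfl | h
          · exact hzS' hw
          · exact hTS _ h hw
        · intro k hkm h
          rw [Finset.mem_insert] at h
          rcases h with h | h | h
          · by_cases hkb' : k = b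
            · subst hkb'
              exact absurd h (hRS _ hR.left_mem)
            · have := hk k hkm (Or.inr h); omega
          · have := hinj _ _ hkm (by omega) h; omega
          · have := hTk k hkm h; omega

theorem twoState_all [Fintype V] (hG : IsTwoConnected G) {x : ℕ → V} {m p q : ℕ}
    (hinj : ∀ i j, i ≤ m → j ≤ m → x i = x j → i = j)
    (hadj : ∀ i, i < m → G.Adj (x i) (x (i + 1))) (hp : 0 < p) (hpq : p ≤ q) (hq : q < m) :
    TwoState G x m p q := by
  induction q, hpq using Nat.le_induction with
  | base => exact twoState_base hG hinj hp hq
  | succ t hpt ih => exact twoState_step hG hinj hadj hpt hq (ih (by omega))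

theorem count_lem [Fintype V] [DecidableRel G.Adj] {X Y : Finset V} (hdisj : Disjoint X Y)
    (hbip : ∀ x y : V, G.Adj x y → (x ∈ X ∧ y ∈ Y) ∨ (x ∈ Y ∧ y ∈ X))
    {x : ℕ → V} {m n : ℕ} (hu : x 0 ∈ X) (hv : x m ∈ Y)
    (hinj : ∀ i j, i ≤ m → j ≤ m → x i = x j → i = j)
    (hadj : ∀ i, i < m → G.Adj (x i) (x (i + 1)))
    (hmaxu : ∀ w, G.Adj (x 0) w → ∃ k ≤ m, x k = w)
    (S : Finset V) (hvS : ∀ w, G.Adj (x m) w → w ∈ S)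
    (huS : ∀ k, k + 1 ≤ m → k + 1 ≠ n → G.Adj (x 0) (x (k + 1)) → x k ∈ S ∧ ¬ G.Adj (x m) (x k)) :
    G.degree (x 0) + G.degree (x m) - 1 ≤ (S ∩ X).card := by
  have hd : ∀ w, w ∈ X → w ∈ Y → False := fun w h1 h2 => Finset.disjoint_left.1 hdisj h1 h2
  set A := (Finset.range m).filter (fun k => G.Adj (x 0) (x (k + 1))) with hA
  have hdu : G.degree (x 0) = A.card := by
    rw [← SimpleGraph.card_neighborFinset_eq_degree]
    have : G.neighborFinset (x 0) = A.image (fun k => x (k + 1)) := by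
      ext w
      simp only [SimpleGraph.mem_neighborFinset, hA, Finset.mem_image, Finset.mem_filter,
        Finset.mem_range]
      constructor
      · intro h
        obtain ⟨k, hk, rfl⟩ := hmaxu w h
        rcases k with _ | k
        · exact absurd h (G.loopless.irrefl _)
        · exact ⟨k, ⟨by omega, h⟩, rfl⟩
      · rintro ⟨k, ⟨_, h⟩, rfl⟩
        exact h
    rw [this, Finset.card_image_of_injOn]
    intro k hk l hl h
    simp only [hA, Finset.coe_filter, Finset.mem_range, Set.mem_ofPred_eq] at hk hl
    have := hinj _ _ (by omega) (by omega) h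
    omega
  have h1 : A.card - 1 ≤ ((A.erase (n - 1)).image x).card := by
    rw [Finset.card_image_of_injOn]
    · exact Finset.pred_card_le_card_erase
    · intro k hk l hl h
      simp only [hA, Finset.coe_erase, Finset.coe_filter, Finset.mem_range, Set.mem_sdiff,
        Set.mem_ofPred_eq] at hk hl
      exact hinj _ _ (by omega) (by omega) h
  have hAe : ∀ k ∈ A.erase (n - 1), x k ∈ S ∧ ¬ G.Adj (x m) (x k) ∧ x k ∈ X := by
    intro k hk
    simp only [hA, Finset.mem_erase, Finset.mem_filter, Finset.mem_range] at hk
    have h2 := huS k (by omega) (by omega) hk.2.2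
    refine ⟨h2.1, h2.2, ?_⟩
    rcases hbip _ _ (hadj k hk.2.1) with h | h
    · exact h.1
    · rcases hbip _ _ hk.2.2 with h' | h'
      · exact (hd _ h.2 h'.2).elim
      · exact (hd _ hu h'.1).elim
  have hdis : Disjoint ((A.erase (n - 1)).image x) (G.neighborFinset (x m)) := by
    rw [Finset.disjoint_left]
    intro w hw hw'
    obtain ⟨k, hk, rfl⟩ := Finset.mem_image.1 hw
    exact (hAe k hk).2.1 (by simpa using hw')
  have hsub : ((A.erase (n - 1)).image x) ∪ (G.neighborFinset (x m)) ⊆ S ∩ X := by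
    intro w hw
    rw [Finset.mem_inter]
    rcases Finset.mem_union.1 hw with hw | hw
    · obtain ⟨k, hk, rfl⟩ := Finset.mem_image.1 hw
      exact ⟨(hAe k hk).1, (hAe k hk).2.2⟩
    · rw [SimpleGraph.mem_neighborFinset] at hw
      refine ⟨hvS w hw, ?_⟩
      rcases hbip _ _ hw with h | h
      · exact (hd _ h.1 hv).elim
      · exact h.2
  have h3 := Finset.card_le_card hsub
  rw [Finset.card_union_of_disjoint hdis, SimpleGraph.card_neighborFinset_eq_degree] at h3
  omega

theorem main_aux [Fintype V] [DecidableRel G.Adj] {X Y : Finset V} (hdisj : Disjoint X Y)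
    (hbip : ∀ x y : V, G.Adj x y → (x ∈ X ∧ y ∈ Y) ∨ (x ∈ Y ∧ y ∈ X))
    (hG : IsTwoConnected G)
    {x : ℕ → V} {m : ℕ} (hu : x 0 ∈ X) (hv : x m ∈ Y)
    (hinj : ∀ i j, i ≤ m → j ≤ m → x i = x j → i = j)
    (hadj : ∀ i, i < m → G.Adj (x i) (x (i + 1)))
    (hmaxu : ∀ w, G.Adj (x 0) w → ∃ k ≤ m, x k = w)
    (hmaxv : ∀ w, G.Adj (x m) w → ∃ k ≤ m, x k = w) :
    ∃ a b S, PathOn G a b S ∧ G.Adj b a ∧ 3 ≤ S.card ∧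
      min (m + 1) (2 * (G.degree (x 0) + G.degree (x m) - 1)) ≤ S.card := by
  have hd : ∀ w, w ∈ X → w ∈ Y → False := fun w h1 h2 => Finset.disjoint_left.1 hdisj h1 h2
  have hm0 : m ≠ 0 := by rintro rfl; exact hd _ hu hv
  have hnotboth : ∀ w, G.Adj (x 0) w → G.Adj (x m) w → False := by
    intro w h1 h2
    rcases hbip _ _ h1 with h | h <;> rcases hbip _ _ h2 with h' | h'
    · exact hd _ h'.1 hv
    · exact hd _ h'.2 h.2
    · exact hd _ hu h.1
    · exact hd _ hu h.1
  -- a second neighbour of `x 0`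
  have hne : ∃ l, 1 < l ∧ l ≤ m ∧ G.Adj (x 0) (x l) := by
    have h01 : x 0 ≠ x 1 := fun h => by
      have := hinj _ _ (by omega) (by omega) h
      omega
    obtain ⟨y, hy⟩ : ∃ y, y ∈ (Finset.univ \ {x 0, x 1} : Finset V) := by
      have h1 : ({x 0, x 1} : Finset V).card ≤ 2 := Finset.card_le_two
      have h2 := hG.1
      have h3 := Finset.le_card_sdiff ({x 0, x 1} : Finset V) Finset.univ
      rw [Finset.card_univ] at h3
      have : 0 < (Finset.univ \ {x 0, x 1} : Finset V).card := by omega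
      exact Finset.card_pos.1 this
    obtain ⟨z, hz, w, e, he, T, hzw, hT, h1, h2⟩ := PathOn.conn hG (x 1) {x 0}
      (Finset.univ \ {x 0, x 1}) (by simp) (by simpa using h01.symm) (by simp) (by simp) ⟨y, hy⟩
    rw [Finset.mem_singleton] at hz
    subst hz
    obtain ⟨k, hk, rfl⟩ := hmaxu w hzw
    refine ⟨k, ?_, hk, hzw⟩
    have h3 := (h1 _ hT.left_mem).2
    have h4 := hzw.ne
    by_contra hc
    interval_cases k
    · exact h4 rfl
    · exact h3 rfl
  obtain ⟨l, hl1, hlm, hl⟩ := hne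
  have hdu : 2 ≤ G.degree (x 0) := by
    rw [← SimpleGraph.card_neighborFinset_eq_degree]
    have : ({x 1, x l} : Finset V) ⊆ G.neighborFinset (x 0) := by
      intro w hw
      rw [SimpleGraph.mem_neighborFinset]
      simp only [Finset.mem_insert, Finset.mem_singleton] at hw
      rcases hw with rfl | rfl
      · exact hadj 0 (by omega)
      · exact hl
    have h2 := Finset.card_le_card this
    rwa [Finset.card_pair (fun h => by
      have := hinj _ _ (by omega) (by omega) h
      omega)] at h2
  have hvm : G.Adj (x m) (x (m - 1)) := by
    have := hadj (m - 1) (by omega)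
    rw [Nat.sub_add_cancel (by omega)] at this
    exact this.symm
  have hdv : 1 ≤ G.degree (x m) := by
    rw [← SimpleGraph.card_neighborFinset_eq_degree]
    exact Finset.card_pos.2 ⟨x (m-1), by simpa using hvm⟩
  -- finishing tool
  have finish : ∀ a b S n, PathOn G a b S → G.Adj b a → (∀ w, G.Adj (x m) w → w ∈ S) →
      (∀ k, k + 1 ≤ m → k + 1 ≠ n → G.Adj (x 0) (x (k + 1)) → x k ∈ S ∧ ¬ G.Adj (x m) (x k)) →
      ∃ a b S, PathOn G a b S ∧ G.Adj b a ∧ 3 ≤ S.card ∧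
      min (m + 1) (2 * (G.degree (x 0) + G.degree (x m) - 1)) ≤ S.card := by
    intro a b S n hp hba h1 h2
    have h3 := count_lem hdisj hbip hu hv hinj hadj hmaxu S h1 h2
    have h4 := hp.cycle_parity hdisj hbip hba
    exact ⟨a, b, S, hp, hba, by omega, by omega⟩
  -- crossing cycles
  have crossing : ∀ i j, i < j → j ≤ m → G.Adj (x m) (x i) → G.Adj (x 0) (x j) →
      PathOn G (x i) (x m) (sg x 0 i ∪ sg x j m) := by
    intro i j hij hj hi1 hj1
    refine (sg_path hinj hadj (Nat.zero_le i) (by omega)).symm.join hj1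
      (sg_path hinj hadj hj le_rfl) ?_
    intro w hw hw'
    rw [mem_sg] at hw hw'
    obtain ⟨k, hk, rfl⟩ := hw
    obtain ⟨l, hl, hl'⟩ := hw'
    have := hinj _ _ (by omega) (by omega) hl'
    omega
  by_cases hham : ∃ k, k < m ∧ G.Adj (x m) (x k) ∧ G.Adj (x 0) (x (k + 1))
  · obtain ⟨k, hk, h1, h2⟩ := hham
    have hp := crossing k (k+1) (by omega) (by omega) h1 h2
    have hc : (sg x 0 k ∪ sg x (k+1) m).card = m + 1 := by
      have : sg x 0 k ∪ sg x (k+1) m = (Finset.range (m + 1)).image x := by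
        ext w
        simp only [Finset.mem_union, mem_sg, Finset.mem_image, Finset.mem_range]
        constructor
        · rintro (⟨i, hi, rfl⟩ | ⟨i, hi, rfl⟩) <;> exact ⟨i, by omega, rfl⟩
        · rintro ⟨i, hi, rfl⟩
          rcases Nat.lt_or_ge k i with h | h
          · right; exact ⟨i, by omega, rfl⟩
          · left; exact ⟨i, by omega, rfl⟩
      rw [this, Finset.card_image_of_injOn, Finset.card_range]
      intro i hi j hj h
      simp only [Finset.coe_range, Set.mem_Iio] at hi hj
      exact hinj _ _ (by omega) (by omega) h
    exact ⟨_, _, _, hp, h1, by omega, by omega⟩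
  have hham' : ∀ k, k + 1 ≤ m → G.Adj (x 0) (x (k+1)) → ¬ G.Adj (x m) (x k) :=
    fun k hk h1 h2 => hham ⟨k, by omega, h2, h1⟩
  by_cases hcr : ∃ r, ∃ i, i + r + 1 ≤ m ∧ G.Adj (x m) (x i) ∧ G.Adj (x 0) (x (i + r + 1))
  · classical
    obtain ⟨i, hi, h1, h2⟩ := Nat.find_spec hcr
    have hmin := fun r (hr : r < Nat.find hcr) => Nat.find_min hcr hr
    generalize Nat.find hcr = r at hi h1 h2 hmin
    have hp := crossing i (i + r + 1) (by omega) hi h1 h2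
    have hbu : ∀ k, i < k → k < i + r + 1 → ¬ G.Adj (x 0) (x k) := by
      intro k hk1 hk2 h
      refine hmin (k - i - 1) (by omega) ⟨i, by omega, h1, ?_⟩
      rwa [show i + (k - i - 1) + 1 = k by omega]
    have hbv : ∀ k, i < k → k < i + r + 1 → ¬ G.Adj (x m) (x k) := by
      intro k hk1 hk2 h
      refine hmin (i + r - k) (by omega) ⟨k, by omega, h, ?_⟩
      rwa [show k + (i + r - k) + 1 = i + r + 1 by omega]
    refine finish _ _ _ (i + r + 1) hp h1 ?_ ?_
    · intro w hw
      obtain ⟨k, hk, rfl⟩ := hmaxv w hw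
      rw [Finset.mem_union, mem_sg, mem_sg]
      rcases Nat.lt_or_ge i k with h | h
      · right
        refine ⟨k, ⟨?_, hk⟩, rfl⟩
        by_contra hc
        exact hbv k h (by omega) hw
      · left; exact ⟨k, by omega, rfl⟩
    · intro k hk hkn h
      refine ⟨?_, hham' k hk h⟩
      rw [Finset.mem_union, mem_sg, mem_sg]
      rcases Nat.lt_or_ge i k with h' | h'
      · right
        refine ⟨k, ⟨?_, by omega⟩, rfl⟩
        by_contra hc
        exact hbu (k+1) (by omega) (by omega) h
      · left; exact ⟨k, by omega, rfl⟩
  -- no crossing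
  have hnc : ∀ i j, i < j → j ≤ m → G.Adj (x m) (x i) → G.Adj (x 0) (x j) → False := by
    intro i j hij hj h1 h2
    refine hcr ⟨j - i - 1, i, by omega, h1, ?_⟩
    rwa [show i + (j - i - 1) + 1 = j by omega]
  obtain ⟨p, hp, hpm, hpmax⟩ : ∃ p, G.Adj (x 0) (x p) ∧ p ≤ m ∧
      ∀ k ≤ m, G.Adj (x 0) (x k) → k ≤ p := by
    have hex : ((Finset.range (m+1)).filter (fun k => G.Adj (x 0) (x k))).Nonempty :=
      ⟨l, by simp [hl]; omega⟩
    obtain ⟨p, hp, hmx⟩ := Finset.exists_max_image _ id hex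
    simp only [Finset.mem_filter, Finset.mem_range, id] at hp hmx
    exact ⟨p, hp.2, by omega, fun k hk h => hmx k ⟨by omega, h⟩⟩
  obtain ⟨q, hq, hqm, hqmin⟩ : ∃ q, G.Adj (x m) (x q) ∧ q ≤ m ∧
      ∀ k ≤ m, G.Adj (x m) (x k) → q ≤ k := by
    have hex : ((Finset.range (m+1)).filter (fun k => G.Adj (x m) (x k))).Nonempty :=
      ⟨m - 1, by simp [hvm]⟩
    obtain ⟨p, hp, hmx⟩ := Finset.exists_min_image _ id hex
    simp only [Finset.mem_filter, Finset.mem_range, id] at hp hmx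
    exact ⟨p, hp.2, by omega, fun k hk h => hmx k ⟨by omega, h⟩⟩
  have hpq : p < q := by
    rcases lt_trichotomy p q with h | h | h
    · exact h
    · subst h; exact (hnotboth _ hp hq).elim
    · exact (hnc q p h hpm hq hp).elim
  have hqm' : q < m := by
    rcases hqm.lt_or_eq with h | h
    · exact h
    · subst h; exact absurd hq (G.loopless.irrefl _)
  have hp1 : 1 < p := lt_of_lt_of_le hl1 (hpmax l hlm hl)
  obtain ⟨a, b, b', s, R, S, hap, hqs, hsm, hbb, hR, hS, hRS, hk⟩ :=
    twoState_all hG hinj hadj (by omega) hpq.le hqm'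
  obtain ⟨n, han, hn, hnp, hnmin⟩ : ∃ n, a < n ∧ G.Adj (x 0) (x n) ∧ n ≤ p ∧
      ∀ k, a < k → k ≤ m → G.Adj (x 0) (x k) → n ≤ k := by
    have hex : ((Finset.Ioc a m).filter (fun k => G.Adj (x 0) (x k))).Nonempty :=
      ⟨p, by simp [hp]; omega⟩
    obtain ⟨n, hn, hmx⟩ := Finset.exists_min_image _ id hex
    simp only [Finset.mem_filter, Finset.mem_Ioc, id] at hn hmx
    exact ⟨n, hn.1.1, hn.2, hmx p ⟨by omega, hp⟩, fun k h1 h2 h => hmx k ⟨by omega, h⟩⟩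
  obtain ⟨n', hns, hn', hnq, hnmax⟩ : ∃ n', n' < s ∧ G.Adj (x m) (x n') ∧ q ≤ n' ∧
      ∀ k, k < s → G.Adj (x m) (x k) → k ≤ n' := by
    have hex : ((Finset.range s).filter (fun k => G.Adj (x m) (x k))).Nonempty :=
      ⟨q, by simp [hq]; omega⟩
    obtain ⟨n, hn, hmx⟩ := Finset.exists_max_image _ id hex
    simp only [Finset.mem_filter, Finset.mem_range, id] at hn hmx
    exact ⟨n, hn.1, hn.2, hmx q ⟨by omega, hq⟩, fun k h1 h => hmx k ⟨by omega, h⟩⟩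
  have hA0 : PathOn G (x a) (x p) (sg x 0 a ∪ sg x n p) := by
    refine (sg_path hinj hadj (Nat.zero_le a) (by omega)).symm.join hn
      (sg_path hinj hadj hnp (by omega)) ?_
    intro w hw hw'
    rw [mem_sg] at hw hw'
    obtain ⟨k, hk, rfl⟩ := hw
    obtain ⟨l, hl, hl'⟩ := hw'
    have := hinj _ _ (by omega) (by omega) hl'
    omega
  have hA1 : PathOn G (x b') (x b) (sg x 0 a ∪ sg x n p) := by
    rcases hbb with ⟨rfl, rfl⟩ | ⟨rfl, rfl⟩
    · exact hA0
    · exact hA0.symm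
  have hB : PathOn G (x q) (x s) (sg x q n' ∪ sg x s m) := by
    refine ((sg_path hinj hadj hnq (by omega)).join hn'.symm
      (sg_path hinj hadj hsm le_rfl).symm ?_)
    intro w hw hw'
    rw [mem_sg] at hw hw'
    obtain ⟨k, hk, rfl⟩ := hw
    obtain ⟨l, hl, hl'⟩ := hw'
    have := hinj _ _ (by omega) (by omega) hl'
    omega
  have mA : ∀ w ∈ sg x 0 a ∪ sg x n p, ∃ k ≤ p, x k = w := by
    intro w hw
    rw [Finset.mem_union, mem_sg, mem_sg] at hw
    rcases hw with ⟨k, hk, rfl⟩ | ⟨k, hk, rfl⟩ <;> exact ⟨k, by omega, rfl⟩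
  have mB : ∀ w ∈ sg x q n' ∪ sg x s m, ∃ k, q ≤ k ∧ k ≤ m ∧ x k = w := by
    intro w hw
    rw [Finset.mem_union, mem_sg, mem_sg] at hw
    rcases hw with ⟨k, hk, rfl⟩ | ⟨k, hk, rfl⟩ <;> exact ⟨k, by omega, by omega, rfl⟩
  generalize hSA : sg x 0 a ∪ sg x n p = SA at hA0 hA1 mA
  generalize hSB : sg x q n' ∪ sg x s m = SB at hB mB
  have dAR : ∀ w ∈ SA, w ∈ R → w = x b := by
    intro w hw hwR
    obtain ⟨k, hkp, rfl⟩ := mA w hw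
    have h1 := hk k (by omega) (Or.inl hwR)
    have h2 : k ≠ b' := by
      rintro rfl
      exact hRS _ hwR hS.left_mem
    have : k = b := by omega
    rw [this]
  have dAS : ∀ w ∈ SA, w ∈ S → w = x b' := by
    intro w hw hwR
    obtain ⟨k, hkp, rfl⟩ := mA w hw
    have h1 := hk k (by omega) (Or.inr hwR)
    have h2 : k ≠ b := by
      rintro rfl
      exact hRS _ hR.left_mem hwR
    have : k = b' := by omega
    rw [this]
  have dBR : ∀ w ∈ SB, w ∈ R → w = x q := by
    intro w hw hwR
    obtain ⟨k, hkq, hkm, rfl⟩ := mB w hw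
    have h1 := hk k (by omega) (Or.inl hwR)
    have h2 : k ≠ s := by
      rintro rfl
      exact hRS _ hwR hS.right_mem
    have : k = q := by omega
    rw [this]
  have dBS : ∀ w ∈ SB, w ∈ S → w = x s := by
    intro w hw hwR
    obtain ⟨k, hkq, hkm, rfl⟩ := mB w hw
    have h1 := hk k (by omega) (Or.inr hwR)
    have h2 : k ≠ q := by
      rintro rfl
      exact hRS _ hR.right_mem hwR
    have : k = s := by omega
    rw [this]
  have dAB : ∀ w ∈ SA, w ∉ SB := by
    intro w hw hw'
    obtain ⟨k, hkp, rfl⟩ := mA w hw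
    obtain ⟨l, hlq, hlm, hl⟩ := mB _ hw'
    have := hinj _ _ (by omega) (by omega) hl
    omega
  have hb's : x b' ≠ x s := fun h => by
    have := hinj _ _ (by omega) (by omega) h
    omega
  obtain ⟨y, S', hy, hS', hbS', rfl⟩ := hS.peel hb's
  have hARB : PathOn G (x b') (x s) (SA ∪ R ∪ SB) := by
    refine (hA1.glue hR dAR).glue hB ?_
    intro w hw hwB
    rcases Finset.mem_union.1 hw with h | h
    · exact absurd hwB (dAB w h)
    · exact dBR w hwB h
  have hfull : PathOn G (x b') y (SA ∪ R ∪ SB ∪ S') := by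
    refine hARB.glue hS'.symm ?_
    intro w hw hwS
    have hwS2 : w ∈ insert (x b') S' := Finset.mem_insert_of_mem hwS
    rcases Finset.mem_union.1 hw with h | h
    · rcases Finset.mem_union.1 h with h | h
      · exact absurd (dAS w h hwS2 ▸ hwS) hbS'
      · exact absurd hwS2 (hRS w h)
    · exact dBS w h hwS2
  refine finish _ _ _ n hfull hy.symm ?_ ?_
  · intro w hw
    obtain ⟨k, hk, rfl⟩ := hmaxv w hw
    have hqk := hqmin k hk hw
    have : x k ∈ SB := by
      rw [← hSB, Finset.mem_union, mem_sg, mem_sg]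
      rcases Nat.lt_or_ge k s with h | h
      · left; exact ⟨k, ⟨hqk, hnmax k h hw⟩, rfl⟩
      · right; exact ⟨k, by omega, rfl⟩
    simp [this]
  · intro k hk hkn h
    refine ⟨?_, hham' k hk h⟩
    have hkp := hpmax _ hk h
    have : x k ∈ SA := by
      rw [← hSA, Finset.mem_union, mem_sg, mem_sg]
      rcases Nat.lt_or_ge a (k+1) with h' | h'
      · have := hnmin _ h' hk h
        right; exact ⟨k, by omega, rfl⟩
      · left; exact ⟨k, by omega, rfl⟩
    simp [this]

end main

/-- Let `G` be a 2-connected bipartite graph with parts `X, Y` and `P` a maximal path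
(no neighbour of either endpoint lies off `P`) with endpoints `u ∈ X`, `v ∈ Y`. Then `G`
contains a cycle of length at least `min {|V(P)|, 2(d(u) + d(v) - 1)}`, where `d` is the
degree in `G`. -/
theorem stmt_8 {V : Type*} [Fintype V] [DecidableEq V]
    (G : SimpleGraph V) [DecidableRel G.Adj]
    (X Y : Finset V) (hdisj : Disjoint X Y) (hunion : X ∪ Y = Finset.univ)
    (hbip : ∀ x y : V, G.Adj x y → (x ∈ X ∧ y ∈ Y) ∨ (x ∈ Y ∧ y ∈ X))
    (hG : IsTwoConnected G)
    (u v : V) (hu : u ∈ X) (hv : v ∈ Y) (P : G.Walk u v) (hP : P.IsPath)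
    (hmax : ∀ w : V, (G.Adj u w ∨ G.Adj v w) → w ∈ P.support) :
    ∃ (w : V) (c : G.Walk w w), c.IsCycle ∧
      min P.support.length (2 * (G.degree u + G.degree v - 1)) ≤ c.length := by
  have hx0 : P.getVert 0 = u := P.getVert_zero
  have hxm : P.getVert P.length = v := P.getVert_length
  have hsup : ∀ w, w ∈ P.support → ∃ k ≤ P.length, P.getVert k = w := by
    intro w hw
    obtain ⟨k, h1, h2⟩ := SimpleGraph.Walk.mem_support_iff_exists_getVert.1 hw
    exact ⟨k, h2, h1⟩
  obtain ⟨a, b, S, hp, hba, h3, hle⟩ := main_aux (G := G) hdisj hbip hG (x := P.getVert)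
    (m := P.length) (by rw [hx0]; exact hu) (by rw [hxm]; exact hv)
    (fun i j hi hj h => hP.getVert_injOn hi hj h)
    (fun i hi => P.adj_getVert_succ hi)
    (fun w hw => hsup w (hmax w (Or.inl (by rwa [hx0] at hw))))
    (fun w hw => hsup w (hmax w (Or.inr (by rwa [hxm] at hw))))
  obtain ⟨w, c, hc, hcl⟩ := hp.toCycle hba h3
  refine ⟨w, c, hc, ?_⟩
  rw [hcl, SimpleGraph.Walk.length_support]
  have e : ∀ w w' : V, w = w' → G.degree w = G.degree w' := by
    rintro w _ rfl
    rfl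
  rw [e _ _ hx0, e _ _ hxm] at hle
  exact hle
end

section
/- Let G be a 2-connected graph on n vertices with minimum degree δ(G) ≥ r ≥ 2, where n ≥ k ≥ 5, and set h = ⌊(k-1)/2⌋. If the number of copies of K_{s,s} in G exceeds max{ g_{s,s}(n,k,r), g_{s,s}(n,k,h) }, where g_{s,s}(n,k,a) = Σ_{i=1}^{n-k+a} C(a,s)·C(n-s-i, s-1) + (1/2)·C(k-a, 2s)·C(2s, s), then G contains a cycle of length at least k. -/
/-- The number of (unordered, not necessarily induced) copies of the complete bipartite
graph `K_{s,s}` in `G`: half the number of ordered pairs `(S, T)` of disjoint `s`-sets of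
vertices with all edges between `S` and `T` present. -/
noncomputable def kssCount {V : Type*} [Fintype V] (G : SimpleGraph V) (s : ℕ) : ℕ :=
  ({p : Finset V × Finset V | p.1.card = s ∧ p.2.card = s ∧ Disjoint p.1 p.2 ∧
      ∀ x ∈ p.1, ∀ y ∈ p.2, G.Adj x y} : Set (Finset V × Finset V)).ncard / 2

/-- `g_{s,s}(n, k, a) = Σ_{i=1}^{n-k+a} C(a,s)·C(n-s-i, s-1) + (1/2)·C(k-a, 2s)·C(2s, s)`. -/
def gss (n k a s : ℕ) : ℕ :=
  (∑ i ∈ Finset.Icc 1 (n - k + a), a.choose s * (n - s - i).choose (s - 1))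
    + (k - a).choose (2 * s) * (2 * s).choose s / 2


/-- `PO G u w S`: there is a path from `u` to `w` with vertex set `S`. -/
inductive PO {V : Type*} [DecidableEq V] (G : SimpleGraph V) : V → V → Finset V → Prop
  | single (u : V) : PO G u u {u}
  | cons {u v w : V} {S : Finset V} : G.Adj u v → PO G v w S → u ∉ S → PO G u w (insert u S)

namespace PO
variable {V : Type*} [DecidableEq V] {G : SimpleGraph V}

lemma left_mem {u w : V} {S : Finset V} (h : PO G u w S) : u ∈ S := by
  cases h <;> simp

lemma right_mem {u w : V} {S : Finset V} (h : PO G u w S) : w ∈ S := by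
  induction h with
  | single u => simp
  | cons _ _ _ ih => simp [ih]

lemma joinE {u z z' w : V} {S T : Finset V} (h1 : PO G u z S) (e : G.Adj z z')
    (h2 : PO G z' w T) (hd : ∀ x ∈ S, x ∉ T) : PO G u w (S ∪ T) := by
  induction h1 with
  | single u =>
    rw [← Finset.insert_eq]
    exact .cons e h2 (hd u (by simp))
  | @cons a b c S' hab _ ha ih =>
    rw [Finset.insert_union]
    refine .cons hab (ih e (fun x hx => hd x (by simp [hx]))) ?_
    have := hd a (by simp)
    simp [ha, this]

lemma reverse {u w : V} {S : Finset V} (h : PO G u w S) : PO G w u S := by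
  induction h with
  | single u => exact .single u
  | @cons a b c S' hab _ ha ih =>
    have := joinE ih hab.symm (.single a) (by intro x hx; simp; rintro rfl; exact ha hx)
    rwa [Finset.union_comm, ← Finset.insert_eq] at this

lemma join {u z w : V} {S T : Finset V} (h1 : PO G u z S)
    (h2 : PO G z w T) (hd : ∀ x ∈ S, x ∈ T → x = z) : PO G u w (S ∪ T) := by
  induction h1 with
  | single u =>
    rw [← Finset.insert_eq, Finset.insert_eq_of_mem h2.left_mem]
    exact h2
  | @cons a b c S' hab h ha ih =>
    rw [Finset.insert_union]
    refine .cons hab (ih h2 (fun x hx => hd x (by simp [hx]))) ?_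
    have := hd a (by simp)
    have := h.right_mem
    grind

lemma split {u w z : V} {S : Finset V} (h : PO G u w S) (hz : z ∈ S) :
    ∃ S1 S2, PO G u z S1 ∧ PO G z w S2 ∧ S1 ∪ S2 = S ∧ ∀ x ∈ S1, x ∈ S2 → x = z := by
  induction h with
  | single u =>
    simp at hz; subst hz
    exact ⟨{z}, {z}, .single _, .single _, by simp, by simp⟩
  | @cons a b c S' hab h ha ih =>
    by_cases hza : z = a
    · subst hza
      exact ⟨{z}, insert z S', .single _, .cons hab h ha, by simp, by simp⟩
    · obtain ⟨S1, S2, h1, h2, h3, h4⟩ := ih (by grind)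
      refine ⟨insert a S1, S2, .cons hab h1 (by grind), h2, by grind, by grind⟩

lemma lastHit {u w : V} {S W : Finset V} (h : PO G u w S) (hW : ∃ x ∈ S, x ∈ W) :
    ∃ z T, z ∈ W ∧ PO G z w T ∧ T ⊆ S ∧ (∀ x ∈ T, x ∈ W → x = z) ∧ (u ∈ T → z = u) := by
  induction h with
  | single u =>
    obtain ⟨x, hx, hxW⟩ := hW
    simp at hx; subst hx
    exact ⟨x, {x}, hxW, .single _, by simp, by simp, by simp⟩
  | @cons a b c S' hab h ha ih =>
    by_cases hh : ∃ x ∈ S', x ∈ W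
    · obtain ⟨z, T, h1, h2, h3, h4, h5⟩ := ih hh
      exact ⟨z, T, h1, h2, by grind, h4, by grind⟩
    · exact ⟨a, insert a S', by grind, .cons hab h ha, by simp, by grind, by simp⟩

lemma mono {G' : SimpleGraph V} (hG : G ≤ G') {u w : V} {S : Finset V} (h : PO G u w S) :
    PO G' u w S := by
  induction h with
  | single u => exact .single u
  | cons hab _ ha ih => exact .cons (hG hab) ih ha

lemma toFun {u w : V} {S : Finset V} (h : PO G u w S) :
    ∃ (f : ℕ → V) (m : ℕ), f 0 = u ∧ f m = w ∧ (∀ i < m, G.Adj (f i) (f (i+1))) ∧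
      (∀ i ≤ m, ∀ j ≤ m, f i = f j → i = j) ∧ S = (Finset.range (m+1)).image f := by
  induction h with
  | single u => exact ⟨fun _ => u, 0, rfl, rfl, by simp, by simp, by simp⟩
  | @cons a b c S' hab h ha ih =>
    obtain ⟨f, m, h0, hm, hadj, hinj, hS⟩ := ih
    have hne : ∀ i ≤ m, f i ≠ a := by
      rintro i hi rfl
      exact ha (by rw [hS]; exact Finset.mem_image_of_mem _ (by simp; omega))
    refine ⟨fun i => Nat.casesOn i a f, m+1, rfl, hm, ?_, ?_, ?_⟩
    · rintro (_ | i) hi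
      · simpa [h0] using hab
      · exact hadj i (by omega)
    · rintro (_ | i) hi (_ | j) hj hij
      · rfl
      · exact absurd hij.symm (hne j (by omega))
      · exact absurd hij (hne i (by omega))
      · simpa using hinj i (by omega) j (by omega) hij
    · rw [Finset.range_add_one', Finset.image_insert, hS]
      congr 1
      ext x
      simp
      exact Iff.rfl

lemma seg (f : ℕ → V) (m : ℕ) (hadj : ∀ i < m, G.Adj (f i) (f (i+1)))
    (hinj : ∀ i ≤ m, ∀ j ≤ m, f i = f j → i = j) (i j : ℕ) (hij : i ≤ j) (hj : j ≤ m) :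
    PO G (f i) (f j) ((Finset.Icc i j).image f) := by
  induction j, hij using Nat.le_induction with
  | base => simpa using PO.single (f i)
  | succ j hij ih =>
    have := joinE (ih (by omega)) (hadj j (by omega)) (.single (f (j+1))) (by
      intro x hx hx'
      simp at hx hx'
      obtain ⟨l, hl, rfl⟩ := hx
      have := hinj l (by omega) (j+1) hj hx'
      omega)
    convert this using 1
    have hI : Finset.Icc i (j+1) = insert (j+1) (Finset.Icc i j) := by
      ext l; simp only [Finset.mem_Icc, Finset.mem_insert]; omega
    rw [hI, Finset.image_insert, Finset.union_comm, Finset.insert_eq]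

end PO

section menger
variable {V : Type*} [DecidableEq V]

def TC (G : SimpleGraph V) : Prop :=
  ∀ b u w : V, u ≠ b → w ≠ b → ∃ S, PO G u w S ∧ b ∉ S

lemma xyPath {G : SimpleGraph V} (hG : TC G) (X Y : Finset V) (b x0 y0 : V) (hx : x0 ∈ X)
    (hxb : x0 ≠ b) (hy : y0 ∈ Y) (hyb : y0 ≠ b) :
    ∃ u w R, PO G u w R ∧ b ∉ R ∧ u ∈ X ∧ w ∈ Y ∧ (∀ x ∈ R, x ∈ X → x = u) ∧
      (∀ x ∈ R, x ∈ Y → x = w) := by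
  obtain ⟨S, hS, hb⟩ := hG b x0 y0 hxb hyb
  obtain ⟨z, T, h1, h2, h3, h4, -⟩ := hS.lastHit ⟨x0, hS.left_mem, hx⟩
  obtain ⟨z', T', h1', h2', h3', h4', -⟩ := h2.reverse.lastHit ⟨y0, h2.right_mem, hy⟩
  exact ⟨z, z', T', h2'.reverse, by grind, h1, h1', by grind, h4'⟩

set_option maxHeartbeats 2000000 in
lemma menger2 [Fintype V] {G : SimpleGraph V} (hG : TC G) (X : Finset V) (w0 x0 x1 : V)
    (hw0 : w0 ∈ X) (hx0 : x0 ∈ X) (hx1 : x1 ∈ X) (hx01 : x0 ≠ x1) (N : ℕ) :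
    ∀ (Y W : Finset V) (b y0 : V), Yᶜ.card ≤ N → PO G w0 b W → b ∈ Y → y0 ∈ Y → y0 ≠ b →
      (∀ x ∈ W, x ∈ X → x = w0) → (∀ x ∈ W, x ∈ Y → x = b) →
      ∃ s1 s2 e S1 S2, PO G s1 b S1 ∧ PO G s2 e S2 ∧ s1 ∈ X ∧ s2 ∈ X ∧ e ∈ Y ∧ e ≠ b ∧
        (∀ x ∈ S1, x ∉ S2) ∧ (∀ x ∈ S1, x ∈ X → x = s1) ∧ (∀ x ∈ S2, x ∈ X → x = s2) ∧
        (∀ x ∈ S1, x ∈ Y → x = b) ∧ (∀ x ∈ S2, x ∈ Y → x = e) ∧ (w0 = s1 ∨ w0 = s2) := by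
  induction N with
  | zero =>
    intro Y W b y0 hc hW hb hy0 hyb hWX hWY
    have hY : Y = Finset.univ := by simpa using hc
    subst hY
    have h0 := hWY w0 hW.left_mem (by simp)
    subst h0
    obtain ⟨t, ht, htX⟩ : ∃ t ∈ X, t ≠ w0 := by
      by_cases h : x0 = w0
      · exact ⟨x1, hx1, by grind⟩
      · exact ⟨x0, hx0, h⟩
    exact ⟨w0, t, t, {w0}, {t}, .single _, .single _, hw0, ht, by simp, htX, by grind, by grind,
      by grind, by grind, by grind, by simp⟩
  | succ N ih =>
    intro Y W b y0 hc hW hb hy0 hyb hWX hWY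
    obtain ⟨t, ht, htX⟩ : ∃ t ∈ X, t ≠ b := by
      by_cases h : x0 = b
      · exact ⟨x1, hx1, by grind⟩
      · exact ⟨x0, hx0, h⟩
    obtain ⟨u, c, R, hR, hbR, huX, hcY, hRX, hRY⟩ := xyPath hG X Y b t y0 ht htX hy0 hyb
    by_cases hRW : ∃ x ∈ R, x ∈ W
    swap
    · have := hR.right_mem
      exact ⟨w0, u, c, W, R, hW, hR, hw0, huX, hcY, by grind, by grind, hWX, hRX, hWY, hRY,
        by simp⟩
    obtain ⟨z, R2, hzW, hR2, hR2R, hR2W, hR2u⟩ := hR.lastHit hRW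
    obtain ⟨W1, W2, hW1, hW2, hW12, hWi⟩ := hW.split hzW
    have hzR2 := hR2.left_mem
    have hcR2 := hR2.right_mem
    have hzb : z ≠ b := by grind
    have hzY : z ∉ Y := by grind
    have hzW2 := hW2.left_mem
    have hbW2 := hW2.right_mem
    have hw0W1 := hW1.left_mem
    have hzW1 := hW1.right_mem
    obtain ⟨s1, s2, e, S1, S2, hS1, hS2, hs1, hs2, he, hez, hd, hX1, hX2, hY1, hY2, hw⟩ :=
      ih (Y ∪ W2 ∪ R2) W1 z b (by
        have : (Y ∪ W2 ∪ R2)ᶜ ⊂ Yᶜ := by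
          rw [Finset.compl_ssubset_compl]
          refine ⟨by grind, fun h => hzY (h (by grind))⟩
        have := Finset.card_lt_card this
        omega) hW1 (by grind) (by grind) hzb.symm (by grind) (by grind)
    have hzS1 := hS1.right_mem
    have heS2 := hS2.right_mem
    have hR2X : ∀ x ∈ R2, x ∈ X → x = z ∧ x = s1 := by grind
    have hW2X : ∀ x ∈ W2, x ∈ X → x = z ∧ x = s1 := by grind
    have hS1Y : ∀ x ∈ S1, x ∉ Y := by grind
    by_cases heW : e ∈ W2
    · obtain ⟨W3, W4, hW3, hW4, hW34, hWi'⟩ := hW2.split heW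
      have hzW4 : z ∉ W4 := fun h => hez (hWi' z hW3.left_mem h).symm
      refine ⟨s2, s1, c, S2 ∪ W4, S1 ∪ R2, hS2.join hW4 ?_, hS1.join hR2 ?_, hs2, hs1, hcY,
        ?_, ?_, ?_, ?_, ?_, ?_, hw.symm⟩
      · grind
      · grind
      · grind
      · grind
      · grind
      · grind
      · grind
      · grind
    by_cases heR : e ∈ R2
    · obtain ⟨R3, R4, hR3, hR4, hR34, hRi'⟩ := hR2.split heR
      have hzR4 : z ∉ R4 := fun h => hez (hRi' z hR3.left_mem h).symm
      refine ⟨s1, s2, c, S1 ∪ W2, S2 ∪ R4, hS1.join hW2 ?_, hS2.join hR4 ?_, hs1, hs2, hcY,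
        ?_, ?_, ?_, ?_, ?_, ?_, hw⟩
      · grind
      · grind
      · grind
      · grind
      · grind
      · grind
      · grind
      · grind
    · refine ⟨s1, s2, e, S1 ∪ W2, S2, hS1.join hW2 ?_, hS2, hs1, hs2, ?_,
        ?_, ?_, ?_, ?_, ?_, ?_, hw⟩
      · grind
      · grind
      · grind
      · grind
      · grind
      · grind
      · grind
      · grind

end menger

section posa
variable {V : Type*} [DecidableEq V]

def Cyc (G : SimpleGraph V) (k : ℕ) : Prop :=
  ∃ u w S, G.Adj w u ∧ PO G u w S ∧ k ≤ S.card

lemma two_paths {G : SimpleGraph V} {s e : V} {S T : Finset V} (hS : PO G s e S)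
    (hT : PO G s e T) (hse : s ≠ e) (h : ∀ x ∈ S, x ∈ T → x = s ∨ x = e) :
    ∃ u w, G.Adj w u ∧ PO G u w (S ∪ T) := by
  cases hT with
  | single => exact absurd rfl hse
  | @cons _ v _ T' hab hT' ha =>
    refine ⟨v, s, hab, ?_⟩
    have := hT'.join hS.reverse (by grind)
    have h2 : S ∪ insert s T' = T' ∪ S := by
      have := hS.left_mem
      grind
    rw [h2]; exact this

lemma kernel {G : SimpleGraph V} (f : ℕ → V) (p : ℕ) (hadj : ∀ i < p, G.Adj (f i) (f (i+1)))
    (hinj : ∀ i ≤ p, ∀ j ≤ p, f i = f j → i = j) (hp : G.Adj (f 0) (f p)) (i : ℕ) (hi : i < p) :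
    ∃ K, PO G (f p) (f i) K ∧ K ⊆ (Finset.Icc 0 p).image f ∧
      (∀ l ≤ p, G.Adj (f 0) (f l) → f l ∈ K) ∧ f 0 ∈ K := by
  classical
  have hex : ∃ c, i < c ∧ c ≤ p ∧ G.Adj (f 0) (f c) := ⟨p, hi, le_rfl, hp⟩
  obtain ⟨hc1, hc2, hc3⟩ := Nat.find_spec hex
  have hmin := fun l => @Nat.find_min _ _ hex l
  generalize Nat.find hex = c at hc1 hc2 hc3 hmin
  have h1 := (PO.seg f p hadj hinj c p hc2 le_rfl).reverse
  have h2 := PO.seg f p hadj hinj 0 i (by omega) hi.le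
  refine ⟨_, h1.joinE hc3.symm h2 ?_, ?_, ?_, ?_⟩
  · intro x hx hx'
    simp only [Finset.mem_image, Finset.mem_Icc] at hx hx'
    obtain ⟨a, ha, rfl⟩ := hx
    obtain ⟨b, hb, hab⟩ := hx'
    have := hinj b (by omega) a (by omega) hab
    omega
  · rw [← Finset.image_union]
    apply Finset.image_subset_image
    intro l; simp only [Finset.mem_union, Finset.mem_Icc]; omega
  · intro l hl hal
    rw [← Finset.image_union]
    apply Finset.mem_image_of_mem
    simp only [Finset.mem_union, Finset.mem_Icc]
    by_contra hcon
    exact hmin l (by omega) ⟨by omega, hl, hal⟩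
  · rw [← Finset.image_union]
    apply Finset.mem_image_of_mem
    simp

lemma posa_cross {G : SimpleGraph V} [DecidableRel G.Adj] (f : ℕ → V) (m k : ℕ)
    (hadj : ∀ i < m, G.Adj (f i) (f (i+1)))
    (hinj : ∀ i ≤ m, ∀ j ≤ m, f i = f j → i = j)
    (hkm : k ≤ m + 1)
    (hk : k ≤ ((Finset.range (m+1)).filter (fun i => G.Adj (f 0) (f i))).card +
      ((Finset.range (m+1)).filter (fun i => G.Adj (f m) (f i))).card)
    (hcross : ∃ i j, i < j ∧ j ≤ m ∧ G.Adj (f 0) (f j) ∧ G.Adj (f m) (f i)) : Cyc G k := by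
  classical
  have hex : ∃ d i, i + d + 1 ≤ m ∧ G.Adj (f 0) (f (i + d + 1)) ∧ G.Adj (f m) (f i) := by
    obtain ⟨i, j, h1, h2, h3, h4⟩ := hcross
    refine ⟨j - i - 1, i, ?_, ?_, h4⟩
    · omega
    · rwa [show i + (j - i - 1) + 1 = j by omega]
  obtain ⟨i, hm, h0, hi⟩ := Nat.find_spec hex
  have hmin := fun l => @Nat.find_min _ _ hex l
  generalize Nat.find hex = d at hm h0 hi hmin
  have h1 := PO.seg f m hadj hinj 0 i (by omega) (by omega)
  have h2 := (PO.seg f m hadj hinj (i+d+1) m (by omega) le_rfl).reverse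
  have h3 := h1.joinE hi.symm h2 (by
    intro x hx hx'
    simp only [Finset.mem_image, Finset.mem_Icc] at hx hx'
    obtain ⟨a, ha, rfl⟩ := hx
    obtain ⟨b, hb, hab⟩ := hx'
    have := hinj b (by omega) a (by omega) hab
    omega)
  refine ⟨_, _, _, h0.symm, h3, ?_⟩
  rw [← Finset.image_union, Finset.card_image_of_injOn (by
    intro a ha b hb hab
    simp at ha hb
    exact hinj a (by omega) b (by omega) hab), Finset.card_union_of_disjoint (by
      rw [Finset.disjoint_left]; intro a; simp only [Finset.mem_Icc]; omega)]
  simp only [Nat.card_Icc]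
  rcases Nat.eq_zero_or_pos d with hd | hd
  · omega
  -- index sets
  set A := (Finset.range (m+1)).filter (fun i => G.Adj (f 0) (f i)) with hA
  set B := (Finset.range (m+1)).filter (fun i => G.Adj (f m) (f i)) with hB
  have hno : ∀ a ∈ A, ∀ b ∈ B, b < a → d ≤ a - b - 1 := by
    intro a ha b hb hba
    by_contra hlt
    simp [hA, hB] at ha hb
    refine hmin (a - b - 1) (by omega) ⟨b, by omega, ?_, hb.2⟩
    rw [show b + (a - b - 1) + 1 = a by omega]; exact ha.2
  have hiB : i ∈ B := by simp [hB, hi]; omega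
  have hjA : i + d + 1 ∈ A := by simp [hA, h0]; omega
  have h0A : 0 ∉ A := by simp [hA]
  have hmB : m ∉ B := by simp [hB]
  have hAm : ∀ a ∈ A, a ≤ m := by intro a ha; simp [hA] at ha; omega
  have hBm : ∀ a ∈ B, a ≤ m := by intro a ha; simp [hB] at ha; omega
  -- shift B by one
  have hsub : insert 0 (A ∪ (B.erase i).image (· + 1)) ⊆
      Finset.Icc 0 i ∪ Finset.Icc (i+d+1) m := by
    intro l hl
    simp only [Finset.mem_insert, Finset.mem_union, Finset.mem_image, Finset.mem_erase] at hl
    simp only [Finset.mem_union, Finset.mem_Icc]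
    rcases hl with rfl | hl | ⟨b, ⟨hbi, hb⟩, rfl⟩
    · omega
    · have := hno l hl i hiB
      have := hAm l hl
      omega
    · have h1 := hno _ hjA b hb
      have := hBm b hb
      have : b ≠ m := by rintro rfl; exact hmB hb
      omega
  have hcard := Finset.card_le_card hsub
  rw [Finset.card_insert_of_notMem (by simp [h0A]), Finset.card_union_of_disjoint (by
      rw [Finset.disjoint_left]
      intro a ha ha'
      simp only [Finset.mem_image, Finset.mem_erase] at ha'
      obtain ⟨b, ⟨_, hb⟩, rfl⟩ := ha'
      have := hno _ ha b hb (by omega)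
      omega), Finset.card_image_of_injective _ (add_left_injective 1),
      Finset.card_erase_of_mem hiB, Finset.card_union_of_disjoint (by
      rw [Finset.disjoint_left]; intro a; simp only [Finset.mem_Icc]; omega)] at hcard
  simp only [Nat.card_Icc] at hcard
  have : 0 < B.card := Finset.card_pos.2 ⟨i, hiB⟩
  omega

lemma posa [Fintype V] {G : SimpleGraph V} [DecidableRel G.Adj] (hG : TC G)
    (f : ℕ → V) (m k : ℕ)
    (hadj : ∀ i < m, G.Adj (f i) (f (i+1)))
    (hinj : ∀ i ≤ m, ∀ j ≤ m, f i = f j → i = j)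
    (hkm : k ≤ m + 1)
    (hk : k ≤ ((Finset.range (m+1)).filter (fun i => G.Adj (f 0) (f i))).card +
      ((Finset.range (m+1)).filter (fun i => G.Adj (f m) (f i))).card)
    (hA0 : ((Finset.range (m+1)).filter (fun i => G.Adj (f 0) (f i))).Nonempty)
    (hB0 : ((Finset.range (m+1)).filter (fun i => G.Adj (f m) (f i))).Nonempty) : Cyc G k := by
  classical
  by_cases hcross : ∃ i j, i < j ∧ j ≤ m ∧ G.Adj (f 0) (f j) ∧ G.Adj (f m) (f i)
  · exact posa_cross f m k hadj hinj hkm hk hcross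
  by_cases hxy : G.Adj (f 0) (f m)
  · refine ⟨_, _, _, hxy.symm, PO.seg f m hadj hinj 0 m (by omega) le_rfl, ?_⟩
    rw [Finset.card_image_of_injOn (by
      intro a ha b hb hab
      simp at ha hb
      exact hinj a (by omega) b (by omega) hab)]
    simpa using hkm
  set A := (Finset.range (m+1)).filter (fun i => G.Adj (f 0) (f i)) with hA
  set B := (Finset.range (m+1)).filter (fun i => G.Adj (f m) (f i)) with hB
  have hmA : ∀ a, a ∈ A ↔ a ≤ m ∧ G.Adj (f 0) (f a) := by intro a; simp [hA, Nat.lt_succ_iff]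
  have hmB : ∀ a, a ∈ B ↔ a ≤ m ∧ G.Adj (f m) (f a) := by intro a; simp [hB, Nat.lt_succ_iff]
  obtain ⟨p, hpA, hpmax⟩ : ∃ p ∈ A, ∀ a ∈ A, a ≤ p :=
    ⟨A.max' hA0, A.max'_mem _, fun a ha => A.le_max' a ha⟩
  obtain ⟨q, hqB, hqmin⟩ : ∃ q ∈ B, ∀ a ∈ B, q ≤ a :=
    ⟨B.min' hB0, B.min'_mem _, fun a ha => B.min'_le a ha⟩
  have hpA' := (hmA p).1 hpA
  have hqB' := (hmB q).1 hqB
  have hpq : p ≤ q := by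
    by_contra h
    exact hcross ⟨q, p, by omega, hpA'.1, hpA'.2, hqB'.2⟩
  have hp0 : 0 < p := by
    rcases Nat.eq_zero_or_pos p with h | h
    · subst h; exact absurd hpA'.2 (G.loopless.irrefl _)
    · exact h
  have hqm : q < m := by
    rcases lt_or_eq_of_le hqB'.1 with h | h
    · exact h
    · subst h; exact absurd hqB'.2 (G.loopless.irrefl _)
  set X := (Finset.Icc 0 p).image f with hX
  set Y := (Finset.Icc q m).image f with hY
  set W := (Finset.Icc p q).image f with hW
  have hmX : ∀ a ≤ m, f a ∈ X ↔ a ≤ p := by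
    intro a ha
    simp only [hX, Finset.mem_image, Finset.mem_Icc]
    constructor
    · rintro ⟨b, hb, hab⟩
      have := hinj b (by omega) a ha hab
      omega
    · intro h; exact ⟨a, by omega, rfl⟩
  have hmY : ∀ a ≤ m, f a ∈ Y ↔ q ≤ a := by
    intro a ha
    simp only [hY, Finset.mem_image, Finset.mem_Icc]
    constructor
    · rintro ⟨b, hb, hab⟩
      have := hinj b (by omega) a ha hab
      omega
    · intro h; exact ⟨a, by omega, rfl⟩
  obtain ⟨s1, s2, e, S1, S2, hS1, hS2, hs1, hs2, he, hez, hd, hX1, hX2, hY1, hY2, hw⟩ :=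
    menger2 hG X (f p) (f 0) (f p) ((hmX p hpA'.1).2 le_rfl) ((hmX 0 (by omega)).2 (by omega))
      ((hmX p hpA'.1).2 le_rfl) (fun h => by have := hinj _ (by omega) _ hpA'.1 h; omega)
      (Yᶜ.card) Y W (f q) (f m) le_rfl
      (PO.seg f m hadj hinj p q hpq hqB'.1) ((hmY q hqB'.1).2 le_rfl) ((hmY m le_rfl).2 hqB'.1)
      (fun h => by have := hinj _ le_rfl _ hqB'.1 h; omega)
      (by
        intro x hx hx'
        simp only [hW, Finset.mem_image, Finset.mem_Icc] at hx
        obtain ⟨a, ha, rfl⟩ := hx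
        have := (hmX a (by omega)).1 hx'
        rw [show a = p by omega])
      (by
        intro x hx hx'
        simp only [hW, Finset.mem_image, Finset.mem_Icc] at hx
        obtain ⟨a, ha, rfl⟩ := hx
        have := (hmY a (by omega)).1 hx'
        rw [show a = q by omega])
  have hs12 : s1 ≠ s2 := by
    rintro rfl
    exact hd _ hS1.left_mem hS2.left_mem
  -- the kernel at X
  have hker : ∀ a ∈ X, a ≠ f p → ∃ K, PO G (f p) a K ∧ K ⊆ X ∧
      (∀ l ≤ p, G.Adj (f 0) (f l) → f l ∈ K) ∧ f 0 ∈ K := by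
    intro a ha hap
    simp only [hX, Finset.mem_image, Finset.mem_Icc] at ha
    obtain ⟨i, hi, rfl⟩ := ha
    have hip : i ≠ p := by rintro rfl; exact hap rfl
    exact kernel f p (fun i hi => hadj i (by omega))
      (fun i hi j hj => hinj i (by omega) j (by omega)) hpA'.2 i (by omega)
  obtain ⟨K, hK, hKX, hKA, hK0⟩ : ∃ K, PO G s1 s2 K ∧ K ⊆ X ∧
      (∀ l ≤ p, G.Adj (f 0) (f l) → f l ∈ K) ∧ f 0 ∈ K := by
    rcases hw with h | h
    · obtain ⟨K, h1, h2⟩ := hker s2 hs2 (by rw [h]; exact hs12.symm)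
      exact ⟨K, h ▸ h1, h2⟩
    · obtain ⟨K, h1, h2⟩ := hker s1 hs1 (by rw [h]; exact hs12)
      exact ⟨K, h ▸ h1.reverse, h2⟩
  -- the kernel at Y
  obtain ⟨L, hL, hLY, hLB, hL0⟩ : ∃ L, PO G (f q) e L ∧ L ⊆ Y ∧
      (∀ l ≤ m, q ≤ l → G.Adj (f m) (f l) → f l ∈ L) ∧ f m ∈ L := by
    simp only [hY, Finset.mem_image, Finset.mem_Icc] at he
    obtain ⟨i, hi, rfl⟩ := he
    have hip : i ≠ q := by rintro rfl; exact hez rfl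
    obtain ⟨L, h1, h2, h3, h4⟩ := kernel (G := G) (fun i => f (m - i)) (m - q)
      (fun i hi => by
        have := hadj (m - (i+1)) (by omega)
        rw [show m - (i+1) + 1 = m - i by omega] at this
        exact this.symm)
      (fun i hi j hj h => by
        have := hinj (m-i) (by omega) (m-j) (by omega) h
        omega) (by
        rw [show m - 0 = m by omega, show m - (m - q) = q by omega]; exact hqB'.2)
      (m - i) (by omega)
    simp only [show m - 0 = m by omega, show m - (m - q) = q by omega,
      show m - (m - i) = i by omega] at h1 h2 h3 h4
    refine ⟨L, h1, ?_, ?_, h4⟩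
    · intro x hx
      have := h2 hx
      simp only [Finset.mem_image, Finset.mem_Icc] at this
      obtain ⟨a, ha, rfl⟩ := this
      exact (hmY _ (by omega)).2 (by omega)
    · intro l hl hql hal
      have := h3 (m - l) (by omega) (by rwa [show m - (m - l) = l by omega])
      rwa [show m - (m - l) = l by omega] at this
  have hP1 := hK.join hS2 (fun x hx hx' => hX2 x hx' (hKX hx))
  have hP2 := hS1.join hL (fun x hx hx' => hY1 x hx (hLY hx'))
  have hs2S := hS2.left_mem
  have heS := hS2.right_mem
  have hs1S := hS1.left_mem
  have hqS := hS1.right_mem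
  have hXY : ∀ x, x ∈ X → x ∈ Y → x = f q := by
    intro x hx hx'
    simp only [hX, Finset.mem_image, Finset.mem_Icc] at hx
    obtain ⟨a, ha, rfl⟩ := hx
    have := (hmY a (by omega)).1 hx'
    rw [show a = q by omega]
  obtain ⟨u, w, hwu, hC⟩ := two_paths hP1 hP2 (by grind) (by
    intro x hx hx'
    simp only [Finset.mem_union] at hx hx'
    rcases hx with hx | hx <;> rcases hx' with hx' | hx'
    · left; exact hX1 x hx' (hKX hx)
    · have := hXY x (hKX hx) (hLY hx')
      left; exact hX1 x (this ▸ hqS) (hKX hx)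
    · exact absurd hx (hd x hx')
    · right; exact hY2 x hx (hLY hx'))
  refine ⟨u, w, _, hwu, hC, ?_⟩
  have hsub : (insert 0 (insert m (A ∪ B))).image f ⊆ K ∪ S2 ∪ (S1 ∪ L) := by
    intro x hx
    simp only [Finset.mem_image, Finset.mem_insert, Finset.mem_union] at hx
    obtain ⟨a, (rfl | rfl | ha | ha), rfl⟩ := hx
    · simp [hK0]
    · simp [hL0]
    · have := hKA a (hpmax a ha) ((hmA a).1 ha).2
      simp [this]
    · have := hLB a ((hmB a).1 ha).1 (hqmin a ha) ((hmB a).1 ha).2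
      simp [this]
  have hcard := Finset.card_le_card hsub
  have h0A : 0 ∉ A := by simp [hmA]
  have h0B : 0 ∉ B := by
    intro h; exact hxy ((hmB 0).1 h).2.symm
  have hmA' : m ∉ A := by
    intro h; exact hxy ((hmA m).1 h).2
  have hmB' : m ∉ B := by simp [hmB]
  rw [Finset.card_image_of_injOn (by
    intro a ha b hb hab
    simp only [Finset.coe_insert, Finset.coe_union, Set.mem_insert_iff, Set.mem_union,
      Finset.mem_coe] at ha hb
    have h1 := fun a => (hmA a).1
    have h2 := fun a => (hmB a).1
    exact hinj a (by grind) b (by grind) hab), Finset.card_insert_of_notMem (by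
      simp [h0A, h0B]; omega), Finset.card_insert_of_notMem (by simp [hmA', hmB'])] at hcard
  have hint : (A ∩ B).card ≤ 1 := by
    rw [Finset.card_le_one]
    intro a ha b hb
    simp only [Finset.mem_inter] at ha hb
    have := hpmax a ha.1
    have := hqmin a ha.2
    have := hpmax b hb.1
    have := hqmin b hb.2
    omega
  have := Finset.card_union_add_card_inter A B
  omega

end posa

section kop
variable {V : Type*} [DecidableEq V] [Fintype V]

lemma longPath {G : SimpleGraph V} [DecidableRel G.Adj] (hG : TC G) (A B : Finset V)
    (α β k : ℕ) (hα : 1 ≤ α) (hβ : 1 ≤ β) (hk : k ≤ α + β)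
    (hA : ∀ a ∈ A, α ≤ (A.filter (G.Adj a)).card) (hB : ∀ a ∈ B, β ≤ (B.filter (G.Adj a)).card)
    (hex : ∃ x ∈ A, ∃ y ∈ B, ∃ S, PO G x y S ∧ k ≤ S.card) : Cyc G k := by
  classical
  obtain ⟨x0, hx0, y0, hy0, S0, hS0, hk0⟩ := hex
  obtain ⟨S, hS, hmax⟩ := Finset.exists_max_image
    (Finset.univ.filter (fun S : Finset V => ∃ x ∈ A, ∃ y ∈ B, PO G x y S)) Finset.card
    ⟨S0, by simp; exact ⟨x0, hx0, y0, hy0, hS0⟩⟩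
  have hkS : k ≤ S.card := hk0.trans (hmax S0 (by simp; exact ⟨x0, hx0, y0, hy0, hS0⟩))
  simp only [Finset.mem_filter, Finset.mem_univ, true_and] at hS hmax
  obtain ⟨x, hx, y, hy, hP⟩ := hS
  have hxN : ∀ z ∈ A, G.Adj x z → z ∈ S := by
    intro z hz hxz
    by_contra hzS
    have := hmax _ ⟨z, hz, y, hy, .cons hxz.symm hP hzS⟩
    rw [Finset.card_insert_of_notMem hzS] at this
    omega
  have hyN : ∀ z ∈ B, G.Adj y z → z ∈ S := by
    intro z hz hxz
    by_contra hzS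
    have := hmax _ ⟨x, hx, z, hz, (PO.cons hxz.symm hP.reverse hzS).reverse⟩
    rw [Finset.card_insert_of_notMem hzS] at this
    omega
  obtain ⟨f, m, h0, hm, hadj, hinj, hSf⟩ := hP.toFun
  subst h0 hm
  have hSc : S.card ≤ m + 1 := by
    rw [hSf]; exact Finset.card_image_le.trans (by simp)
  have key : ∀ (C : Finset V) (v : V), (∀ z ∈ C, G.Adj v z → z ∈ S) →
      (C.filter (G.Adj v)).card ≤ ((Finset.range (m+1)).filter (fun i => G.Adj v (f i))).card := by
    intro C v hv
    refine (Finset.card_le_card (t := ((Finset.range (m+1)).filter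
      (fun i => G.Adj v (f i))).image f) ?_).trans Finset.card_image_le
    intro z hz
    simp only [Finset.mem_filter] at hz
    have := hv z hz.1 hz.2
    rw [hSf] at this
    simp only [Finset.mem_image] at this ⊢
    obtain ⟨i, hi, rfl⟩ := this
    exact ⟨i, by simp only [Finset.mem_filter]; exact ⟨hi, hz.2⟩, rfl⟩
  have h1 := (hA _ hx).trans (key A _ hxN)
  have h2 := (hB _ hy).trans (key B _ hyN)
  exact posa hG f m k hadj hinj (by omega) (by omega) (Finset.card_pos.1 (by omega))
    (Finset.card_pos.1 (by omega))

def IsCore (G : SimpleGraph V) [DecidableRel G.Adj] (a : ℕ) (H : Finset V) : Prop :=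
  (∀ v ∈ H, a < (H.filter (G.Adj v)).card) ∧
    ∀ T : Finset V, (∀ v ∈ T, a < (T.filter (G.Adj v)).card) → T ⊆ H

lemma exists_core (G : SimpleGraph V) [DecidableRel G.Adj] (a : ℕ) : ∃ H, IsCore G a H := by
  classical
  refine ⟨(Finset.univ.filter (fun T : Finset V =>
    ∀ v ∈ T, a < (T.filter (G.Adj v)).card)).biUnion id, ?_, ?_⟩
  · intro v hv
    simp only [Finset.mem_biUnion, Finset.mem_filter, Finset.mem_univ, true_and, id] at hv
    obtain ⟨T, hT, hvT⟩ := hv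
    refine (hT v hvT).trans_le (Finset.card_le_card (Finset.filter_subset_filter _ ?_))
    intro x hx
    simp only [Finset.mem_biUnion, Finset.mem_filter, Finset.mem_univ, true_and, id]
    exact ⟨T, hT, hx⟩
  · intro T hT x hx
    simp only [Finset.mem_biUnion, Finset.mem_filter, Finset.mem_univ, true_and, id]
    exact ⟨T, hT, hx⟩

lemma clique_PO {G : SimpleGraph V} (H : Finset V) (hH : ∀ x ∈ H, ∀ y ∈ H, x ≠ y → G.Adj x y)
    (hne : H.Nonempty) : ∃ u w, PO G u w H := by
  induction hne using Finset.Nonempty.cons_induction with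
  | singleton a => exact ⟨a, a, .single a⟩
  | cons a s ha hs ih =>
    obtain ⟨u, w, h⟩ := ih (fun x hx y hy => hH x (by simp [hx]) y (by simp [hy]))
    rw [Finset.cons_eq_insert]
    refine ⟨a, w, .cons (hH a (by simp) u (by simp [h.left_mem]) ?_) h ha⟩
    rintro rfl; exact ha h.left_mem

lemma PO.eq_of_eq {G : SimpleGraph V} {u : V} {S : Finset V} (h : PO G u u S) : S = {u} := by
  cases h with
  | single => rfl
  | cons _ h' hu => exact absurd h'.right_mem hu

lemma structure_lem {G : SimpleGraph V} [DecidableRel G.Adj] (hG : TC G) (k : ℕ) (hk : 5 ≤ k)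
    (hsat : ∀ x y, x ≠ y → ¬ G.Adj x y → ∃ S, PO G x y S ∧ k ≤ S.card) (hno : ¬ Cyc G k)
    (H : Finset V) (hH : IsCore G ((k-1)/2) H) (hne : H.Nonempty) :
    (k-1)/2 + 2 ≤ H.card ∧ H.card < k ∧ IsCore G (k - H.card) H := by
  have hcl : ∀ x ∈ H, ∀ y ∈ H, x ≠ y → G.Adj x y := by
    intro x hx y hy hxy
    by_contra h
    obtain ⟨S, hS⟩ := hsat x y hxy h
    exact hno (longPath hG H H ((k-1)/2+1) ((k-1)/2+1) k (by omega) (by omega) (by omega)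
      hH.1 hH.1 ⟨x, hx, y, hy, S, hS⟩)
  have hdeg : ∀ v ∈ H, (H.filter (G.Adj v)).card = H.card - 1 := by
    intro v hv
    rw [← Finset.card_erase_of_mem hv]
    congr 1
    ext x
    simp only [Finset.mem_filter, Finset.mem_erase]
    constructor
    · rintro ⟨h1, h2⟩; exact ⟨h2.ne', h1⟩
    · rintro ⟨h1, h2⟩; exact ⟨h2, hcl v hv x h2 (Ne.symm h1)⟩
  have hq1 : (k-1)/2 + 2 ≤ H.card := by
    obtain ⟨v, hv⟩ := hne
    have := hH.1 v hv
    rw [hdeg v hv] at this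
    omega
  have hq2 : H.card < k := by
    by_contra h
    obtain ⟨u, w, hP⟩ := clique_PO H hcl hne
    refine hno ⟨u, w, H, hcl _ hP.right_mem _ hP.left_mem ?_, hP, by omega⟩
    rintro rfl
    have := hP.eq_of_eq
    rw [this] at hq1
    simp at hq1
  refine ⟨hq1, hq2, ?_⟩
  obtain ⟨H', hH'⟩ := exists_core G (k - H.card)
  have hsub : H ⊆ H' := hH'.2 H (fun v hv => by have := hH.1 v hv; omega)
  have heq : H' = H := by
    by_contra hne'
    obtain ⟨x, hx', hx⟩ : ∃ x ∈ H', x ∉ H := by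
      by_contra hcon
      push Not at hcon
      exact hne' (Finset.Subset.antisymm hcon hsub)
    obtain ⟨y, hy, hxy⟩ : ∃ y ∈ H, ¬ G.Adj x y := by
      by_contra hcon
      push Not at hcon
      refine hx (hH.2 (insert x H) ?_ (by simp))
      intro v hv
      rcases Finset.mem_insert.1 hv with rfl | hv
      · have : H ⊆ (insert v H).filter (G.Adj v) := by
          intro z hz; simp [hz, hcon z hz]
        have := Finset.card_le_card this
        omega
      · exact (hH.1 v hv).trans_le
          (Finset.card_le_card (Finset.filter_subset_filter _ (by simp)))
    obtain ⟨S, hS⟩ := hsat x y (by rintro rfl; exact hx hy) hxy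
    exact hno (longPath hG H' H (k - H.card + 1) (H.card - 1) k (by omega) (by omega) (by omega)
      hH'.1 (fun v hv => (hdeg v hv).ge) ⟨x, hx', y, hy, S, hS⟩)
  exact heq ▸ hH'

end kop
section conv
variable {V : Type*} [DecidableEq V] {G : SimpleGraph V}

lemma PO.toWalk {u w : V} {S : Finset V} (h : PO G u w S) :
    ∃ p : G.Walk u w, p.IsPath ∧ p.length + 1 = S.card ∧ ∀ x, x ∈ p.support ↔ x ∈ S := by
  induction h with
  | single u => exact ⟨.nil, by simp, by simp, by simp⟩
  | @cons a b c S hab h ha ih =>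
    obtain ⟨p, h1, h2, h3⟩ := ih
    refine ⟨.cons hab p, ?_, ?_, ?_⟩
    · rw [SimpleGraph.Walk.cons_isPath_iff]
      exact ⟨h1, by rwa [h3]⟩
    · rw [Finset.card_insert_of_notMem ha]; simp [h2]
    · intro x; simp [h3]

lemma PO.ofWalk {u w : V} (p : G.Walk u w) (hp : p.IsPath) :
    ∃ S, PO G u w S ∧ p.length + 1 = S.card ∧ ∀ x, x ∈ p.support ↔ x ∈ S := by
  induction p with
  | nil => exact ⟨_, .single _, by simp, by simp⟩
  | @cons a b c h p ih =>
    rw [SimpleGraph.Walk.cons_isPath_iff] at hp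
    obtain ⟨S, h1, h2, h3⟩ := ih hp.1
    have ha : a ∉ S := by rw [← h3]; exact hp.2
    refine ⟨_, .cons h h1 ha, ?_, ?_⟩
    · rw [Finset.card_insert_of_notMem ha]; simp [h2]
    · intro x; simp [h3]

lemma Cyc.toCycle {k : ℕ} (hk : 3 ≤ k) (h : Cyc G k) :
    ∃ (v : V) (c : G.Walk v v), c.IsCycle ∧ k ≤ c.length := by
  obtain ⟨u, w, S, hwu, hP, hkS⟩ := h
  obtain ⟨p, hp, hl, -⟩ := hP.toWalk
  refine ⟨w, .cons hwu p, ?_, by simp; omega⟩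
  rw [SimpleGraph.Walk.cons_isCycle_iff]
  refine ⟨hp, ?_⟩
  intro he
  cases p with
  | nil => simp at he
  | @cons _ b _ h p =>
    rw [SimpleGraph.Walk.cons_isPath_iff] at hp
    simp only [SimpleGraph.Walk.edges_cons, List.mem_cons] at he
    rcases he with he | he
    · have : b = w := by
        rw [Sym2.eq_iff] at he
        rcases he with ⟨h1, h2⟩ | ⟨h1, h2⟩
        · exact absurd h1 hwu.ne
        · exact h1.symm
      subst this
      have := SimpleGraph.Walk.length_eq_zero_iff.2 (SimpleGraph.Walk.isPath_iff_nil.1 hp.1)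
      simp [this] at hl
      omega
    · exact hp.2 (SimpleGraph.Walk.snd_mem_support_of_mem_edges _ he)

/-- a cycle through the edge `xy` can be made to start with `x → y` -/
lemma cycle_first {x y z : V} (c : G.Walk z z) (hc : c.IsCycle) (he : s(x, y) ∈ c.edges) :
    ∃ (h : G.Adj x y) (p : G.Walk y x), (SimpleGraph.Walk.cons h p).IsCycle ∧
      p.length + 1 = c.length := by
  have hx : x ∈ c.support := SimpleGraph.Walk.fst_mem_support_of_mem_edges _ he
  have hcr := hc.rotate hx
  have hlen : (c.rotate x hx).length = c.length := by simp
  have her : s(x, y) ∈ (c.rotate x hx).edges := (c.rotate_edges x hx).mem_iff.2 he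
  rw [← hlen]
  generalize c.rotate x hx = d at hcr her
  clear he hc hlen hx
  cases d with
  | nil => simp at her
  | @cons _ b _ h p =>
    simp only [SimpleGraph.Walk.edges_cons, List.mem_cons] at her
    rcases her with her | her
    · have : b = y := by
        rw [Sym2.eq_iff] at her
        rcases her with ⟨h1, h2⟩ | ⟨h1, h2⟩
        · exact h2.symm
        · exact absurd h1 h.ne
      subst this
      exact ⟨h, p, hcr, by simp⟩
    · have hrev := hcr.reverse
      have hp := ((SimpleGraph.Walk.cons_isCycle_iff _ _).1 hcr).1.reverse
      have her' : s(x, y) ∈ p.reverse.edges := by simpa using her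
      have hl : p.reverse.length = p.length := by simp
      rw [SimpleGraph.Walk.reverse_cons] at hrev
      simp only [SimpleGraph.Walk.length_cons]
      rw [← hl]
      generalize p.reverse = q at hrev hp her'
      cases q with
      | nil => simp at her'
      | @cons _ b' _ h' q =>
        rw [SimpleGraph.Walk.cons_isPath_iff] at hp
        simp only [SimpleGraph.Walk.edges_cons, List.mem_cons] at her'
        rcases her' with her' | her'
        · have : b' = y := by
            rw [Sym2.eq_iff] at her'
            rcases her' with ⟨h1, h2⟩ | ⟨h1, h2⟩
            · exact h2.symm
            · exact absurd h1 h'.ne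
          subst this
          rw [SimpleGraph.Walk.cons_append] at hrev
          exact ⟨h', _, hrev, by simp⟩
        · exact absurd (SimpleGraph.Walk.fst_mem_support_of_mem_edges _ her') hp.2

lemma sat_path {k : ℕ} (x y : V) (hxy : x ≠ y)
    (hno : ¬ ∃ (v : V) (c : G.Walk v v), c.IsCycle ∧ k ≤ c.length)
    (hyes : ∃ (v : V) (c : (G ⊔ SimpleGraph.edge x y).Walk v v), c.IsCycle ∧ k ≤ c.length) :
    ∃ S, PO G x y S ∧ k ≤ S.card := by
  have hedge : ∀ {u v : V} (p : (G ⊔ SimpleGraph.edge x y).Walk u v), s(x,y) ∉ p.edges →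
      ∀ e ∈ p.edges, e ∈ G.edgeSet := by
    intro u v p hp e he
    have := p.edges_subset_edgeSet he
    induction e with
    | h a b =>
      simp only [SimpleGraph.mem_edgeSet, SimpleGraph.sup_adj, SimpleGraph.edge_adj] at this
      rcases this with h | ⟨⟨rfl, rfl⟩ | ⟨rfl, rfl⟩, _⟩
      · exact h
      · exact absurd he hp
      · exact absurd (by rwa [Sym2.eq_swap]) hp
  obtain ⟨v, c, hc, hk⟩ := hyes
  by_cases he : s(x, y) ∈ c.edges
  · obtain ⟨h, p, hp, hl⟩ := cycle_first c hc he
    rw [SimpleGraph.Walk.cons_isCycle_iff] at hp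
    have := hp.1.transfer (hedge p hp.2)
    obtain ⟨S, h1, h2, -⟩ := PO.ofWalk _ this
    refine ⟨S, h1.reverse, ?_⟩
    rw [SimpleGraph.Walk.length_transfer] at h2
    omega
  · exact absurd ⟨v, c.transfer G (hedge c he), hc.transfer _, by
      rwa [SimpleGraph.Walk.length_transfer]⟩ hno

end conv

section conv
lemma convex_dec (f : ℕ → ℕ) (r h : ℕ)
    (hc : ∀ a, r ≤ a → a + 2 ≤ h → 2 * f (a+1) ≤ f a + f (a+2)) (b : ℕ) (hrb : r ≤ b) :
    b + 1 ≤ h → f (b+1) < f b → f b ≤ f r := by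
  induction b, hrb using Nat.le_induction with
  | base => intros; exact le_rfl
  | succ b hb ih =>
    intro h1 h2
    have := hc b hb h1
    rw [show b + 1 + 1 = b + 2 by omega] at h2
    have := ih (by omega) (by omega)
    omega

lemma convex_max (f : ℕ → ℕ) (r h : ℕ) (hrh : r ≤ h)
    (hc : ∀ a, r ≤ a → a + 2 ≤ h → 2 * f (a+1) ≤ f a + f (a+2)) :
    ∀ a, r ≤ a → a ≤ h → f a ≤ max (f r) (f h) := by
  induction h, hrh using Nat.le_induction with
  | base => intro a h1 h2; rw [show a = r by omega]; simp
  | succ h hrh ih =>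
    intro a h1 h2
    have ih' := ih (fun a h1 h2 => hc a h1 (by omega))
    have hd := convex_dec f r (h+1) hc h hrh le_rfl
    rcases Nat.lt_or_ge h a with h3 | h3
    · rw [show a = h + 1 by omega]; simp
    · have := ih' a h1 h3
      rcases Nat.lt_or_ge (f (h+1)) (f h) with h4 | h4
      · have := hd h4; omega
      · omega

lemma choose_convex (M j : ℕ) (hj : 1 ≤ j) :
    2 * (M+1).choose j ≤ M.choose j + (M+2).choose j := by
  obtain ⟨j, rfl⟩ : ∃ i, j = i + 1 := ⟨j-1, by omega⟩
  have h1 := Nat.choose_succ_succ M j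
  have h2 := Nat.choose_succ_succ (M+1) j
  have h3 : M.choose j ≤ (M+1).choose j := Nat.choose_le_choose j (by omega)
  simp only [Nat.succ_eq_add_one] at *
  rw [show M + 1 + 1 = M + 2 by omega] at h2
  omega

lemma caseA (a t N : ℕ) (h : t ^ 2 ≤ a + 3) (hN : a + 3 ≤ N + t) :
    a.choose (t+1) * N.choose t ≤ (a+2).choose (t+1) * (N-1).choose t := by
  rcases Nat.lt_or_ge a (t+1) with ha | ha
  · rw [Nat.choose_eq_zero_of_lt ha]; simp
  have hNt : t ≤ N := by nlinarith
  have e1 : (N-1).choose t * N = N.choose t * (N - t) := by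
    have := Nat.choose_mul_succ_eq (N-1) t
    rwa [show N - 1 + 1 = N by omega] at this
  have e2 : (a+1).choose (t+1) * (a+2) = (a+2).choose (t+1) * (a + 1 - t) := by
    have := Nat.choose_mul_succ_eq (a+1) (t+1)
    rwa [show a + 1 + 1 - (t+1) = a + 1 - t by omega] at this
  have e3 : a.choose (t+1) ≤ (a+1).choose (t+1) := Nat.choose_le_choose _ (by omega)
  obtain ⟨b, hb⟩ : ∃ b, b + t = a + 1 := ⟨a+1-t, by omega⟩
  obtain ⟨c, hc⟩ : ∃ c, c + t = N := ⟨N-t, by omega⟩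
  rw [show N - t = c by omega] at e1
  rw [show a + 1 - t = b by omega] at e2
  have hpos : 0 < b * N := by
    apply Nat.mul_pos <;> omega
  have key : b * N ≤ (a+2) * c := by nlinarith
  generalize a.choose (t+1) = f0 at *
  generalize (a+1).choose (t+1) = f1 at *
  generalize (a+2).choose (t+1) = f2 at *
  generalize N.choose t = d1 at *
  generalize (N-1).choose t = d2 at *
  refine Nat.le_of_mul_le_mul_right ?_ hpos
  calc f0 * d1 * (b * N) ≤ f0 * d1 * ((a+2) * c) := Nat.mul_le_mul_left _ key
    _ = (f0 * (a+2)) * (d1 * c) := by ring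
    _ ≤ (f1 * (a+2)) * (d1 * c) := by gcongr
    _ = (f2 * b) * (d2 * N) := by rw [e2, e1]
    _ = f2 * d2 * (b * N) := by ring

lemma caseB (a t : ℕ) (h : a + 3 < (t+1) ^ 2) :
    a.choose (t+2) ≤ a * a.choose t := by
  have e1 := Nat.choose_succ_right_eq a (t+1)
  have e2 := Nat.choose_succ_right_eq a t
  have h1 : a - (t+1) ≤ a := by omega
  have h2 : a - t ≤ a := by omega
  generalize a.choose (t+1+1) = f0 at *
  generalize a.choose (t+1) = f1 at *
  generalize a.choose t = f2 at *
  generalize a - (t+1) = b at *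
  generalize a - t = c at *
  have hpos : 0 < (t+1+1) * (t+1) := by positivity
  refine Nat.le_of_mul_le_mul_right ?_ hpos
  calc f0 * ((t+1+1)*(t+1)) = (f0 * (t+1+1)) * (t+1) := by ring
    _ = (f1 * (t+1)) * b := by rw [e1]; ring
    _ = f2 * c * b := by rw [e2]
    _ ≤ f2 * a * a := by gcongr
    _ ≤ f2 * a * ((t+1+1)*(t+1)) := by
      apply Nat.mul_le_mul_left; nlinarith
    _ = _ := by ring

lemma conv_alg (f0 g0 Δ D d1 d2 a : ℕ) (hD : a * d1 ≤ D)
    (h : f0 * d1 ≤ (f0 + g0 + (g0 + Δ)) * d2 ∨ f0 ≤ a * Δ) :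
    2 * ((f0 + g0) * (D + d1)) ≤ f0 * D + (f0 + g0 + (g0 + Δ)) * (D + d1 + d2) := by
  have : f0 * d1 ≤ Δ * D + (f0 + g0 + (g0 + Δ)) * d2 := by
    rcases h with h | h
    · exact h.trans (by simp)
    · calc f0 * d1 ≤ a * Δ * d1 := by gcongr
        _ = Δ * (a * d1) := by ring
        _ ≤ Δ * D := by gcongr
        _ ≤ _ := by simp
  nlinarith [Nat.zero_le (Δ * d1)]

lemma gss_convex (n k a s : ℕ) (hs : 1 ≤ s) (hkn : k ≤ n) (ha : a + 2 ≤ (k-1)/2) :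
    2 * gss n k (a+1) s ≤ gss n k a s + gss n k (a+2) s := by
  obtain ⟨t, rfl⟩ : ∃ t, s = t + 1 := ⟨s-1, by omega⟩
  obtain ⟨c, hc⟩ : ∃ c, (2 * (t+1)).choose (t+1) = 2 * c := by
    have := Nat.two_dvd_centralBinom_succ t
    rwa [Nat.centralBinom] at this
  unfold gss
  simp only [← Finset.mul_sum, hc]
  have hE : ∀ x : ℕ, x * (2 * c) / 2 = x * c := by
    intro x; rw [show x * (2*c) = x * c * 2 by ring]; simp
  simp only [hE]
  simp only [show ∀ x : ℕ, x + 1 - 1 = x by intro x; omega]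
  have hE2 := Nat.mul_le_mul_right c (choose_convex (k - a - 2) (2 * (t+1)) (by omega))
  rw [show k - a - 2 + 1 = k - (a+1) by omega, show k - a - 2 + 2 = k - a by omega,
    show k - a - 2 = k - (a+2) by omega] at hE2
  set D := ∑ i ∈ Finset.Icc 1 (n - k + a), (n - (t+1) - i).choose t with hDdef
  rw [show n - k + (a+2) = n - k + a + 1 + 1 by omega, show n - k + (a+1) = n - k + a + 1 by omega]
  rw [Finset.sum_Icc_succ_top (b := n - k + a + 1) (by omega) _,
    Finset.sum_Icc_succ_top (b := n - k + a) (by omega) _, ← hDdef]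
  set d1 := (n - (t+1) - (n - k + a + 1)).choose t with hd1
  set d2 := (n - (t+1) - (n - k + a + 1 + 1)).choose t with hd2
  have hD : a * d1 ≤ D := by
    have h1 : (Finset.Icc 1 (n - k + a)).card • d1 ≤ D := by
      apply Finset.card_nsmul_le_sum
      intro i hi
      simp only [Finset.mem_Icc] at hi
      exact Nat.choose_le_choose _ (by omega)
    simp only [Nat.card_Icc, smul_eq_mul] at h1
    refine le_trans ?_ h1
    gcongr; omega
  have p1 : (a+1).choose (t+1) = a.choose (t+1) + a.choose t := by
    rw [Nat.choose_succ_succ]; simp; ring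
  obtain ⟨Δ, hΔ, hΔ'⟩ : ∃ Δ, (a+1).choose t = a.choose t + Δ ∧
      (∀ t', t = t' + 1 → Δ = a.choose t') := by
    cases t with
    | zero => exact ⟨0, by simp, by intro t' h; omega⟩
    | succ t' =>
      refine ⟨a.choose t', by rw [Nat.choose_succ_succ]; simp; ring, ?_⟩
      intro t'' h; rw [show t' = t'' by omega]
  have p2 : (a+2).choose (t+1) = a.choose (t+1) + a.choose t + (a.choose t + Δ) := by
    rw [show a + 2 = (a+1) + 1 by omega, Nat.choose_succ_succ, ← hΔ]
    simp only [Nat.succ_eq_add_one]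
    rw [p1]; ring
  have main := conv_alg (a.choose (t+1)) (a.choose t) Δ D d1 d2 a hD (by
    rw [← p2]
    rcases Nat.lt_or_ge (a+3) (t^2) with h | h
    · right
      cases t with
      | zero => simp at h
      | succ t' =>
        rw [hΔ' t' rfl]
        exact caseB a t' h
    · rcases Nat.lt_or_ge a (t+1) with hat | hat
      · left; rw [Nat.choose_eq_zero_of_lt hat]; simp
      left
      have := caseA a t (n - (t+1) - (n - k + a + 1)) h (by omega)
      rwa [show n - (t+1) - (n - k + a + 1) - 1 = n - (t+1) - (n - k + a + 1 + 1) by omega] at this)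
  rw [p1, p2]
  nlinarith
end conv

section counting
variable {V : Type*} [DecidableEq V]

/-- ordered pairs of sides of copies of `K_{s,s}` inside `T` -/
def prs (G : SimpleGraph V) [DecidableRel G.Adj] (s : ℕ) (T : Finset V) :
    Finset (Finset V × Finset V) :=
  (T.powersetCard s ×ˢ T.powersetCard s).filter
    (fun p => Disjoint p.1 p.2 ∧ ∀ x ∈ p.1, ∀ y ∈ p.2, G.Adj x y)

lemma mem_prs {G : SimpleGraph V} [DecidableRel G.Adj] {s : ℕ} {T : Finset V}
    {p : Finset V × Finset V} : p ∈ prs G s T ↔ p.1 ⊆ T ∧ p.2 ⊆ T ∧ p.1.card = s ∧ p.2.card = s ∧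
      Disjoint p.1 p.2 ∧ ∀ x ∈ p.1, ∀ y ∈ p.2, G.Adj x y := by
  simp only [prs, Finset.mem_filter, Finset.mem_product, Finset.mem_powersetCard]
  tauto

lemma prs_side {G : SimpleGraph V} [DecidableRel G.Adj] {s a : ℕ} {T : Finset V} {v : V}
    (hs : 1 ≤ s) (hv : v ∈ T) (ha : (T.filter (G.Adj v)).card ≤ a) :
    ((prs G s T).filter (fun p => v ∈ p.1)).card ≤
      a.choose s * (T.card - 1 - s).choose (s - 1) := by
  have hsub : (prs G s T).filter (fun p => v ∈ p.1) ⊆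
      ((T.filter (G.Adj v)).powersetCard s).biUnion (fun B =>
        (((T.erase v) \ B).powersetCard (s-1)).image (fun A => (insert v A, B))) := by
    rintro ⟨A, B⟩ hp
    simp only [Finset.mem_filter, mem_prs] at hp
    obtain ⟨⟨hA, hB, hAs, hBs, hd, hadj⟩, hvA⟩ := hp
    simp only [Finset.mem_biUnion, Finset.mem_powersetCard, Finset.mem_image, Prod.mk.injEq]
    refine ⟨B, ⟨?_, hBs⟩, A.erase v, ⟨?_, ?_⟩, Finset.insert_erase hvA, rfl⟩
    · intro y hy
      simp only [Finset.mem_filter]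
      exact ⟨hB hy, hadj v hvA y hy⟩
    · intro x hx
      have hx' := Finset.mem_erase.1 hx
      simp only [Finset.mem_sdiff, Finset.mem_erase]
      exact ⟨⟨hx'.1, hA hx'.2⟩, Finset.disjoint_left.1 hd hx'.2⟩
    · rw [Finset.card_erase_of_mem hvA, hAs]
  refine (Finset.card_le_card hsub).trans ?_
  refine (Finset.card_biUnion_le_card_mul _ _ ((T.card - 1 - s).choose (s-1)) ?_).trans ?_
  · intro B hB
    rw [Finset.mem_powersetCard] at hB
    refine Finset.card_image_le.trans ?_
    rw [Finset.card_powersetCard, Finset.card_sdiff_of_subset, Finset.card_erase_of_mem hv, hB.2]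
    intro y hy
    have := hB.1 hy
    simp only [Finset.mem_filter] at this
    exact Finset.mem_erase.2 ⟨this.2.ne', this.1⟩
  · rw [Finset.card_powersetCard]
    gcongr

lemma prs_step {G : SimpleGraph V} [DecidableRel G.Adj] {s a : ℕ} {T : Finset V} {v : V}
    (hs : 1 ≤ s) (hv : v ∈ T) (ha : (T.filter (G.Adj v)).card ≤ a) :
    (prs G s T).card ≤ (prs G s (T.erase v)).card +
      2 * (a.choose s * (T.card - 1 - s).choose (s - 1)) := by
  have h1 := prs_side (G := G) hs hv ha
  have h2 : ((prs G s T).filter (fun p => v ∈ p.2)).card ≤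
      ((prs G s T).filter (fun p => v ∈ p.1)).card := by
    apply Finset.card_le_card_of_injOn Prod.swap
    · rintro ⟨A, B⟩ hp
      simp only [Finset.mem_coe, Finset.mem_filter, mem_prs, Prod.fst_swap, Prod.snd_swap] at hp ⊢
      obtain ⟨⟨hA, hB, hAs, hBs, hd, hadj⟩, hvA⟩ := hp
      exact ⟨⟨hB, hA, hBs, hAs, hd.symm, fun x hx y hy => (hadj y hy x hx).symm⟩, hvA⟩
    · exact Prod.swap_injective.injOn
  have h3 : prs G s T ⊆ prs G s (T.erase v) ∪ ((prs G s T).filter (fun p => v ∈ p.1) ∪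
      (prs G s T).filter (fun p => v ∈ p.2)) := by
    intro p hp
    simp only [Finset.mem_union, Finset.mem_filter]
    by_cases hp1 : v ∈ p.1
    · tauto
    by_cases hp2 : v ∈ p.2
    · tauto
    left
    rw [mem_prs] at hp ⊢
    obtain ⟨hA, hB, h⟩ := hp
    exact ⟨Finset.subset_erase.2 ⟨hA, hp1⟩, Finset.subset_erase.2 ⟨hB, hp2⟩, h⟩
  have h4 := Finset.card_le_card h3
  have h5 := Finset.card_union_le (prs G s (T.erase v)) ((prs G s T).filter (fun p => v ∈ p.1) ∪
      (prs G s T).filter (fun p => v ∈ p.2))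
  have h6 := Finset.card_union_le ((prs G s T).filter (fun p => v ∈ p.1))
    ((prs G s T).filter (fun p => v ∈ p.2))
  omega

lemma prs_card_le (G : SimpleGraph V) [DecidableRel G.Adj] (s : ℕ) (T : Finset V) :
    (prs G s T).card ≤ T.card.choose (2 * s) * (2 * s).choose s := by
  have hsub : prs G s T ⊆ (T.powersetCard s).biUnion (fun A =>
        ((T \ A).powersetCard s).image (fun B => (A, B))) := by
    rintro ⟨A, B⟩ hp
    rw [mem_prs] at hp
    obtain ⟨hA, hB, hAs, hBs, hd, hadj⟩ := hp
    simp only [Finset.mem_biUnion, Finset.mem_powersetCard, Finset.mem_image, Prod.mk.injEq]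
    refine ⟨A, ⟨hA, hAs⟩, B, ⟨?_, hBs⟩, rfl, rfl⟩
    intro x hx
    exact Finset.mem_sdiff.2 ⟨hB hx, Finset.disjoint_right.1 hd hx⟩
  refine (Finset.card_le_card hsub).trans ?_
  refine (Finset.card_biUnion_le_card_mul _ _ ((T.card - s).choose s) ?_).trans ?_
  · intro A hA
    rw [Finset.mem_powersetCard] at hA
    refine Finset.card_image_le.trans ?_
    rw [Finset.card_powersetCard, Finset.card_sdiff_of_subset hA.1, hA.2]
  · rw [Finset.card_powersetCard]
    rcases Nat.lt_or_ge T.card (2 * s) with h | h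
    · rw [Nat.choose_eq_zero_of_lt (show T.card - s < s by omega)]
      simp
    · rw [Nat.choose_mul (by omega), show 2 * s - s = s by omega]

lemma peel [Fintype V] {G : SimpleGraph V} [DecidableRel G.Adj] {s a : ℕ} (hs : 1 ≤ s)
    (H : Finset V) (hH : IsCore G a H) (j : ℕ) (hj : j + H.card ≤ Fintype.card V) :
    ∃ T, H ⊆ T ∧ T.card + j = Fintype.card V ∧ (prs G s Finset.univ).card ≤ (prs G s T).card +
      2 * ∑ i ∈ Finset.Icc 1 j, a.choose s * (Fintype.card V - s - i).choose (s-1) := by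
  induction j with
  | zero => exact ⟨Finset.univ, by simp, by simp, by simp⟩
  | succ j ih =>
    obtain ⟨T, hHT, hTc, hN⟩ := ih (by omega)
    obtain ⟨v, hv, hva⟩ : ∃ v ∈ T, (T.filter (G.Adj v)).card ≤ a := by
      by_contra hcon
      push Not at hcon
      have := Finset.card_le_card (hH.2 T hcon)
      omega
    have hvH : v ∉ H := by
      intro h
      have := hH.1 v h
      have := Finset.card_le_card (Finset.filter_subset_filter (G.Adj v) hHT)
      omega
    refine ⟨T.erase v, Finset.subset_erase.2 ⟨hHT, hvH⟩, ?_, ?_⟩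
    · have := Finset.card_erase_add_one hv
      omega
    · have := prs_step (G := G) hs hv hva
      rw [Finset.sum_Icc_succ_top (by omega)]
      rw [show T.card - 1 - s = Fintype.card V - s - (j+1) by omega] at this
      omega

/-- The counting conclusion for a core. -/
lemma count_le [Fintype V] {G : SimpleGraph V} [DecidableRel G.Adj] {s a k : ℕ} (hs : 1 ≤ s)
    (H : Finset V) (hH : IsCore G a H) (hak : a ≤ k) (hk : k ≤ Fintype.card V)
    (hHc : H.card ≤ k - a) : (prs G s Finset.univ).card / 2 ≤ gss (Fintype.card V) k a s := by
  obtain ⟨T, hHT, hTc, hN⟩ := peel (s := s) hs H hH (Fintype.card V - k + a) (by omega)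
  have h1 := prs_card_le G s T
  rw [show T.card = k - a by omega] at h1
  unfold gss
  omega

end counting

lemma IsTwoConnected.tc {V : Type*} [Fintype V] [DecidableEq V] {G : SimpleGraph V}
    (h : IsTwoConnected G) : TC G := by
  intro b u w hu hw
  have hc := h.2 b
  have hu' : u ∈ ((⊤ : G.Subgraph).deleteVerts {b}).verts := by simp [hu]
  have hw' : w ∈ ((⊤ : G.Subgraph).deleteVerts {b}).verts := by simp [hw]
  obtain ⟨p⟩ := hc.preconnected ⟨u, hu'⟩ ⟨w, hw'⟩
  have hb : b ∉ (p.map ((⊤ : G.Subgraph).deleteVerts {b}).hom).support := by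
    rw [SimpleGraph.Walk.support_map]
    intro hmem
    rw [List.mem_map] at hmem
    obtain ⟨⟨x, hx⟩, -, hxb⟩ := hmem
    simp at hx hxb
    exact hx hxb
  have hb' : b ∉ (p.map ((⊤ : G.Subgraph).deleteVerts {b}).hom).bypass.support :=
    fun h => hb (SimpleGraph.Walk.support_bypass_subset_support _ h)
  obtain ⟨S, h1, -, h3⟩ := PO.ofWalk _ (SimpleGraph.Walk.bypass_isPath
    (p.map ((⊤ : G.Subgraph).deleteVerts {b}).hom))
  exact ⟨S, h1, by rwa [← h3]⟩

lemma kss_le {V : Type*} [Fintype V] [DecidableEq V] (G G' : SimpleGraph V) [DecidableRel G'.Adj]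
    (hG : G ≤ G') (s : ℕ) : kssCount G s ≤ (prs G' s Finset.univ).card / 2 := by
  unfold kssCount
  apply Nat.div_le_div_right
  rw [← Set.ncard_coe_finset]
  apply Set.ncard_le_ncard
  · intro p hp
    rw [Finset.mem_coe, mem_prs]
    obtain ⟨h1, h2, h3, h4⟩ := hp
    exact ⟨by simp, by simp, h1, h2, h3, fun x hx y hy => hG (h4 x hx y hy)⟩
  · exact Set.toFinite _

lemma kss_zero {V : Type*} [Fintype V] (G : SimpleGraph V) : kssCount G 0 = 0 := by
  unfold kssCount
  have : ({p : Finset V × Finset V | p.1.card = 0 ∧ p.2.card = 0 ∧ Disjoint p.1 p.2 ∧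
      ∀ x ∈ p.1, ∀ y ∈ p.2, G.Adj x y} : Set (Finset V × Finset V)) ⊆ {(∅, ∅)} := by
    rintro ⟨A, B⟩ ⟨h1, h2, -⟩
    simp at h1 h2
    simp [h1, h2]
  have h := Set.ncard_le_ncard this
  rw [Set.ncard_singleton] at h
  omega

/-- Let `G` be a 2-connected graph on `n` vertices with minimum degree `≥ r ≥ 2`, where
`n ≥ k ≥ 5`; set `h = ⌊(k-1)/2⌋`. If the number of copies of `K_{s,s}` in `G` exceeds
`max {g_{s,s}(n,k,r), g_{s,s}(n,k,h)}`, then `G` contains a cycle of length at least `k`. -/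
theorem stmt_16 {V : Type*} [Fintype V] [DecidableEq V]
    (G : SimpleGraph V) [DecidableRel G.Adj] (n k r s : ℕ)
    (hcard : Fintype.card V = n)
    (h2conn : IsTwoConnected G)
    (hr : 2 ≤ r) (hδ : ∀ v : V, r ≤ G.degree v)
    (hk : 5 ≤ k) (hkn : k ≤ n)
    (hcount : max (gss n k r s) (gss n k ((k - 1) / 2) s) < kssCount G s) :
    ∃ (v : V) (c : G.Walk v v), c.IsCycle ∧ k ≤ c.length := by
  classical
  by_contra hno
  have hs : 1 ≤ s := by
    rcases Nat.eq_zero_or_pos s with rfl | h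
    · rw [kss_zero] at hcount; omega
    · exact h
  obtain ⟨G', hGG', hmax⟩ := (Set.toFinite {G' : SimpleGraph V |
    ¬ ∃ (v : V) (c : G'.Walk v v), c.IsCycle ∧ k ≤ c.length}).exists_le_maximal hno
  have hno' := hmax.prop
  simp only [Set.mem_ofPred_eq] at hno'
  have hTC : TC G' := by
    intro b u w hu hw
    obtain ⟨S, h1, h2⟩ := h2conn.tc b u w hu hw
    exact ⟨S, h1.mono hGG', h2⟩
  have hsat : ∀ x y, x ≠ y → ¬ G'.Adj x y → ∃ S, PO G' x y S ∧ k ≤ S.card := by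
    intro x y hxy hadj
    refine sat_path x y hxy hno' ?_
    by_contra hcon
    have h1 : G' ⊔ SimpleGraph.edge x y ≤ G' := hmax.le_of_ge hcon le_sup_left
    apply hadj
    apply h1
    simp [SimpleGraph.edge_adj, hxy]
  have hcyc : ¬ Cyc G' k := fun h => hno' (h.toCycle (by omega))
  have hle := kss_le G G' hGG' s
  subst hcard
  obtain ⟨H, hH⟩ := exists_core G' ((k-1)/2)
  rcases H.eq_empty_or_nonempty with rfl | hne
  · have := count_le (k := k) hs ∅ hH (by omega) hkn (by simp)
    omega
  obtain ⟨hq1, hq2, hcore⟩ := structure_lem hTC k hk hsat hcyc H hH hne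
  have hc := count_le (k := k) hs H hcore (by omega) hkn (by omega)
  have hra : r ≤ k - H.card := by
    by_contra hlt
    have huniv := hcore.2 Finset.univ (by
      intro v _
      have h1 := hδ v
      have h2 : G.degree v ≤ (Finset.univ.filter (G'.Adj v)).card := by
        rw [← SimpleGraph.card_neighborFinset_eq_degree]
        apply Finset.card_le_card
        intro x hx
        rw [SimpleGraph.mem_neighborFinset] at hx
        simp [hGG' hx]
      omega)
    have := Finset.card_le_card huniv
    rw [Finset.card_univ] at this
    omega
  have := convex_max (fun a => gss (Fintype.card V) k a s) r ((k-1)/2) (by omega)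
    (fun a _ h2 => gss_convex _ k a s hs hkn h2) (k - H.card) hra (by omega)
  omega
end
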